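/- arXiv:2509.00887 — 4 statements merged into one kernel-verified Lean document; each statement's English description precedes it below -/
import Mathlib

section
/- Let k be an algebraically closed field of characteristic p > 0, let A' → A be a surjective local homomorphism of artinian local k-algebras with residue field k, and let T be a formally smooth k-algebra. Then the induced group homomorphism HS^{A'}(T) → HS^A(T) (base change along A' → A) is surjective: every A-algebra automorphism of A ⊗_k T that induces the identity modulo the maximal ideal of A lifts to an A'-algebra automorphism of A' ⊗_k T inducing the identity modulo the maximal ideal of A'. -/
open scoped TensorProduct

universe u

/-- An algebra endomorphism that is the identity modulo a nilpotent ideal of the base ring is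
bijective. -/
theorem AlgHom.bijective_of_sub_mem_map_of_isNilpotent {B P : Type*} [CommRing B] [CommRing P]
    [Algebra B P] {I : Ideal B} (hI : IsNilpotent I) (E : P →ₐ[B] P)
    (hE : ∀ z, E z - z ∈ I.map (algebraMap B P)) : Function.Bijective E := by
  obtain ⟨n, hn⟩ := hI
  set N : Module.End B P := E.toLinearMap - 1 with hN
  have hN_top : (⊤ : Submodule B P).map N ≤ I • ⊤ := by
    rintro _ ⟨z, -, rfl⟩
    rw [Ideal.smul_top_eq_map]
    exact hE z
  have hN_pow (m : ℕ) (z : P) : (N ^ m) z ∈ (I ^ m • ⊤ : Submodule B P) := by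
    induction m with
    | zero => rw [pow_zero, pow_zero, Ideal.one_eq_top, Submodule.top_smul]; trivial
    | succ m ih =>
      have h : N ((N ^ m) z) ∈ (I ^ m • ⊤ : Submodule B P).map N :=
        Submodule.mem_map_of_mem ih
      rw [Submodule.map_smul''] at h
      rw [pow_succ' N, Module.End.mul_apply, pow_succ I, mul_smul]
      exact Submodule.smul_mono le_rfl hN_top h
  have hN_nil : IsNilpotent N := ⟨n, LinearMap.ext fun z ↦ by simpa [hn] using hN_pow n z⟩
  have hE_unit : IsUnit (E.toLinearMap : Module.End B P) := by
    have h := hN_nil.isUnit_add_one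
    rwa [hN, sub_add_cancel] at h
  exact (Module.End.isUnit_iff _).mp hE_unit

/-- Let `f : A' → A` be a surjective local homomorphism of artinian
local `k`-algebras with residue field `k`, and let `T` be a formally smooth
`k`-algebra.  Every `A`-algebra automorphism `D` of `A ⊗_k T` inducing the identity
modulo `m_A` lifts to an `A'`-algebra automorphism `E` of `A' ⊗_k T` inducing the
identity modulo `m_{A'}`, i.e. the base-change map `HS^{A'}(T) → HS^A(T)` is
surjective. -/
theorem hs_artinian_lift_of_formallySmooth
    (k : Type u) [Field k] [IsAlgClosed k] (p : ℕ) [Fact p.Prime] [CharP k p]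
    (A : Type u) [CommRing A] [Algebra k A] [IsArtinianRing A] [IsLocalRing A]
    (hA : Function.Bijective (algebraMap k (IsLocalRing.ResidueField A)))
    (A' : Type u) [CommRing A'] [Algebra k A'] [IsArtinianRing A'] [IsLocalRing A']
    (hA' : Function.Bijective (algebraMap k (IsLocalRing.ResidueField A')))
    (f : A' →ₐ[k] A) (hf : Function.Surjective f) (hfl : IsLocalHom f.toRingHom)
    (T : Type u) [CommRing T] [Algebra k T] [Algebra.FormallySmooth k T]
    (D : (A ⊗[k] T) ≃ₐ[A] (A ⊗[k] T))
    (hD : ∀ z : A ⊗[k] T, D z - z ∈ (IsLocalRing.maximalIdeal A).map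
        (Algebra.TensorProduct.includeLeftRingHom : A →+* A ⊗[k] T)) :
    ∃ E : (A' ⊗[k] T) ≃ₐ[A'] (A' ⊗[k] T),
      (∀ z : A' ⊗[k] T, E z - z ∈ (IsLocalRing.maximalIdeal A').map
          (Algebra.TensorProduct.includeLeftRingHom : A' →+* A' ⊗[k] T)) ∧
      ∀ z : A' ⊗[k] T,
        Algebra.TensorProduct.map f (AlgHom.id k T) (E z) =
          D (Algebra.TensorProduct.map f (AlgHom.id k T) z) := by
  have hI : IsNilpotent (IsLocalRing.maximalIdeal A') := by
    rw [← IsLocalRing.jacobson_eq_maximalIdeal ⊥ bot_ne_top]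
    exact IsArtinianRing.isNilpotent_jacobson_bot
  set π : A' ⊗[k] T →ₐ[k] A ⊗[k] T := Algebra.TensorProduct.map f (AlgHom.id k T) with hπ_def
  set J : Ideal (A' ⊗[k] T) := (IsLocalRing.maximalIdeal A').map
    (Algebra.TensorProduct.includeLeftRingHom : A' →+* A' ⊗[k] T) with hJ
  have hπ : Function.Surjective π := TensorProduct.map_surjective hf Function.surjective_id
  have hker : RingHom.ker π ≤ J := by
    rw [hπ_def, Algebra.TensorProduct.rTensor_ker f hf]
    exact Ideal.map_mono (IsLocalRing.le_maximalIdeal (RingHom.ker_ne_top f))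
  have hJ_nil : IsNilpotent J := by
    obtain ⟨n, hn⟩ := hI
    exact ⟨n, by rw [hJ, ← Ideal.map_pow, hn]; exact Ideal.map_bot⟩
  have hker_nil : IsNilpotent (RingHom.ker π) := by
    obtain ⟨n, hn⟩ := hJ_nil
    exact ⟨n, le_bot_iff.mp ((Ideal.pow_right_mono hker n).trans hn.le)⟩
  let h : T →ₐ[k] A' ⊗[k] T := Algebra.FormallySmooth.liftOfSurjective
    ((D.toAlgHom.restrictScalars k).comp Algebra.TensorProduct.includeRight) π hπ hker_nil
  have hh (t : T) : π (h t) = D (1 ⊗ₜ t) :=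
    Algebra.FormallySmooth.liftOfSurjective_apply _ π hπ hker_nil t
  let E : A' ⊗[k] T →ₐ[A'] A' ⊗[k] T :=
    Algebra.TensorProduct.lift (Algebra.ofId A' _) h fun _ _ ↦ Commute.all _ _
  have hE_tmul (a : A') (t : T) : E (a ⊗ₜ t) = (a ⊗ₜ[k] (1 : T)) * h t := by
    simp [E, Algebra.ofId_apply]
  have hπE (z : A' ⊗[k] T) : π (E z) = D (π z) := by
    induction z with
    | zero => simp
    | add x y hx hy => simp only [map_add, hx, hy]
    | tmul a t =>
      have ha : (f a ⊗ₜ[k] t : A ⊗[k] T) = f a • (1 ⊗ₜ t) := by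
        rw [TensorProduct.smul_tmul', smul_eq_mul, mul_one]
      rw [hE_tmul, map_mul, hh]
      simp only [hπ_def, Algebra.TensorProduct.map_tmul, AlgHom.coe_id, id_eq]
      rw [ha, map_smul, Algebra.smul_def]
      simp
  have hmap : (IsLocalRing.maximalIdeal A).map
      (Algebra.TensorProduct.includeLeftRingHom : A →+* A ⊗[k] T) ≤ J.map π.toRingHom := by
    have hcomp : π.toRingHom.comp Algebra.TensorProduct.includeLeftRingHom =
        (Algebra.TensorProduct.includeLeftRingHom : A →+* A ⊗[k] T).comp f.toRingHom := by
      ext a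
      simp [hπ_def]
    rw [hJ, Ideal.map_map, hcomp, ← Ideal.map_map]
    refine Ideal.map_mono fun a ha ↦ ?_
    obtain ⟨b, rfl⟩ := hf a
    exact Ideal.mem_map_of_mem f.toRingHom
      (((IsLocalRing.local_hom_TFAE f.toRingHom).out 0 4).mp hfl ▸ ha)
  have hE (z : A' ⊗[k] T) : E z - z ∈ J := by
    have hz : π (E z - z) ∈ J.map π.toRingHom := by
      rw [map_sub, hπE]
      exact hmap (hD _)
    obtain ⟨w, hw, hwz⟩ := (Ideal.mem_map_iff_of_surjective π.toRingHom hπ).mp hz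
    have hsub : E z - z - w ∈ J := hker (by
      rw [RingHom.mem_ker, map_sub, sub_eq_zero]
      exact hwz.symm)
    simpa using J.add_mem hsub hw
  exact ⟨AlgEquiv.ofBijective E (E.bijective_of_sub_mem_map_of_isNilpotent hI hE), hE, hπE⟩
end

section
/- Let k be an algebraically closed field of characteristic p > 0, let A be an artinian local k-algebra with residue field k, let T be a formally smooth k-algebra, I ⊆ T an ideal, and R := T/I. Then every D ∈ HS^A(R) lifts to an element E ∈ HS^A(T): there exists an A-algebra automorphism E of A ⊗_k T inducing the identity modulo m_A, such that E maps the ideal A ⊗_k I of A ⊗_k T into itself and the automorphism of A ⊗_k R ≅ (A ⊗_k T)/(A ⊗_k I) induced by E equals D. -/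
open scoped TensorProduct

universe u

/-- An endomorphism of a module that is congruent to the identity modulo a nilpotent ideal is
bijective. -/
theorem Module.End.bijective_of_sub_mem_smul_top {A M : Type*} [CommRing A] [AddCommGroup M]
    [Module A M] {m : Ideal A} (hm : IsNilpotent m) (f : Module.End A M)
    (hf : ∀ x, f x - x ∈ m • (⊤ : Submodule A M)) : Function.Bijective f := by
  obtain ⟨n, hn⟩ := hm
  have key : ∀ (i : ℕ) (x : M), ((f - 1) ^ i) x ∈ m ^ i • (⊤ : Submodule A M) := by
    intro i
    induction i with
    | zero => simp
    | succ i ih =>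
      intro x
      have hmap : (m • (⊤ : Submodule A M)).map ((f - 1) ^ i) ≤ m ^ (i + 1) • ⊤ := by
        rw [Submodule.map_smul'', pow_succ', Submodule.mul_smul]
        refine Submodule.smul_mono le_rfl ?_
        rintro _ ⟨y, -, rfl⟩
        exact ih y
      rw [pow_succ]
      exact hmap ⟨(f - 1) x, hf x, rfl⟩
  have hnil : IsNilpotent (f - 1) :=
    ⟨n, LinearMap.ext fun x => by simpa [hn] using key n x⟩
  have hunit : IsUnit f := by simpa using hnil.isUnit_one_add
  exact (Module.End.isUnit_iff f).mp hunit

/-- A homomorphism from a formally smooth algebra that lifts modulo a nilpotent ideal, up to the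
image of that ideal, along a surjection lifts compatibly with the given lift. -/
theorem Algebra.FormallySmooth.exists_lift_congr {k T B S : Type*} [CommRing k] [CommRing T]
    [Algebra k T] [Algebra.FormallySmooth k T] [CommRing B] [Algebra k B] [CommRing S]
    [Algebra k S] {M : Ideal B} (hM : IsNilpotent M) (π : B →ₐ[k] S)
    (hπ : Function.Surjective π) (s : T →ₐ[k] B) (d : T →ₐ[k] S)
    (hd : ∀ t, d t - π (s t) ∈ M.map (π : B →+* S)) :
    ∃ e : T →ₐ[k] B, (∀ t, e t - s t ∈ M) ∧ ∀ t, π (e t) = d t := by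
  let f : B →ₐ[k] (B ⧸ M) × S := (Ideal.Quotient.mkₐ k M).prod π
  let g : T →ₐ[k] (B ⧸ M) × S := ((Ideal.Quotient.mkₐ k M).comp s).prod d
  have hg : ∀ t, g t ∈ f.range := by
    intro t
    obtain ⟨y, hy, hyd⟩ := (Ideal.mem_map_iff_of_surjective (π : B →+* S) hπ).mp (hd t)
    refine ⟨s t + y, Prod.ext ?_ ?_⟩
    · exact Ideal.Quotient.eq.mpr (by simpa using hy)
    · change π (s t + y) = d t
      rw [map_add, show π y = _ from hyd, add_sub_cancel]
  have hker : IsNilpotent (RingHom.ker (f.rangeRestrict : B →+* f.range)) := by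
    obtain ⟨n, hn⟩ := hM
    refine ⟨n, le_bot_iff.mp ((Ideal.pow_right_mono ?_ n).trans hn.le)⟩
    intro z hz
    exact Ideal.Quotient.eq_zero_iff_mem.mp (congrArg (fun w : f.range => w.1.1) hz)
  refine ⟨Algebra.FormallySmooth.liftOfSurjective (g.codRestrict f.range hg)
    f.rangeRestrict f.rangeRestrict_surjective hker, ?_⟩
  have he := fun t => congrArg Subtype.val
    (Algebra.FormallySmooth.liftOfSurjective_apply (g.codRestrict f.range hg)
      f.rangeRestrict f.rangeRestrict_surjective hker t)
  exact ⟨fun t => Ideal.Quotient.eq.mp (congrArg Prod.fst (he t)),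
    fun t => congrArg Prod.snd (he t)⟩

/-- Let `A` be an artinian local `k`-algebra with residue field `k`,
`T` a formally smooth `k`-algebra, `I ⊆ T` an ideal and `R = T/I`.  Every
`D ∈ HS^A(R)` (an `A`-algebra automorphism of `A ⊗_k R` inducing the identity
modulo `m_A`) lifts to some `E ∈ HS^A(T)` preserving the ideal `A ⊗_k I` and
inducing `D` on `A ⊗_k R`. -/
theorem hs_artinian_lift_of_quotient
    (k : Type u) [Field k] [IsAlgClosed k] (p : ℕ) [Fact p.Prime] [CharP k p]
    (A : Type u) [CommRing A] [Algebra k A] [IsArtinianRing A] [IsLocalRing A]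
    (hA : Function.Bijective (algebraMap k (IsLocalRing.ResidueField A)))
    (T : Type u) [CommRing T] [Algebra k T] [Algebra.FormallySmooth k T]
    (I : Ideal T)
    (D : (A ⊗[k] (T ⧸ I)) ≃ₐ[A] (A ⊗[k] (T ⧸ I)))
    (hD : ∀ z : A ⊗[k] (T ⧸ I), D z - z ∈ (IsLocalRing.maximalIdeal A).map
        (Algebra.TensorProduct.includeLeftRingHom : A →+* A ⊗[k] (T ⧸ I)))
    : ∃ E : (A ⊗[k] T) ≃ₐ[A] (A ⊗[k] T),
      (∀ z : A ⊗[k] T, E z - z ∈ (IsLocalRing.maximalIdeal A).map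
          (Algebra.TensorProduct.includeLeftRingHom : A →+* A ⊗[k] T)) ∧
      (∀ z ∈ I.map (Algebra.TensorProduct.includeRight : T →ₐ[k] A ⊗[k] T).toRingHom,
        E z ∈ I.map (Algebra.TensorProduct.includeRight : T →ₐ[k] A ⊗[k] T).toRingHom) ∧
      (∀ z : A ⊗[k] T,
        Algebra.TensorProduct.map (AlgHom.id k A) (Ideal.Quotient.mkₐ k I) (E z) =
          D (Algebra.TensorProduct.map (AlgHom.id k A) (Ideal.Quotient.mkₐ k I) z)) := by
  let π : A ⊗[k] T →ₐ[A] A ⊗[k] (T ⧸ I) :=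
    Algebra.TensorProduct.map (AlgHom.id A A) (Ideal.Quotient.mkₐ k I)
  have hπ_apply : ∀ z, Algebra.TensorProduct.map (AlgHom.id k A) (Ideal.Quotient.mkₐ k I) z = π z :=
    fun _ => rfl
  have hπ : Function.Surjective π :=
    LinearMap.lTensor_surjective A (g := (Ideal.Quotient.mkₐ k I).toLinearMap)
      (Ideal.Quotient.mkₐ_surjective k I)
  have hker : ∀ z, π z = 0 ↔
      z ∈ I.map (Algebra.TensorProduct.includeRight : T →ₐ[k] A ⊗[k] T).toRingHom := by
    intro z
    have h := Algebra.TensorProduct.lTensor_ker (A := A) (Ideal.Quotient.mkₐ k I)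
      (Ideal.Quotient.mkₐ_surjective k I)
    rw [show RingHom.ker (Ideal.Quotient.mkₐ k I) = I from Ideal.mk_ker] at h
    exact iff_of_eq (congrArg (z ∈ ·) h)
  set M : Ideal (A ⊗[k] T) := (IsLocalRing.maximalIdeal A).map
    (Algebra.TensorProduct.includeLeftRingHom : A →+* A ⊗[k] T) with hM
  have hmnil : IsNilpotent (IsLocalRing.maximalIdeal A) := by
    rw [← IsLocalRing.jacobson_eq_maximalIdeal ⊥ bot_ne_top]
    exact IsArtinianRing.isNilpotent_jacobson_bot
  have hMnil : IsNilpotent M := hmnil.map (Ideal.mapHom _)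
  have hmap : (IsLocalRing.maximalIdeal A).map
      (Algebra.TensorProduct.includeLeftRingHom : A →+* A ⊗[k] (T ⧸ I)) =
        M.map (π.restrictScalars k : A ⊗[k] T →+* A ⊗[k] (T ⧸ I)) := by
    rw [hM, Ideal.map_map]
    congr 1
  obtain ⟨e, heM, heD⟩ := Algebra.FormallySmooth.exists_lift_congr hMnil (π.restrictScalars k) hπ
    Algebra.TensorProduct.includeRight
    (((D.toAlgHom.comp π).restrictScalars k).comp Algebra.TensorProduct.includeRight)
    (fun t => hmap ▸ hD (π (1 ⊗ₜ t)))
  let E : A ⊗[k] T →ₐ[A] A ⊗[k] T := Algebra.TensorProduct.lift (Algebra.ofId A _) e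
    fun _ _ => Commute.all _ _
  have hEt : ∀ t, E (1 ⊗ₜ t) = e t := fun t => by
    simp [E, ← Algebra.TensorProduct.one_def]
  have hEM : ∀ z, E z - z ∈ M := by
    intro z
    have h : (Ideal.Quotient.mkₐ A M).comp E = Ideal.Quotient.mkₐ A M := by
      ext t
      change Ideal.Quotient.mk M (E (1 ⊗ₜ t)) = Ideal.Quotient.mk M (1 ⊗ₜ t)
      rw [hEt]
      exact Ideal.Quotient.eq.mpr (heM t)
    exact Ideal.Quotient.eq.mp (DFunLike.congr_fun h z)
  have hED : ∀ z, π (E z) = D (π z) := by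
    have h : π.comp E = D.toAlgHom.comp π := by
      ext t
      change π (E (1 ⊗ₜ t)) = D (π (1 ⊗ₜ t))
      rw [hEt]
      exact heD t
    exact DFunLike.congr_fun h
  have hbij : Function.Bijective E := by
    have h : ∀ z, E.toLinearMap z - z ∈ IsLocalRing.maximalIdeal A • (⊤ : Submodule A (A ⊗[k] T)) := by
      intro z
      rw [Ideal.smul_top_eq_map]
      exact hEM z
    exact Module.End.bijective_of_sub_mem_smul_top hmnil E.toLinearMap h
  refine ⟨AlgEquiv.ofBijective E hbij, hEM, fun z hz => ?_, fun z => ?_⟩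
  · rw [← hker] at hz ⊢
    exact (hED z).trans (by rw [hz, map_zero])
  · rw [hπ_apply, hπ_apply]
    exact hED z
end

section
/- Let k be an algebraically closed field of characteristic p > 0, let Ψ : 0 → k·s → A₂ →^g A₁ → 0 be a small extension of artinian local k-algebras with residue field k, let T be a formally smooth k-algebra, I ⊆ T an ideal, and R := T/I. Let D₁, D₂, D₃ ∈ HS^{A₁}(R) and let E₁, E₂, E₃ ∈ HS^{A₂}(T) be lifts of D₁, D₂, D₃ respectively (meaning: for each i, the base change g_*(E_i) ∈ HS^{A₁}(T) maps the ideal A₁ ⊗_k I into itself and induces D_i on A₁ ⊗_k R). Suppose E₂ maps the ideal A₂ ⊗_k I of A₂ ⊗_k T into itself, and suppose d ∈ Der_k(T, T) is such that d⟨s⟩ ∘ E₁ ∘ E₃ maps A₂ ⊗_k I into itself. Then d⟨s⟩ ∘ E₁ ∘ E₂ ∘ E₃ also maps A₂ ⊗_k I into itself (hence induces an element of HS^{A₂}(R)). -/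
open scoped TensorProduct

universe u

section InsertionLemma

open Algebra.TensorProduct IsLocalRing

variable {k A T : Type*} [CommRing k] [CommRing A] [Algebra k A] [CommRing T] [Algebra k T]

/-- The ideal `𝔪 ⊗ T` of `A ⊗ T` generated by an ideal `𝔪` of `A`. -/
local notation "extL" => Ideal.map (includeLeftRingHom : A →+* A ⊗[k] T)

/-- The ideal `A ⊗ I` of `A ⊗ T` generated by an ideal `I` of `T`. -/
local notation "extR" => Ideal.map (AlgHom.toRingHom (includeRight : T →ₐ[k] A ⊗[k] T))

/-- If `A = k + 𝔪`, then every element of `A ⊗ I` is of the form `1 ⊗ i` with `i ∈ I`,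
up to `(𝔪 ⊗ T) * (A ⊗ I)`. -/
lemma exists_sub_one_tmul_mem_mul_of_mem_map (ε : A →ₐ[k] k) (I : Ideal T) {z : A ⊗[k] T}
    (hz : z ∈ extR I) :
    ∃ i ∈ I, z - 1 ⊗ₜ i ∈ extL (RingHom.ker ε) * extR I := by
  refine Submodule.span_induction (fun x hx => ?_) ?_ (fun x y _ _ hx hy => ?_)
    (fun a x hx h => ?_) hz
  · obtain ⟨i, hi, rfl⟩ := hx
    exact ⟨i, hi, by simp⟩
  · exact ⟨0, I.zero_mem, by simp⟩
  · obtain ⟨i, hi, hx⟩ := hx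
    obtain ⟨j, hj, hy⟩ := hy
    refine ⟨i + j, I.add_mem hi hj, ?_⟩
    rw [TensorProduct.tmul_add, add_sub_add_comm]
    exact Ideal.add_mem _ hx hy
  · obtain ⟨i, hi, hxi⟩ := h
    induction a using TensorProduct.induction_on with
    | zero => exact ⟨0, I.zero_mem, by simp⟩
    | tmul a t =>
      refine ⟨ε a • (t * i), Submodule.smul_of_tower_mem I _ (I.mul_mem_left t hi), ?_⟩
      have hdecomp : (a ⊗ₜ[k] t) • x - 1 ⊗ₜ[k] (ε a • (t * i)) =
          (a ⊗ₜ[k] t) * (x - 1 ⊗ₜ i) +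
            (a - algebraMap k A (ε a)) ⊗ₜ[k] 1 * 1 ⊗ₜ[k] (t * i) := by
        rw [TensorProduct.tmul_smul, TensorProduct.smul_tmul', smul_eq_mul, mul_sub,
          tmul_mul_tmul, tmul_mul_tmul, mul_one, mul_one, one_mul, TensorProduct.sub_tmul,
          Algebra.algebraMap_eq_smul_one, sub_add_sub_cancel]
      rw [hdecomp]
      refine Ideal.add_mem _ (Ideal.mul_mem_left _ _ hxi) (Ideal.mul_mem_mul ?_ ?_)
      · exact Ideal.mem_map_of_mem includeLeftRingHom (by simp [RingHom.mem_ker])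
      · exact Ideal.mem_map_of_mem (includeRight : T →ₐ[k] A ⊗[k] T).toRingHom
          (I.mul_mem_left t hi)
    | add a b ha hb =>
      obtain ⟨i, hi, ha⟩ := ha
      obtain ⟨j, hj, hb⟩ := hb
      refine ⟨i + j, I.add_mem hi hj, ?_⟩
      rw [TensorProduct.tmul_add, add_smul, add_sub_add_comm]
      exact Ideal.add_mem _ ha hb

/-- For an augmented `k`-algebra `A` with augmentation ideal `𝔪`, the intersection of `𝔪 ⊗ T` and
`A ⊗ I` is their product. -/
lemma map_ker_inf_map_le_mul (ε : A →ₐ[k] k) (I : Ideal T) :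
    extL (RingHom.ker ε) ⊓ extR I ≤ extL (RingHom.ker ε) * extR I := by
  rintro z ⟨hzm, hzI⟩
  obtain ⟨i, -, hi⟩ := exists_sub_one_tmul_mem_mul_of_mem_map ε I hzI
  let π : A ⊗[k] T →ₐ[k] T := lift ((Algebra.ofId k T).comp ε) (AlgHom.id k T)
    fun _ _ => Commute.all _ _
  have hπ : extL (RingHom.ker ε) ≤ RingHom.ker π := by
    refine Ideal.map_le_iff_le_comap.2 fun a ha => ?_
    rw [RingHom.mem_ker] at ha
    simp [π, RingHom.mem_ker, ha]
  have hi0 : i = 0 := by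
    have hdiff : π (z - 1 ⊗ₜ i) = 0 := hπ (Ideal.mul_le_left (J := extR I) hi)
    have hz : π z = 0 := hπ hzm
    simpa [hz, π] using hdiff
  simpa [hi0] using hi

/-- If `s` is killed by `𝔪`, then `s ⊗ 1` is killed by `𝔪 ⊗ T`. -/
lemma map_mul_span_tmul_one_eq_bot {m : Ideal A} {s : A} (hsm : ∀ b ∈ m, b * s = 0) :
    extL m * Ideal.span {s ⊗ₜ[k] (1 : T)} = ⊥ := by
  rw [← Set.image_singleton (f := fun a : A => a ⊗ₜ[k] (1 : T)),
    show (fun a : A => a ⊗ₜ[k] (1 : T)) = (includeLeftRingHom : A →+* A ⊗[k] T) from rfl,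
    ← Ideal.map_span, ← Ideal.map_mul]
  suffices m * Ideal.span {s} = ⊥ by rw [this, Ideal.map_bot]
  rw [eq_bot_iff, Ideal.mul_le]
  intro b hb c hc
  obtain ⟨a, rfl⟩ := Ideal.mem_span_singleton'.1 hc
  rw [mul_left_comm, hsm b hb, mul_zero, Submodule.mem_bot]

/-- Modulo the kernel of the surjection `A ⊗ T → A' ⊗ T`, membership in `A ⊗ I` can be checked in
`A' ⊗ T`. -/
lemma mem_map_sup_span_of_map_mem {A' : Type*} [CommRing A'] [Algebra k A'] (g : A →ₐ[k] A')
    (hg : Function.Surjective g) {s : A} (hker : RingHom.ker g.toRingHom = Ideal.span {s})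
    (I : Ideal T) {z : A ⊗[k] T}
    (hz : map g (AlgHom.id k T) z ∈
      I.map (includeRight : T →ₐ[k] A' ⊗[k] T).toRingHom) :
    z ∈ extR I ⊔ Ideal.span {s ⊗ₜ[k] (1 : T)} := by
  let G : A ⊗[k] T →+* A' ⊗[k] T := (map g (AlgHom.id k T)).toRingHom
  have hG : Function.Surjective G := by
    exact TensorProduct.map_surjective (g := g.toLinearMap) (g' := LinearMap.id (M := T)) hg
      Function.surjective_id
  have hcomp : (includeRight : T →ₐ[k] A' ⊗[k] T).toRingHom =
      G.comp (includeRight : T →ₐ[k] A ⊗[k] T).toRingHom := by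
    ext t
    simp [G]
  have hkerG : Ideal.comap G ⊥ = Ideal.span {s ⊗ₜ[k] (1 : T)} := by
    change RingHom.ker (map g (AlgHom.id k T)) = _
    refine (rTensor_ker (R := k) (C := T) g hg).trans ?_
    change Ideal.map _ (RingHom.ker g.toRingHom) = _
    rw [hker, Ideal.map_span, Set.image_singleton]
    rfl
  rw [hcomp, ← Ideal.map_map] at hz
  have hz' : z ∈ Ideal.comap G (Ideal.map G (extR I)) := hz
  rwa [Ideal.comap_map_of_surjective G hG, hkerG] at hz'

/-- An `A`-algebra endomorphism sending each `1 ⊗ x` to `1 ⊗ x + s ⊗ d x` is the identity modulo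
`s`. -/
lemma sub_mem_span_tmul_one {s : A} {d : T → T} (D : A ⊗[k] T →ₐ[A] A ⊗[k] T)
    (hD : ∀ x : T, D (1 ⊗ₜ x) = 1 ⊗ₜ x + s ⊗ₜ d x) (z : A ⊗[k] T) :
    D z - z ∈ Ideal.span {s ⊗ₜ[k] (1 : T)} := by
  induction z using TensorProduct.induction_on with
  | zero => simp
  | tmul a x =>
    have hax : a ⊗ₜ[k] x = a • (1 ⊗ₜ[k] x) := by simp [TensorProduct.smul_tmul']
    have hdiff : D (a ⊗ₜ[k] x) - a ⊗ₜ[k] x = (a ⊗ₜ[k] d x) * (s ⊗ₜ[k] 1) := by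
      rw [hax, map_smul, hD, ← smul_sub, add_sub_cancel_left]
      simp [TensorProduct.smul_tmul']
    rw [hdiff]
    exact Ideal.mul_mem_left _ _ (Ideal.mem_span_singleton_self _)
  | add x y hx hy =>
    rw [map_add, add_sub_add_comm]
    exact Ideal.add_mem _ hx hy

/-- If `s` is killed by `𝔪` and `F` maps `A ⊗ I` into `A ⊗ I + s (A ⊗ T)`, then `F` maps
`(𝔪 ⊗ T) * (A ⊗ I)` into `A ⊗ I`. -/
lemma mem_map_of_mem_mul {m : Ideal A} {s : A} (hsm : ∀ b ∈ m, b * s = 0) {I : Ideal T}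
    (F : A ⊗[k] T →ₐ[A] A ⊗[k] T)
    (hF : ∀ z ∈ extR I, F z ∈ extR I ⊔ Ideal.span {s ⊗ₜ[k] (1 : T)}) {z : A ⊗[k] T}
    (hz : z ∈ extL m * extR I) : F z ∈ extR I := by
  have hFm : extL m ≤ (extL m).comap F := Ideal.map_le_iff_le_comap.2 fun a ha => by
    rw [Ideal.mem_comap, Ideal.mem_comap]
    have hFa : F (includeLeftRingHom a) = includeLeftRingHom a := F.commutes a
    rw [hFa]
    exact Ideal.mem_map_of_mem _ ha
  refine Submodule.mul_induction_on hz (fun w hw j hj => ?_) fun x y hx hy => ?_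
  · have hFw : F w ∈ extL m := hFm hw
    have hprod := Ideal.mul_mem_mul hFw (hF j hj)
    rw [Ideal.mul_sup, map_mul_span_tmul_one_eq_bot hsm, sup_bot_eq] at hprod
    rw [map_mul]
    exact Ideal.mul_le_right (I := extL m) hprod
  · rw [map_add]
    exact Ideal.add_mem _ hx hy

/-- A local `k`-algebra with residue field `k` is augmented over `k`, with augmentation ideal the
maximal ideal. -/
lemma exists_algHom_ker_eq_maximalIdeal [IsLocalRing A]
    (hA : Function.Bijective (algebraMap k (ResidueField A))) :
    ∃ ε : A →ₐ[k] k, RingHom.ker ε = maximalIdeal A := by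
  let e : k ≃ₐ[k] ResidueField A := AlgEquiv.ofBijective (Algebra.ofId k _) hA
  refine ⟨e.symm.toAlgHom.comp (IsScalarTower.toAlgHom k A (ResidueField A)), ?_⟩
  ext a
  rw [RingHom.mem_ker, ← residue_eq_zero_iff]
  exact map_eq_zero_iff e.symm e.symm.injective

end InsertionLemma

/-- Let `Ψ : 0 → k·s → A₂ → A₁ → 0` be a small extension, `T` a
formally smooth `k`-algebra, `I ⊆ T` an ideal, `R = T/I`.  Let
`D₁, D₂, D₃ ∈ HS^{A₁}(R)` with lifts `E₁, E₂, E₃ ∈ HS^{A₂}(T)`.  If `E₂` maps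
`A₂ ⊗ I` into itself and `d⟨s⟩ ∘ E₁ ∘ E₃` maps `A₂ ⊗ I` into itself for a
`k`-derivation `d` of `T`, then `d⟨s⟩ ∘ E₁ ∘ E₂ ∘ E₃` maps `A₂ ⊗ I` into itself. -/
theorem ideal_preserved_insertion_lemma
    (k : Type u) [Field k] [IsAlgClosed k] (p : ℕ) [Fact p.Prime] [CharP k p]
    (A₁ : Type u) [CommRing A₁] [Algebra k A₁] [IsArtinianRing A₁] [IsLocalRing A₁]
    (hA₁ : Function.Bijective (algebraMap k (IsLocalRing.ResidueField A₁)))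
    (A₂ : Type u) [CommRing A₂] [Algebra k A₂] [IsArtinianRing A₂] [IsLocalRing A₂]
    (hA₂ : Function.Bijective (algebraMap k (IsLocalRing.ResidueField A₂)))
    (g : A₂ →ₐ[k] A₁) (hg : Function.Surjective g)
    (s : A₂) (hs : s ≠ 0) (hsm : ∀ b ∈ IsLocalRing.maximalIdeal A₂, b * s = 0)
    (hker : RingHom.ker g.toRingHom = Ideal.span {s})
    (T : Type u) [CommRing T] [Algebra k T] [Algebra.FormallySmooth k T]
    (I : Ideal T)
    (D₁ D₂ D₃ : (A₁ ⊗[k] (T ⧸ I)) ≃ₐ[A₁] (A₁ ⊗[k] (T ⧸ I)))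
    (hD : ∀ Di ∈ [D₁, D₂, D₃], ∀ z : A₁ ⊗[k] (T ⧸ I),
      Di z - z ∈ (IsLocalRing.maximalIdeal A₁).map
        (Algebra.TensorProduct.includeLeftRingHom : A₁ →+* A₁ ⊗[k] (T ⧸ I)))
    (E₁ E₂ E₃ : (A₂ ⊗[k] T) ≃ₐ[A₂] (A₂ ⊗[k] T))
    (hE : ∀ Ei ∈ [E₁, E₂, E₃], ∀ z : A₂ ⊗[k] T,
      Ei z - z ∈ (IsLocalRing.maximalIdeal A₂).map
        (Algebra.TensorProduct.includeLeftRingHom : A₂ →+* A₂ ⊗[k] T))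
    -- each `E_i` is a lift of `D_i` : `g_*(E_i)` preserves `A₁ ⊗ I` and induces `D_i`
    (hlift₁ : ∀ (P : ((A₂ ⊗[k] T) ≃ₐ[A₂] (A₂ ⊗[k] T)) ×
        ((A₁ ⊗[k] (T ⧸ I)) ≃ₐ[A₁] (A₁ ⊗[k] (T ⧸ I)))),
      P ∈ [(E₁, D₁), (E₂, D₂), (E₃, D₃)] → ∀ z : A₂ ⊗[k] T,
        Algebra.TensorProduct.map g (AlgHom.id k T) z ∈
          I.map (Algebra.TensorProduct.includeRight : T →ₐ[k] A₁ ⊗[k] T).toRingHom →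
        Algebra.TensorProduct.map g (AlgHom.id k T) (P.1 z) ∈
          I.map (Algebra.TensorProduct.includeRight : T →ₐ[k] A₁ ⊗[k] T).toRingHom)
    (hlift₂ : ∀ (P : ((A₂ ⊗[k] T) ≃ₐ[A₂] (A₂ ⊗[k] T)) ×
        ((A₁ ⊗[k] (T ⧸ I)) ≃ₐ[A₁] (A₁ ⊗[k] (T ⧸ I)))),
      P ∈ [(E₁, D₁), (E₂, D₂), (E₃, D₃)] → ∀ z : A₂ ⊗[k] T,
        Algebra.TensorProduct.map (AlgHom.id k A₁) (Ideal.Quotient.mkₐ k I)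
            (Algebra.TensorProduct.map g (AlgHom.id k T) (P.1 z)) =
          P.2 (Algebra.TensorProduct.map (AlgHom.id k A₁) (Ideal.Quotient.mkₐ k I)
            (Algebra.TensorProduct.map g (AlgHom.id k T) z)))
    -- `E₂` preserves `A₂ ⊗ I`
    (hE₂I : ∀ z ∈ I.map (Algebra.TensorProduct.includeRight : T →ₐ[k] A₂ ⊗[k] T).toRingHom,
      E₂ z ∈ I.map (Algebra.TensorProduct.includeRight : T →ₐ[k] A₂ ⊗[k] T).toRingHom)
    -- the automorphism `d⟨s⟩` associated to a `k`-derivation `d` of `T`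
    (d : Derivation k T T) (Ds : (A₂ ⊗[k] T) ≃ₐ[A₂] (A₂ ⊗[k] T))
    (hDs : ∀ x : T, Ds ((1 : A₂) ⊗ₜ[k] x) = (1 : A₂) ⊗ₜ[k] x + s ⊗ₜ[k] d x)
    -- `d⟨s⟩ ∘ E₁ ∘ E₃` preserves `A₂ ⊗ I`
    (h13 : ∀ z ∈ I.map (Algebra.TensorProduct.includeRight : T →ₐ[k] A₂ ⊗[k] T).toRingHom,
      Ds (E₁ (E₃ z)) ∈
        I.map (Algebra.TensorProduct.includeRight : T →ₐ[k] A₂ ⊗[k] T).toRingHom) :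
    ∀ z ∈ I.map (Algebra.TensorProduct.includeRight : T →ₐ[k] A₂ ⊗[k] T).toRingHom,
      Ds (E₁ (E₂ (E₃ z))) ∈
        I.map (Algebra.TensorProduct.includeRight : T →ₐ[k] A₂ ⊗[k] T).toRingHom := by
  obtain ⟨ε, hε⟩ := exists_algHom_ker_eq_maximalIdeal hA₂
  set J := I.map (Algebra.TensorProduct.includeRight : T →ₐ[k] A₂ ⊗[k] T).toRingHom with hJ
  set S : Ideal (A₂ ⊗[k] T) := Ideal.span {s ⊗ₜ[k] (1 : T)} with hS
  have hmapJ : ∀ z ∈ J, Algebra.TensorProduct.map g (AlgHom.id k T) z ∈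
      I.map (Algebra.TensorProduct.includeRight : T →ₐ[k] A₁ ⊗[k] T).toRingHom := by
    have hle : J ≤ (I.map (Algebra.TensorProduct.includeRight :
        T →ₐ[k] A₁ ⊗[k] T).toRingHom).comap (Algebra.TensorProduct.map g (AlgHom.id k T)) :=
      Ideal.map_le_iff_le_comap.2 fun t ht => by
        simpa using Ideal.mem_map_of_mem
          (Algebra.TensorProduct.includeRight : T →ₐ[k] A₁ ⊗[k] T).toRingHom ht
    exact fun z hz => hle hz
  have hE₁J : ∀ z ∈ J, E₁ z ∈ J ⊔ S := fun z hz =>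
    mem_map_sup_span_of_map_mem g hg hker I (hlift₁ (E₁, D₁) (by simp) z (hmapJ z hz))
  have hE₃J : ∀ z ∈ J, E₃ z ∈ J ⊔ S := fun z hz =>
    mem_map_sup_span_of_map_mem g hg hker I (hlift₁ (E₃, D₃) (by simp) z (hmapJ z hz))
  have hDsE₁J : ∀ z ∈ J, Ds (E₁ z) ∈ J ⊔ S := fun z hz => by
    rw [← sub_add_cancel (Ds (E₁ z)) (E₁ z)]
    exact Ideal.add_mem _
      (Ideal.mem_sup_right (sub_mem_span_tmul_one Ds.toAlgHom hDs (E₁ z))) (hE₁J z hz)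
  have hE₂S : ∀ y ∈ S, E₂ y = y := fun y hy => by
    obtain ⟨t, rfl⟩ := Ideal.mem_span_singleton'.1 hy
    have hst : E₂ (s ⊗ₜ[k] (1 : T)) = s ⊗ₜ 1 := E₂.commutes s
    have hmul := Ideal.mul_mem_mul (hE E₂ (by simp) t)
      (Ideal.mem_span_singleton_self (s ⊗ₜ[k] (1 : T)))
    rw [map_mul_span_tmul_one_eq_bot hsm, Submodule.mem_bot, sub_mul, sub_eq_zero] at hmul
    rw [map_mul, hst, hmul]
  intro z hz
  obtain ⟨j, hj, y, hy, hjy⟩ := Submodule.mem_sup.1 (hE₃J z hz)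
  have hE₂E₃ : E₂ (E₃ z) = (E₂ j - j) + E₃ z := by
    rw [← hjy, map_add, hE₂S y hy]
    ring
  have hmem : E₂ j - j ∈ (IsLocalRing.maximalIdeal A₂).map
      (Algebra.TensorProduct.includeLeftRingHom : A₂ →+* A₂ ⊗[k] T) * J := by
    have hE₂j := hE E₂ (by simp) j
    rw [← hε] at hE₂j ⊢
    exact map_ker_inf_map_le_mul ε I ⟨hE₂j, Ideal.sub_mem _ (hE₂I j hj) hj⟩
  rw [hE₂E₃, map_add, map_add]
  exact Ideal.add_mem _
    (mem_map_of_mem_mul hsm (E₁.trans Ds).toAlgHom hDsE₁J hmem) (h13 z hz)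
end

section
/- Let k be an algebraically closed field of characteristic p > 0, let R be a finite type k-algebra, and let A be an artinian local k-algebra with residue field k and maximal ideal m_A. Let B be an A-algebra which is flat over A, together with a surjective A-algebra homomorphism π : B → R (R regarded as an A-algebra via A → A/m_A = k) inducing an isomorphism B ⊗_A k ≅ R. Suppose B is locally trivial: there exist f₁, …, f_r ∈ R generating the unit ideal of R, elements g₁, …, g_r ∈ B with π(g_i) = f_i, and for each i an A-algebra isomorphism φ_i : B[1/g_i] → A ⊗_k R[1/f_i] compatible with the natural projections of both sides onto R[1/f_i]. Then B is trivial: there exists an A-algebra isomorphism B → A ⊗_k R compatible with the natural projections of both sides onto R. (This is the affine case of the theorem: every locally trivial deformation of an affine algebraic k-scheme over an artinian local k-algebra with residue field k is trivial.) -/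
open scoped TensorProduct

/-- The natural projection `A ⊗_k L → L` induced by the `k`-point `ε : A → k`
(for `A` local with residue field `k`, this is reduction modulo `m_A`). -/
noncomputable def tensorProj (k : Type*) [Field k] (A : Type*) [CommRing A] [Algebra k A]
    (ε : A →ₐ[k] k) (L : Type*) [CommRing L] [Algebra k L] :
    A ⊗[k] L →ₐ[k] L :=
  (Algebra.TensorProduct.lid k L).toAlgHom.comp
    (Algebra.TensorProduct.map ε (AlgHom.id k L))

namespace AffineDeformation

open scoped Polynomial

section Basic

variable {k : Type*} [Field k] {P : Type*} [CommRing P] [Algebra k P]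
variable {A : Type*} [CommRing A] [Algebra k A]

/-- The extension to `A ⊗ P` of an ideal of the coefficient ring `A`. -/
noncomputable def coeffIdeal (k : Type*) [Field k] (P : Type*) [CommRing P] [Algebra k P]
    {A : Type*} [CommRing A] [Algebra k A] (K : Ideal A) : Ideal (A ⊗[k] P) :=
  K.map (algebraMap A (A ⊗[k] P))

/-- The extension to `A ⊗ P` of an ideal of `P`. -/
noncomputable def baseIdeal (k A : Type*) [Field k] [CommRing A] [Algebra k A]
    {P : Type*} [CommRing P] [Algebra k P] (I : Ideal P) : Ideal (A ⊗[k] P) :=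
  I.map (Algebra.TensorProduct.includeRight : P →ₐ[k] A ⊗[k] P)

/-- The ideal `𝔪I + J` of `A ⊗ P`. -/
noncomputable def errIdeal (k : Type*) [Field k] {P : Type*} [CommRing P] [Algebra k P]
    {A : Type*} [CommRing A] [Algebra k A] (m : Ideal A) (I : Ideal P) (J : Ideal A) :
    Ideal (A ⊗[k] P) :=
  coeffIdeal k P m * baseIdeal k A I ⊔ coeffIdeal k P J

lemma tmul_mem_coeffIdeal {K : Ideal A} {s : A} (hs : s ∈ K) (x : P) :
    s ⊗ₜ[k] x ∈ coeffIdeal k P K := by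
  have h : s ⊗ₜ[k] x = (1 ⊗ₜ[k] x) * algebraMap A (A ⊗[k] P) s := by
    simp [Algebra.TensorProduct.algebraMap_apply]
  rw [h]
  exact Ideal.mul_mem_left _ _ (Ideal.mem_map_of_mem _ hs)

lemma smul_mem_coeffIdeal {K : Ideal A} {s : A} (hs : s ∈ K) (y : A ⊗[k] P) :
    s • y ∈ coeffIdeal k P K := by
  rw [Algebra.smul_def]
  exact Ideal.mul_mem_right _ _ (Ideal.mem_map_of_mem _ hs)

lemma coeffIdeal_mono {K L : Ideal A} (h : K ≤ L) : coeffIdeal k P K ≤ coeffIdeal k P L :=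
  Ideal.map_mono h

lemma coeffIdeal_mul (K L : Ideal A) :
    coeffIdeal k P K * coeffIdeal k P L = coeffIdeal k P (K * L) :=
  (Ideal.map_mul _ _ _).symm

lemma tmul_mem_baseIdeal {I : Ideal P} (a : A) {u : P} (hu : u ∈ I) :
    a ⊗ₜ[k] u ∈ baseIdeal k A I := by
  have h : a ⊗ₜ[k] u = (a ⊗ₜ[k] 1) *
      (Algebra.TensorProduct.includeRight : P →ₐ[k] A ⊗[k] P) u := by simp
  rw [h]
  exact Ideal.mul_mem_left _ _ (Ideal.mem_map_of_mem _ hu)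

lemma tmul_mem_mul {m : Ideal A} {I : Ideal P} {a : A} (ha : a ∈ m) {u : P} (hu : u ∈ I) :
    a ⊗ₜ[k] u ∈ coeffIdeal k P m * baseIdeal k A I := by
  have h : a ⊗ₜ[k] u = (a ⊗ₜ[k] 1) * (1 ⊗ₜ[k] u) := by simp
  rw [h]
  exact Ideal.mul_mem_mul (tmul_mem_coeffIdeal ha 1) (tmul_mem_baseIdeal 1 hu)

lemma map_mem_coeffIdeal {B : Type*} [CommRing B] [Algebra k B] {P' : Type*} [CommRing P']
    [Algebra k P'] (f : A ⊗[k] P →+* B ⊗[k] P') {K : Ideal A} {L : Ideal B}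
    (h : ∀ a ∈ K, f (a ⊗ₜ 1) ∈ coeffIdeal k P' L) {y : A ⊗[k] P}
    (hy : y ∈ coeffIdeal k P K) : f y ∈ coeffIdeal k P' L := by
  have : coeffIdeal k P K ≤ (coeffIdeal k P' L).comap f := by
    refine Ideal.map_le_iff_le_comap.2 fun a ha => ?_
    simpa [Algebra.TensorProduct.algebraMap_apply] using h a ha
  exact this hy

lemma map_mem_coeffIdeal_self (g : A ⊗[k] P →ₐ[A] A ⊗[k] P) {K : Ideal A} {y : A ⊗[k] P}
    (hy : y ∈ coeffIdeal k P K) : g y ∈ coeffIdeal k P K := by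
  refine map_mem_coeffIdeal g.toRingHom (fun a ha => ?_) hy
  have : a ⊗ₜ[k] (1 : P) = algebraMap A (A ⊗[k] P) a := by
    simp [Algebra.TensorProduct.algebraMap_apply]
  rw [this]
  simp only [AlgHom.toRingHom_eq_coe, RingHom.coe_coe, AlgHom.commutes]
  exact Ideal.mem_map_of_mem (algebraMap A (A ⊗[k] P)) ha

/-- Every element of `K ⊗ P + ks ⊗ P` is `s ⊗ w` modulo `K ⊗ P`. -/
lemma exists_tmul_of_mem_coeffIdeal {J J' : Ideal A} {s : A} (hs : s ∈ J)
    (hJ : ∀ a ∈ J, ∃ c : k, a - c • s ∈ J') {y : A ⊗[k] P} (hy : y ∈ coeffIdeal k P J) :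
    ∃ w : P, y - s ⊗ₜ[k] w ∈ coeffIdeal k P J' := by
  refine Submodule.span_induction (p := fun y _ => ∃ w : P, y - s ⊗ₜ[k] w ∈ coeffIdeal k P J')
    ?_ ⟨0, by simp⟩ ?_ ?_ hy
  · rintro _ ⟨a, ha, rfl⟩
    obtain ⟨c, hc⟩ := hJ a ha
    refine ⟨c • 1, ?_⟩
    have := tmul_mem_coeffIdeal (k := k) hc (1 : P)
    rwa [TensorProduct.sub_tmul, TensorProduct.smul_tmul] at this
  · rintro x y _ _ ⟨w, hw⟩ ⟨w', hw'⟩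
    refine ⟨w + w', ?_⟩
    convert add_mem hw hw' using 1
    rw [TensorProduct.tmul_add]; ring
  · rintro z x hx ⟨w, hw⟩
    suffices h : ∃ w' : P, z * s ⊗ₜ[k] w - s ⊗ₜ[k] w' ∈ coeffIdeal k P J' by
      obtain ⟨w', hw'⟩ := h
      refine ⟨w', ?_⟩
      convert add_mem (Ideal.mul_mem_left _ z hw) hw' using 1
      rw [smul_eq_mul]; ring
    clear hx hw
    induction z with
    | zero => exact ⟨0, by simp⟩
    | tmul a b =>
      obtain ⟨c, hc⟩ := hJ (a * s) (J.mul_mem_left _ hs)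
      refine ⟨c • (b * w), ?_⟩
      have := tmul_mem_coeffIdeal (k := k) hc (b * w)
      rwa [TensorProduct.sub_tmul, TensorProduct.smul_tmul,
        ← Algebra.TensorProduct.tmul_mul_tmul] at this
    | add z z' h h' =>
      obtain ⟨w1, h1⟩ := h
      obtain ⟨w2, h2⟩ := h'
      refine ⟨w1 + w2, ?_⟩
      convert add_mem h1 h2 using 1
      rw [TensorProduct.tmul_add]; ring

end Basic

section Endo

variable {k : Type*} [Field k] {P : Type*} [CommRing P] [Algebra k P]
variable {A : Type*} [CommRing A] [Algebra k A]

/-- Two endomorphisms of `A ⊗ P` agree modulo the ideal `K` of `A`. -/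
def CongrMod (K : Ideal A) (g g' : A ⊗[k] P →ₐ[A] A ⊗[k] P) : Prop :=
  ∀ y, g y - g' y ∈ coeffIdeal k P K

/-- `g` maps `u ∈ I` to `u + s ⊗ η(u)` modulo `𝔪I + J`. -/
def Ob (m : Ideal A) (I : Ideal P) (J : Ideal A) (s : A) (η : P → P)
    (g : A ⊗[k] P →ₐ[A] A ⊗[k] P) : Prop :=
  ∀ u ∈ I, g (1 ⊗ₜ u) - 1 ⊗ₜ u - s ⊗ₜ η u ∈ errIdeal k m I J

lemma errIdeal_mono {m : Ideal A} (I : Ideal P) {J J' : Ideal A} (h : J ≤ J') :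
    errIdeal k m I J ≤ errIdeal k m I J' :=
  sup_le_sup_left (coeffIdeal_mono h) _

lemma coeffIdeal_le_errIdeal (m : Ideal A) (I : Ideal P) (J : Ideal A) :
    coeffIdeal k P J ≤ errIdeal k m I J := le_sup_right

lemma tmul_mem_errIdeal {m : Ideal A} {I : Ideal P} (J : Ideal A) {a : A} (ha : a ∈ m) {u : P}
    (hu : u ∈ I) : a ⊗ₜ[k] u ∈ errIdeal k m I J :=
  Ideal.mem_sup_left (tmul_mem_mul ha hu)

lemma CongrMod.refl (K : Ideal A) (g : A ⊗[k] P →ₐ[A] A ⊗[k] P) : CongrMod K g g :=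
  fun y => by simp

lemma CongrMod.symm {K : Ideal A} {g g' : A ⊗[k] P →ₐ[A] A ⊗[k] P} (h : CongrMod K g g') :
    CongrMod K g' g := fun y => by
  rw [← neg_sub]; exact neg_mem (h y)

lemma CongrMod.mono {K L : Ideal A} (hKL : K ≤ L) {g g' : A ⊗[k] P →ₐ[A] A ⊗[k] P}
    (h : CongrMod K g g') : CongrMod L g g' := fun y => coeffIdeal_mono hKL (h y)

lemma CongrMod.mul {K : Ideal A} {g₁ g₁' g₂ g₂' : A ⊗[k] P →ₐ[A] A ⊗[k] P}
    (h₁ : CongrMod K g₁ g₁') (h₂ : CongrMod K g₂ g₂') : CongrMod K (g₁ * g₂) (g₁' * g₂') :=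
  fun y => by
    rw [AlgHom.mul_apply, AlgHom.mul_apply, ← sub_add_sub_cancel _ (g₁ (g₂' y)), ← map_sub]
    exact add_mem (map_mem_coeffIdeal_self _ (h₂ y)) (h₁ _)

lemma CongrMod.sub_mem_mul {K L : Ideal A} {g g' : A ⊗[k] P →ₐ[A] A ⊗[k] P}
    (h : CongrMod L g g') {x : A ⊗[k] P} (hx : x ∈ coeffIdeal k P K) :
    g x - g' x ∈ coeffIdeal k P (K * L) := by
  refine Submodule.span_induction (p := fun x hx => g x - g' x ∈ coeffIdeal k P (K * L))
    ?_ (by simp) ?_ ?_ hx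
  · rintro _ ⟨a, ha, rfl⟩
    rw [AlgHom.commutes, AlgHom.commutes, sub_self]
    exact zero_mem _
  · intro x y _ _ hx hy
    rw [map_add, map_add, add_sub_add_comm]
    exact add_mem hx hy
  · intro z x hx ih
    have : g (z • x) - g' (z • x) = g' z * (g x - g' x) + g x * (g z - g' z) := by
      simp only [smul_eq_mul, map_mul]; ring
    rw [this]
    refine add_mem (Ideal.mul_mem_left _ _ ih) ?_
    rw [← coeffIdeal_mul]
    exact Ideal.mul_mem_mul (map_mem_coeffIdeal_self g hx) (h z)

/-- `g` reduces to the identity modulo `m`. -/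
def Unip (m : Ideal A) (g : A ⊗[k] P →ₐ[A] A ⊗[k] P) : Prop := CongrMod m g 1

lemma Unip.one (m : Ideal A) : Unip m (1 : A ⊗[k] P →ₐ[A] A ⊗[k] P) := CongrMod.refl _ _

lemma Unip.mul {m : Ideal A} {g g' : A ⊗[k] P →ₐ[A] A ⊗[k] P} (h : Unip m g) (h' : Unip m g') :
    Unip m (g * g') := by
  have := CongrMod.mul h h'
  rwa [mul_one] at this

lemma span_singleton_mul_le {m J : Ideal A} {s : A} (hs : ∀ a ∈ m, a * s ∈ J) :
    Ideal.span {s} * m ≤ J := by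
  rw [Ideal.mul_le]
  intro r hr a ha
  obtain ⟨c, rfl⟩ := Ideal.mem_span_singleton'.1 hr
  have : c * s * a = c * (a * s) := by ring
  rw [this]
  exact J.mul_mem_left _ (hs a ha)

lemma Unip.tmul_sub_mem {m J : Ideal A} {s : A} (hs : ∀ a ∈ m, a * s ∈ J)
    {g : A ⊗[k] P →ₐ[A] A ⊗[k] P} (h : Unip m g) (x : P) :
    g (s ⊗ₜ x) - s ⊗ₜ x ∈ coeffIdeal k P J :=
  coeffIdeal_mono (span_singleton_mul_le hs)
    (CongrMod.sub_mem_mul h (tmul_mem_coeffIdeal (Ideal.mem_span_singleton_self s) x))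

lemma Ob.map_mem_errIdeal {m J : Ideal A} {I : Ideal P} {s : A} (hs : ∀ a ∈ m, a * s ∈ J)
    {η : P → P} {g : A ⊗[k] P →ₐ[A] A ⊗[k] P} (h : Ob m I J s η g) {z : A ⊗[k] P}
    (hz : z ∈ errIdeal k m I J) : g z ∈ errIdeal k m I J := by
  suffices H : errIdeal k m I J ≤ (errIdeal k m I J).comap g from H hz
  refine sup_le ?_ fun x hx => coeffIdeal_le_errIdeal _ _ _ (map_mem_coeffIdeal_self g hx)
  have hT : baseIdeal k A I ≤
      (baseIdeal k A I ⊔ coeffIdeal k P (Ideal.span {s} ⊔ J)).comap g := by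
    refine Ideal.map_le_iff_le_comap.2 fun u hu => ?_
    have h1 : errIdeal k m I J ≤ baseIdeal k A I ⊔ coeffIdeal k P (Ideal.span {s} ⊔ J) :=
      sup_le_sup Ideal.mul_le_right (coeffIdeal_mono le_sup_right)
    have h2 := h1 (h u hu)
    have h3 : s ⊗ₜ[k] η u ∈ baseIdeal k A I ⊔ coeffIdeal k P (Ideal.span {s} ⊔ J) :=
      Ideal.mem_sup_right (tmul_mem_coeffIdeal
        (Ideal.mem_sup_left (Ideal.mem_span_singleton_self s)) _)
    have h4 : (1 : A) ⊗ₜ[k] u ∈ baseIdeal k A I ⊔ coeffIdeal k P (Ideal.span {s} ⊔ J) :=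
      Ideal.mem_sup_left (tmul_mem_baseIdeal 1 hu)
    have h5 := add_mem (add_mem h2 h3) h4
    simpa using h5
  rw [Ideal.mul_le]
  intro x hx y hy
  have h1 : g (x * y) ∈ coeffIdeal k P m *
      (baseIdeal k A I ⊔ coeffIdeal k P (Ideal.span {s} ⊔ J)) := by
    rw [map_mul]
    exact Ideal.mul_mem_mul (map_mem_coeffIdeal_self g hx) (hT hy)
  refine (?_ : _ ≤ errIdeal k m I J) h1
  rw [Ideal.mul_sup, coeffIdeal_mul, Ideal.mul_sup, mul_comm m (Ideal.span {s})]
  exact sup_le_sup le_rfl (coeffIdeal_mono (sup_le (span_singleton_mul_le hs) Ideal.mul_le_right))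

lemma Ob.mul {m J : Ideal A} {I : Ideal P} {s : A} (hs : ∀ a ∈ m, a * s ∈ J)
    {η₁ η₂ : P → P} {g₁ g₂ : A ⊗[k] P →ₐ[A] A ⊗[k] P} (hg : Unip m g₁)
    (h₁ : Ob m I J s η₁ g₁) (h₂ : Ob m I J s η₂ g₂) : Ob m I J s (η₁ + η₂) (g₁ * g₂) := by
  intro u hu
  have e1 := h₁.map_mem_errIdeal hs (h₂ u hu)
  have e2 := coeffIdeal_le_errIdeal m I J (hg.tmul_sub_mem hs (η₂ u))
  convert add_mem (add_mem e1 e2) (h₁ u hu) using 1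
  simp only [map_sub, AlgHom.mul_apply, Pi.add_apply, TensorProduct.tmul_add]
  ring

lemma Ob.one (m : Ideal A) (I : Ideal P) (J : Ideal A) (s : A) :
    Ob m I J s 0 (1 : A ⊗[k] P →ₐ[A] A ⊗[k] P) := fun u _ => by simp

lemma Ob.congr {m J : Ideal A} {I : Ideal P} {s : A} {η : P → P}
    {g g' : A ⊗[k] P →ₐ[A] A ⊗[k] P} (h : Ob m I J s η g) (hg : CongrMod J g' g) :
    Ob m I J s η g' := fun u hu => by
  convert add_mem (coeffIdeal_le_errIdeal m I J (hg (1 ⊗ₜ u))) (h u hu) using 1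
  ring

lemma Ob.mono {m J J' : Ideal A} (hJ : J ≤ J') {I : Ideal P} {s : A} {η : P → P}
    {g : A ⊗[k] P →ₐ[A] A ⊗[k] P} (h : Ob m I J s η g) : Ob m I J' s η g :=
  fun u hu => errIdeal_mono I hJ (h u hu)

/-- `g` preserves `I` modulo `𝔪I + J`. -/
abbrev Pres (m : Ideal A) (I : Ideal P) (J : Ideal A) (g : A ⊗[k] P →ₐ[A] A ⊗[k] P) : Prop :=
  Ob m I J 0 0 g

lemma Ob.change {m J : Ideal A} {I : Ideal P} {s s' : A} {η η' : P → P}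
    {g : A ⊗[k] P →ₐ[A] A ⊗[k] P} (h : Ob m I J s η g)
    (h' : ∀ u ∈ I, s ⊗ₜ[k] η u - s' ⊗ₜ[k] η' u ∈ errIdeal k m I J) : Ob m I J s' η' g :=
  fun u hu => by
    convert add_mem (h u hu) (h' u hu) using 1
    ring

lemma Ob.pres {m J : Ideal A} {I : Ideal P} {s : A} {η : P → P}
    {g : A ⊗[k] P →ₐ[A] A ⊗[k] P} (h : Ob m I J s η g) (hs : s ∈ J) : Pres m I J g :=
  h.change fun u _ => by
    simpa using coeffIdeal_le_errIdeal m I J (tmul_mem_coeffIdeal hs (η u))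

lemma Pres.mul {m J : Ideal A} {I : Ideal P} {g₁ g₂ : A ⊗[k] P →ₐ[A] A ⊗[k] P} (hg : Unip m g₁)
    (h₁ : Pres m I J g₁) (h₂ : Pres m I J g₂) : Pres m I J (g₁ * g₂) := by
  have := Ob.mul (s := 0) (by simp) hg h₁ h₂
  rwa [add_zero] at this

lemma Pres.ob (m : Ideal A) {J J' : Ideal A} {I : Ideal P} {s : A} (hs : s ∈ J)
    (hJ : ∀ a ∈ J, ∃ c : k, a - c • s ∈ J')
    {g : A ⊗[k] P →ₐ[A] A ⊗[k] P} (h : Pres m I J g) : ∃ η : P → P, Ob m I J' s η g := by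
  have : ∀ u : P, ∃ w : P, u ∈ I → g (1 ⊗ₜ u) - 1 ⊗ₜ u - s ⊗ₜ w ∈ errIdeal k m I J' := by
    intro u
    by_cases hu : u ∈ I
    · have h1 := h u hu
      obtain ⟨x, hx, y, hy, hxy⟩ := Submodule.mem_sup.1 h1
      obtain ⟨w, hw⟩ := exists_tmul_of_mem_coeffIdeal hs hJ hy
      refine ⟨w, fun _ => Submodule.mem_sup.2 ⟨x, hx, _, hw, ?_⟩⟩
      rw [← add_sub_assoc, hxy]
      simp
    · exact ⟨0, fun h => absurd h hu⟩
  choose η hη using this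
  exact ⟨η, fun u hu => hη u hu⟩

lemma Pres.ob_iff_zero {m J : Ideal A} {I : Ideal P} {s : A} {g : A ⊗[k] P →ₐ[A] A ⊗[k] P} :
    Ob m I J s 0 g ↔ Pres m I J g := by
  simp [Ob]

end Endo

section Poly

variable {k : Type*} [Field k] {σ : Type*} {A : Type*} [CommRing A] [Algebra k A]

lemma algHom_ext_X {B : Type*} [CommRing B] [Algebra A B]
    {f g : A ⊗[k] MvPolynomial σ k →ₐ[A] B}
    (h : ∀ j, f (1 ⊗ₜ MvPolynomial.X j) = g (1 ⊗ₜ MvPolynomial.X j)) : f = g := by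
  let _ : Algebra k B := Algebra.compHom B (algebraMap k A)
  have _ : IsScalarTower k A B := IsScalarTower.of_algebraMap_eq fun _ => rfl
  refine Algebra.TensorProduct.ext (by ext) ?_
  refine MvPolynomial.algHom_ext fun j => ?_
  simpa using h j

lemma congrMod_of_X {K : Ideal A}
    {g g' : A ⊗[k] MvPolynomial σ k →ₐ[A] A ⊗[k] MvPolynomial σ k}
    (h : ∀ j, g (1 ⊗ₜ MvPolynomial.X j) - g' (1 ⊗ₜ MvPolynomial.X j) ∈
      coeffIdeal k (MvPolynomial σ k) K) : CongrMod K g g' := by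
  have : (Ideal.Quotient.mkₐ A (coeffIdeal k (MvPolynomial σ k) K)).comp g =
      (Ideal.Quotient.mkₐ A (coeffIdeal k (MvPolynomial σ k) K)).comp g' :=
    algHom_ext_X fun j => by
      simpa using Ideal.Quotient.eq.2 (h j)
  intro y
  exact Ideal.Quotient.eq.1 (by simpa using DFunLike.congr_fun this y)

/-- On the variables, `g'` and `g` differ by `s ⊗ v` modulo `J`. -/
def Dif (J : Ideal A) (s : A) (v : σ → MvPolynomial σ k)
    (g' g : A ⊗[k] MvPolynomial σ k →ₐ[A] A ⊗[k] MvPolynomial σ k) : Prop :=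
  ∀ j, g' (1 ⊗ₜ MvPolynomial.X j) - g (1 ⊗ₜ MvPolynomial.X j) - s ⊗ₜ v j ∈
    coeffIdeal k (MvPolynomial σ k) J

lemma Dif.congrMod {J K : Ideal A} {s : A} {v : σ → MvPolynomial σ k}
    {g' g : A ⊗[k] MvPolynomial σ k →ₐ[A] A ⊗[k] MvPolynomial σ k} (h : Dif J s v g' g)
    (hJ : J ≤ K) (hs : s ∈ K) : CongrMod K g' g :=
  congrMod_of_X fun j => by
    have := add_mem (coeffIdeal_mono hJ (h j)) (tmul_mem_coeffIdeal (k := k) hs (v j))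
    simpa using this

lemma Dif.refl (J : Ideal A) (s : A)
    (g : A ⊗[k] MvPolynomial σ k →ₐ[A] A ⊗[k] MvPolynomial σ k) : Dif J s 0 g g :=
  fun j => by simp

lemma dif_zero_iff {J : Ideal A} {s : A}
    {g' g : A ⊗[k] MvPolynomial σ k →ₐ[A] A ⊗[k] MvPolynomial σ k} :
    Dif J s 0 g' g ↔ CongrMod J g' g :=
  ⟨fun h => congrMod_of_X fun j => by simpa using h j, fun h j => by simpa using h _⟩

lemma Dif.mul {m J : Ideal A} {s : A} (hs : ∀ a ∈ m, a * s ∈ J)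
    {v₁ v₂ : σ → MvPolynomial σ k}
    {g₁' g₁ g₂' g₂ : A ⊗[k] MvPolynomial σ k →ₐ[A] A ⊗[k] MvPolynomial σ k}
    (hg₁ : Unip m g₁') (hg₂ : Unip m g₂) (h₁ : Dif J s v₁ g₁' g₁) (h₂ : Dif J s v₂ g₂' g₂) :
    Dif J s (v₁ + v₂) (g₁' * g₂') (g₁ * g₂) := by
  intro j
  have e1 := map_mem_coeffIdeal_self g₁' (h₂ j)
  have e2 := hg₁.tmul_sub_mem hs (v₂ j)
  have e3 : CongrMod (Ideal.span {s} ⊔ J) g₁' g₁ :=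
    h₁.congrMod le_sup_right (Ideal.mem_sup_left (Ideal.mem_span_singleton_self s))
  have e4 := e3.sub_mem_mul (hg₂ (1 ⊗ₜ MvPolynomial.X j))
  have e5 : m * (Ideal.span {s} ⊔ J) ≤ J := by
    rw [Ideal.mul_sup, mul_comm m (Ideal.span {s})]
    exact sup_le (span_singleton_mul_le hs) Ideal.mul_le_right
  convert add_mem (add_mem (add_mem e1 e2) (coeffIdeal_mono e5 e4)) (h₁ j) using 1
  simp only [map_sub, AlgHom.mul_apply, Pi.add_apply, TensorProduct.tmul_add, AlgHom.one_apply]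
  ring

end Poly

section Curve

variable {k : Type*} [Field k] {P : Type*} [CommRing P] [Algebra k P]
variable {A : Type*} [CommRing A] [Algebra k A]

/-- The ideal `(X ^ n)` of `k[X]`. -/
noncomputable def XI (k : Type*) [Field k] (n : ℕ) : Ideal k[X] :=
  Ideal.span {Polynomial.X ^ n}

lemma mem_XI {n : ℕ} {q : k[X]} : q ∈ XI k n ↔ Polynomial.X ^ n ∣ q :=
  Ideal.mem_span_singleton

lemma XI_antitone {n m : ℕ} (h : n ≤ m) : XI k m ≤ XI k n := fun _ hq =>
  mem_XI.2 ((pow_dvd_pow _ h).trans (mem_XI.1 hq))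

lemma X_pow_mem_XI {n m : ℕ} (h : n ≤ m) : (Polynomial.X ^ m : k[X]) ∈ XI k n :=
  mem_XI.2 (pow_dvd_pow _ h)

lemma X_mem_XI : (Polynomial.X : k[X]) ∈ XI k 1 :=
  mem_XI.2 (by simp)

lemma mul_mem_XI {n m l : ℕ} (h : l ≤ n + m) {a b : k[X]} (ha : a ∈ XI k n) (hb : b ∈ XI k m) :
    a * b ∈ XI k l :=
  XI_antitone h (mem_XI.2 (by
    rw [pow_add]; exact mul_dvd_mul (mem_XI.1 ha) (mem_XI.1 hb)))

lemma XI_one_mul_X_pow (n : ℕ) : ∀ a ∈ XI k 1, a * Polynomial.X ^ n ∈ XI k (n + 1) :=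
  fun _ ha => mul_mem_XI (by omega) ha (X_pow_mem_XI le_rfl)

/-- Induction principle for membership in an extended ideal. -/
lemma coeffIdeal_induction {K : Ideal A} {p : A ⊗[k] P → Prop} (h0 : p 0)
    (hadd : ∀ x y, p x → p y → p (x + y)) (ht : ∀ a ∈ K, ∀ x : P, p (a ⊗ₜ x))
    {y : A ⊗[k] P} (hy : y ∈ coeffIdeal k P K) : p y := by
  have h : ∀ z, p (z * y) := by
    refine Submodule.span_induction (p := fun y _ => ∀ z, p (z * y)) ?_ ?_ ?_ ?_ hy
    · rintro _ ⟨a, ha, rfl⟩ z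
      induction z with
      | zero => simpa using h0
      | tmul b x =>
        simpa [Algebra.TensorProduct.algebraMap_apply] using ht (b * a) (K.mul_mem_left _ ha) x
      | add x y hx hy => rw [add_mul]; exact hadd _ _ hx hy
    · intro z
      simpa using h0
    · intro x y _ _ hx hy z
      rw [mul_add]; exact hadd _ _ (hx z) (hy z)
    · intro c x _ hx z
      rw [smul_eq_mul, ← mul_assoc]; exact hx _
  simpa using h 1

/-- Specialisation `X ↦ a`. -/
noncomputable def ev (k : Type*) [Field k] (P : Type*) [CommRing P] [Algebra k P]
    {A : Type*} [CommRing A] [Algebra k A] (a : A) :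
    k[X] ⊗[k] P →ₐ[k] A ⊗[k] P :=
  Algebra.TensorProduct.map (Polynomial.aeval a) (AlgHom.id k P)

@[simp] lemma ev_tmul (a : A) (q : k[X]) (x : P) :
    ev k P a (q ⊗ₜ x) = Polynomial.aeval a q ⊗ₜ x := by
  simp [ev]

lemma ev_mem_coeffIdeal {a : A} {K : Ideal k[X]} {L : Ideal A}
    (h : ∀ q ∈ K, Polynomial.aeval a q ∈ L) {y : k[X] ⊗[k] P} (hy : y ∈ coeffIdeal k P K) :
    ev k P a y ∈ coeffIdeal k P L :=
  map_mem_coeffIdeal (ev k P a).toRingHom (fun q hq => by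
    simpa using tmul_mem_coeffIdeal (k := k) (h q hq) (1 : P)) hy

lemma aeval_mem_of_mem_XI {a : A} {n : ℕ} {L : Ideal A} (h : a ^ n ∈ L) {q : k[X]}
    (hq : q ∈ XI k n) : Polynomial.aeval a q ∈ L := by
  obtain ⟨q, rfl⟩ := mem_XI.1 hq
  simpa using L.mul_mem_right _ h

lemma ev_mem_errIdeal {a : A} {m J : Ideal A} (ha : a ∈ m) {n : ℕ} (hn : a ^ n ∈ J)
    {I : Ideal P} {y : k[X] ⊗[k] P} (hy : y ∈ errIdeal k (XI k 1) I (XI k n)) :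
    ev k P a y ∈ errIdeal k m I J := by
  suffices H : errIdeal k (XI k 1) I (XI k n) ≤ (errIdeal k m I J).comap (ev k P a) from H hy
  refine sup_le (Ideal.mul_le.2 fun x hx y hy => ?_) fun x hx =>
    coeffIdeal_le_errIdeal _ _ _ (ev_mem_coeffIdeal (fun q hq => aeval_mem_of_mem_XI hn hq) hx)
  have hy' : baseIdeal k k[X] I ≤ (baseIdeal k A I).comap (ev k P a) :=
    Ideal.map_le_iff_le_comap.2 fun u hu => by
      simpa using tmul_mem_baseIdeal (k := k) (1 : A) hu
  rw [Ideal.mem_comap, map_mul]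
  exact Ideal.mem_sup_left (Ideal.mul_mem_mul
    (ev_mem_coeffIdeal (fun q hq => aeval_mem_of_mem_XI (by simpa using ha) hq) hx) (hy' hy))

/-- The endomorphism of `A ⊗ P` determined by its restriction to `P`. -/
noncomputable def ofHom (h : P →ₐ[k] A ⊗[k] P) : A ⊗[k] P →ₐ[A] A ⊗[k] P :=
  Algebra.TensorProduct.lift (Algebra.ofId A _) h (fun _ _ => Commute.all _ _)

@[simp] lemma ofHom_one_tmul (h : P →ₐ[k] A ⊗[k] P) (x : P) : ofHom h (1 ⊗ₜ x) = h x := by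
  rw [ofHom, Algebra.TensorProduct.lift_tmul, map_one, one_mul]

/-- The value at `a` of a one-parameter family of endomorphisms. -/
noncomputable def spec (E : k[X] ⊗[k] P →ₐ[k[X]] k[X] ⊗[k] P) (a : A) :
    A ⊗[k] P →ₐ[A] A ⊗[k] P :=
  ofHom (((ev k P a).comp (E.restrictScalars k)).comp Algebra.TensorProduct.includeRight)

@[simp] lemma spec_one_tmul (E : k[X] ⊗[k] P →ₐ[k[X]] k[X] ⊗[k] P) (a : A) (x : P) :
    spec E a (1 ⊗ₜ x) = ev k P a (E (1 ⊗ₜ x)) := by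
  simp [spec]

lemma ob_spec {m J : Ideal A} {I : Ideal P} {q : k[X]} {n : ℕ} {η : P → P}
    {E : k[X] ⊗[k] P →ₐ[k[X]] k[X] ⊗[k] P} (h : Ob (XI k 1) I (XI k n) q η E) {a : A}
    (ha : a ∈ m) (hn : a ^ n ∈ J) :
    Ob m I J (Polynomial.aeval a q) η (spec E a) := fun u hu => by
  simpa using ev_mem_errIdeal ha hn (h u hu)

lemma pres_spec {m J : Ideal A} {I : Ideal P} {n : ℕ}
    {E : k[X] ⊗[k] P →ₐ[k[X]] k[X] ⊗[k] P} (h : Pres (XI k 1) I (XI k n) E) {a : A}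
    (ha : a ∈ m) (hn : a ^ n ∈ J) : Pres m I J (spec E a) := by
  simpa using ob_spec h ha hn

/-- Substitution into a family of exact level `n`, at `a` with `a ^ n` proportional to `s`. -/
lemma ob_spec_smul {m J : Ideal A} {I : Ideal P} {n : ℕ} {η : P → P}
    {E : k[X] ⊗[k] P →ₐ[k[X]] k[X] ⊗[k] P}
    (h : Ob (XI k 1) I (XI k (n + 1)) (Polynomial.X ^ n) η E) {a : A} (ha : a ∈ m)
    {s : A} (hs : ∀ a ∈ m, a * s ∈ J) {l : k} (hl : a ^ n - l • s ∈ J) :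
    Ob m I J s (l • η) (spec E a) := by
  have h1 : a ^ (n + 1) ∈ J := by
    have : a ^ (n + 1) = a * (a ^ n - l • s) + l • (a * s) := by
      rw [mul_sub, mul_smul_comm]; ring
    rw [this]
    exact add_mem (J.mul_mem_left _ hl) (Submodule.smul_of_tower_mem J _ (hs a ha))
  refine (ob_spec h ha h1).change fun u hu => coeffIdeal_le_errIdeal _ _ _ ?_
  have := tmul_mem_coeffIdeal (k := k) hl (η u)
  rw [TensorProduct.sub_tmul, TensorProduct.smul_tmul] at this
  simpa using this

end Curve

section CurvePoly

variable {k : Type*} [Field k] {σ : Type*} {A : Type*} [CommRing A] [Algebra k A]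

lemma unip_spec {m : Ideal A}
    {E : k[X] ⊗[k] MvPolynomial σ k →ₐ[k[X]] k[X] ⊗[k] MvPolynomial σ k}
    (h : Unip (XI k 1) E) {a : A} (ha : a ∈ m) : Unip m (spec E a) :=
  congrMod_of_X fun j => by
    simpa using ev_mem_coeffIdeal (a := a) (L := m)
      (fun q hq => aeval_mem_of_mem_XI (by simpa using ha) hq) (h (1 ⊗ₜ MvPolynomial.X j))

lemma spec_zero_eq_one {E : k[X] ⊗[k] MvPolynomial σ k →ₐ[k[X]] k[X] ⊗[k] MvPolynomial σ k}
    (h : Unip (XI k 1) E) : spec E (0 : A) = 1 := by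
  have h1 : Unip ⊥ (spec E (0 : A)) := unip_spec h (zero_mem _)
  ext y
  have := h1 (1 ⊗ₜ MvPolynomial.X y)
  rw [coeffIdeal, Ideal.map_bot, Ideal.mem_bot, sub_eq_zero] at this
  simpa using this

/-- The family `E` is `1 + X v` to first order. -/
abbrev Lin (v : σ → MvPolynomial σ k)
    (E : k[X] ⊗[k] MvPolynomial σ k →ₐ[k[X]] k[X] ⊗[k] MvPolynomial σ k) : Prop :=
  Dif (XI k 2) Polynomial.X v E 1

lemma Lin.unip {v : σ → MvPolynomial σ k}
    {E : k[X] ⊗[k] MvPolynomial σ k →ₐ[k[X]] k[X] ⊗[k] MvPolynomial σ k} (h : Lin v E) :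
    Unip (XI k 1) E :=
  h.congrMod (XI_antitone (by omega)) X_mem_XI

lemma aeval_add_sub_mem {m J : Ideal A} {a b : A} (ha : a ∈ m) (hb : b ∈ m)
    (hJ : ∀ c ∈ m, c * b ∈ J) {q : k[X]} (hq : q ∈ XI k 2) :
    Polynomial.aeval (a + b) q - Polynomial.aeval a q ∈ J := by
  obtain ⟨r, rfl⟩ := mem_XI.1 hq
  obtain ⟨d, hd⟩ : b ∣ Polynomial.aeval (a + b) r - Polynomial.aeval a r := by
    have := Polynomial.sub_dvd_eval_sub (a + b) a (r.map (algebraMap k A))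
    simpa [Polynomial.eval_map_algebraMap] using this
  have : Polynomial.aeval (a + b) (Polynomial.X ^ 2 * r) -
      Polynomial.aeval a (Polynomial.X ^ 2 * r) =
      (2 * Polynomial.aeval (a + b) r) * (a * b) + Polynomial.aeval (a + b) r * (b * b)
        + a * d * (a * b) := by
    simp only [map_mul, map_pow, Polynomial.aeval_X]
    linear_combination a ^ 2 * hd
  rw [this]
  exact add_mem (add_mem (J.mul_mem_left _ (hJ a ha)) (J.mul_mem_left _ (hJ b hb)))
    (J.mul_mem_left _ (hJ a ha))

lemma Lin.dif_spec {v : σ → MvPolynomial σ k}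
    {E : k[X] ⊗[k] MvPolynomial σ k →ₐ[k[X]] k[X] ⊗[k] MvPolynomial σ k} (h : Lin v E)
    {m J : Ideal A} {a b : A} (ha : a ∈ m) (hb : b ∈ m) (hJ : ∀ c ∈ m, c * b ∈ J) :
    Dif J b v (spec E (a + b)) (spec E a) := by
  intro j
  have h1 : ∀ y ∈ coeffIdeal k (MvPolynomial σ k) (XI k 2),
      ev k _ (a + b) y - ev k _ a y ∈ coeffIdeal k (MvPolynomial σ k) J := by
    intro y hy
    refine coeffIdeal_induction (p := fun y => ev k _ (a + b) y - ev k _ a y ∈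
      coeffIdeal k (MvPolynomial σ k) J) (by simp) ?_ ?_ hy
    · intro x y hx hy
      rw [map_add, map_add, add_sub_add_comm]
      exact add_mem hx hy
    · intro q hq x
      rw [ev_tmul, ev_tmul, ← TensorProduct.sub_tmul]
      exact tmul_mem_coeffIdeal (aeval_add_sub_mem ha hb hJ hq) x
  convert h1 _ (h j) using 1
  simp only [spec_one_tmul, AlgHom.one_apply, map_sub, ev_tmul, map_one, Polynomial.aeval_X,
    TensorProduct.add_tmul]
  ring

lemma Lin.dif_spec_smul {v : σ → MvPolynomial σ k}
    {E : k[X] ⊗[k] MvPolynomial σ k →ₐ[k[X]] k[X] ⊗[k] MvPolynomial σ k} (h : Lin v E)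
    {m J : Ideal A} {a s : A} (ha : a ∈ m) (hs : s ∈ m) (hJ : ∀ c ∈ m, c * s ∈ J) (l : k) :
    Dif J s (l • v) (spec E (a + l • s)) (spec E a) := by
  intro j
  have := h.dif_spec (J := J) ha (Submodule.smul_of_tower_mem m l hs) (fun c hc => by
    rw [mul_smul_comm]; exact Submodule.smul_of_tower_mem J l (hJ c hc)) j
  rwa [TensorProduct.smul_tmul] at this

lemma Lin.mul {v₁ v₂ : σ → MvPolynomial σ k}
    {E₁ E₂ : k[X] ⊗[k] MvPolynomial σ k →ₐ[k[X]] k[X] ⊗[k] MvPolynomial σ k} (h₁ : Lin v₁ E₁)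
    (h₂ : Lin v₂ E₂) : Lin (v₁ + v₂) (E₁ * E₂) := by
  have := Dif.mul (m := XI k 1) (by simpa using XI_one_mul_X_pow (k := k) 1) h₁.unip
    (Unip.one _) h₁ h₂
  rwa [mul_one] at this

lemma Lin.one : Lin (0 : σ → MvPolynomial σ k) 1 := Dif.refl _ _ _

/-- Reparametrisation `X ↦ c X` scales the linear term. -/
lemma Lin.spec_smul_X {v : σ → MvPolynomial σ k}
    {E : k[X] ⊗[k] MvPolynomial σ k →ₐ[k[X]] k[X] ⊗[k] MvPolynomial σ k} (h : Lin v E) (c : k) :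
    Lin (c • v) (spec E (c • (Polynomial.X : k[X]))) := by
  have := h.dif_spec_smul (A := k[X]) (m := XI k 1) (J := XI k 2) (a := 0) (zero_mem _) X_mem_XI
    (by simpa using XI_one_mul_X_pow (k := k) 1) c
  rwa [zero_add, spec_zero_eq_one h.unip] at this

/-- Reparametrisation by an element of order at least two kills the linear term. -/
lemma Unip.lin_spec_zero
    {E : k[X] ⊗[k] MvPolynomial σ k →ₐ[k[X]] k[X] ⊗[k] MvPolynomial σ k} (h : Unip (XI k 1) E)
    {a : k[X]} (ha : a ∈ XI k 2) : Lin 0 (spec E a) :=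
  dif_zero_iff.2 (unip_spec h ha)

end CurvePoly

section Products

variable {k : Type*} [Field k] {σ ι : Type*} {A : Type*} [CommRing A] [Algebra k A]

/-- The ordered product over `l` of the families `E i`, the `i`-th evaluated at `a i`. -/
noncomputable def prodSpec
    (E : ι → (k[X] ⊗[k] MvPolynomial σ k →ₐ[k[X]] k[X] ⊗[k] MvPolynomial σ k))
    (l : List ι) (a : ι → A) : A ⊗[k] MvPolynomial σ k →ₐ[A] A ⊗[k] MvPolynomial σ k :=
  (l.map fun i => spec (E i) (a i)).prod

variable {E : ι → (k[X] ⊗[k] MvPolynomial σ k →ₐ[k[X]] k[X] ⊗[k] MvPolynomial σ k)}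

@[simp] lemma prodSpec_nil (a : ι → A) : prodSpec E [] a = 1 := rfl

@[simp] lemma prodSpec_cons (i : ι) (l : List ι) (a : ι → A) :
    prodSpec E (i :: l) a = spec (E i) (a i) * prodSpec E l a := by
  simp [prodSpec]

lemma prodSpec_append_of_zero (hE : ∀ i, Unip (XI k 1) (E i)) (l l' : List ι) (a : ι → A)
    (h : ∀ i ∈ l', a i = 0) : prodSpec E (l ++ l') a = prodSpec E l a := by
  have : prodSpec E l' a = 1 := by
    induction l' with
    | nil => rfl
    | cons i l' ih =>
      rw [prodSpec_cons, h i (by simp), spec_zero_eq_one (hE i),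
        ih fun j hj => h j (by simp [hj]), one_mul]
  rw [prodSpec, List.map_append, List.prod_append]
  change prodSpec E l a * prodSpec E l' a = _
  rw [this, mul_one]

lemma unip_prodSpec {m : Ideal A} (hE : ∀ i, Unip (XI k 1) (E i)) (l : List ι) {a : ι → A}
    (ha : ∀ i, a i ∈ m) : Unip m (prodSpec E l a) := by
  induction l with
  | nil =>
    rw [prodSpec_nil]
    exact Unip.one _
  | cons i l ih =>
    rw [prodSpec_cons]
    exact Unip.mul (unip_spec (hE i) (ha i)) ih

lemma ob_prodSpec {m J : Ideal A} {I : Ideal (MvPolynomial σ k)} {s : A}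
    (hs : ∀ a ∈ m, a * s ∈ J) (hE : ∀ i, Unip (XI k 1) (E i)) (l : List ι) {a : ι → A}
    (ha : ∀ i, a i ∈ m) {w : ι → MvPolynomial σ k → MvPolynomial σ k}
    (hw : ∀ i ∈ l, Ob m I J s (w i) (spec (E i) (a i))) :
    Ob m I J s (l.map w).sum (prodSpec E l a) := by
  induction l with
  | nil =>
    rw [prodSpec_nil, List.map_nil, List.sum_nil]
    exact Ob.one _ _ _ _
  | cons i l ih =>
    rw [prodSpec_cons, List.map_cons, List.sum_cons]
    exact Ob.mul hs (unip_spec (hE i) (ha i)) (hw i (by simp)) (ih fun j hj => hw j (by simp [hj]))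

lemma dif_prodSpec {m J : Ideal A} {s : A} (hsm : s ∈ m)
    (hs : ∀ a ∈ m, a * s ∈ J) {v : ι → σ → MvPolynomial σ k} (hE : ∀ i, Lin (v i) (E i))
    (l : List ι) {a : ι → A} (ha : ∀ i, a i ∈ m) (c : ι → k) :
    Dif J s (l.map fun i => c i • v i).sum (prodSpec E l fun i => a i + c i • s)
      (prodSpec E l a) := by
  induction l with
  | nil =>
    rw [prodSpec_nil, prodSpec_nil, List.map_nil, List.sum_nil]
    exact Dif.refl _ _ _
  | cons i l ih =>
    rw [prodSpec_cons, prodSpec_cons, List.map_cons, List.sum_cons]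
    exact Dif.mul hs
      (unip_spec (hE i).unip (add_mem (ha i) (Submodule.smul_of_tower_mem m _ hsm)))
      (unip_prodSpec (fun i => (hE i).unip) l ha) ((hE i).dif_spec_smul (ha i) hsm hs (c i)) ih

lemma lin_prodSpec {v : ι → σ → MvPolynomial σ k} (l : List ι) {a : ι → k[X]}
    (h : ∀ i, Lin (v i) (spec (E i) (a i))) : Lin (l.map v).sum (prodSpec E l a) := by
  induction l with
  | nil =>
    rw [prodSpec_nil, List.map_nil, List.sum_nil]
    exact Lin.one
  | cons i l ih =>
    rw [prodSpec_cons, List.map_cons, List.sum_cons]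
    exact (h i).mul ih

end Products

section Levels

variable {k : Type*} [Field k] {σ : Type*}

lemma exists_sub_smul_X_pow_mem {n : ℕ} : ∀ a ∈ XI k n, ∃ c : k,
    a - c • (Polynomial.X ^ n : k[X]) ∈ XI k (n + 1) := by
  intro a ha
  obtain ⟨b, rfl⟩ := mem_XI.1 ha
  refine ⟨b.coeff 0, mem_XI.2 ?_⟩
  have : Polynomial.X ∣ b - Polynomial.C (b.coeff 0) := by
    rw [Polynomial.X_dvd_iff]; simp
  rw [pow_succ, Polynomial.smul_eq_C_mul, mul_comm (Polynomial.C _), ← mul_sub]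
  exact mul_dvd_mul_left _ this

/-- The linear terms of the one-parameter families preserving `I` up to order `n`. -/
noncomputable def levels (I : Ideal (MvPolynomial σ k)) (n : ℕ) :
    Submodule k (σ → MvPolynomial σ k) where
  carrier := {v | ∃ E, Lin v E ∧ Pres (XI k 1) I (XI k n) E}
  zero_mem' := ⟨1, Lin.one, Ob.one _ _ _ _⟩
  add_mem' := by
    rintro v w ⟨E, hE, hE'⟩ ⟨F, hF, hF'⟩
    exact ⟨E * F, hE.mul hF, hE'.mul hE.unip hF'⟩
  smul_mem' := by
    rintro c v ⟨E, hE, hE'⟩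
    refine ⟨_, hE.spec_smul_X c, pres_spec hE' (Submodule.smul_of_tower_mem _ c X_mem_XI) ?_⟩
    rw [smul_pow]
    exact Submodule.smul_of_tower_mem _ _ (X_pow_mem_XI le_rfl)

lemma levels_antitone (I : Ideal (MvPolynomial σ k)) {n m : ℕ} (h : n ≤ m) :
    levels I m ≤ levels I n := by
  rintro v ⟨E, hE, hE'⟩
  exact ⟨E, hE, hE'.mono (XI_antitone h)⟩

lemma levels_one (I : Ideal (MvPolynomial σ k)) : levels I 1 = ⊤ := by
  refine eq_top_iff.2 fun v _ => ?_
  let E : k[X] ⊗[k] MvPolynomial σ k →ₐ[k[X]] k[X] ⊗[k] MvPolynomial σ k :=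
    ofHom (MvPolynomial.aeval fun j => 1 ⊗ₜ MvPolynomial.X j + Polynomial.X ⊗ₜ v j)
  have hE : Lin v E := fun j => by simp [E]
  refine ⟨E, hE, fun u _ => coeffIdeal_le_errIdeal _ _ _ ?_⟩
  simpa using hE.unip (1 ⊗ₜ u)

/-- A family of one-parameter families adapted to the filtration `levels I`, up to order `N`. -/
structure IsAdapted (p : ℕ) (I : Ideal (MvPolynomial σ k)) (N : ℕ) {ι : Type*}
    (E : ι → (k[X] ⊗[k] MvPolynomial σ k →ₐ[k[X]] k[X] ⊗[k] MvPolynomial σ k))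
    (n : ι → ℕ) (v : ι → σ → MvPolynomial σ k)
    (η : ι → MvPolynomial σ k → MvPolynomial σ k) : Prop where
  lin : ∀ i, Lin (v i) (E i)
  ob : ∀ i, Ob (XI k 1) I (XI k (n i + 1)) (Polynomial.X ^ n i) (η i) (E i)
  one_le : ∀ i, 1 ≤ n i
  le : ∀ i, n i ≤ N
  exists_pow : ∀ i, n i < N → ∃ e, n i = p ^ e
  span_eq_top : Submodule.span k (Set.range v) = ⊤
  indep : ∀ q < N, ∀ (t : Finset ι) (c : ι → k), (∀ i ∈ t, c i ≠ 0 → n i = q) →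
    ∑ i ∈ t, c i • v i ∈ levels I (q + 1) → ∀ i ∈ t, c i = 0

/-- The filtration `levels I` jumps only at powers of `p` below `N`. -/
def JumpsAtPow (p : ℕ) (I : Ideal (MvPolynomial σ k)) (N : ℕ) : Prop :=
  ∀ n, 1 ≤ n → n < N → (¬ ∃ e, n = p ^ e) → levels I n ≤ levels I (n + 1)

universe u w

lemma JumpsAtPow.exists_adapted {k : Type u} [Field k] {σ : Type w} {p : ℕ}
    {I : Ideal (MvPolynomial σ k)} {N : ℕ} (hN : 1 ≤ N) (h : JumpsAtPow p I N) :
    ∃ (ι : Type (max u w))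
      (E : ι → (k[X] ⊗[k] MvPolynomial σ k →ₐ[k[X]] k[X] ⊗[k] MvPolynomial σ k)) (n : ι → ℕ)
      (v : ι → σ → MvPolynomial σ k) (η : ι → MvPolynomial σ k → MvPolynomial σ k),
      IsAdapted p I N E n v η := by
  have key : ∀ q : ℕ, ∃ b : Set (σ → MvPolynomial σ k),
      LinearIndependent k ((↑) : b → σ → MvPolynomial σ k) ∧
      (b.Nonempty → 1 ≤ q ∧ q ≤ N ∧ (q < N → ∃ e, q = p ^ e)) ∧ b ⊆ levels I q ∧
      (q < N → Disjoint (Submodule.span k b) (levels I (q + 1))) ∧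
      (1 ≤ q → q < N → levels I q ≤ Submodule.span k b ⊔ levels I (q + 1)) ∧
      (q = N → levels I q ≤ Submodule.span k b) := by
    intro q
    by_cases hq1 : 1 ≤ q ∧ q < N
    · obtain ⟨C, hC⟩ := Submodule.exists_isCompl (levels I (q + 1))
      obtain ⟨b, hb, hspan, hli⟩ :=
        exists_linearIndependent k ((C ⊓ levels I q : Submodule k (σ → MvPolynomial σ k)) :
          Set (σ → MvPolynomial σ k))
      rw [Submodule.span_eq] at hspan
      have hdis : Disjoint (Submodule.span k b) (levels I (q + 1)) := by
        rw [hspan]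
        exact hC.symm.disjoint.mono_left inf_le_left
      refine ⟨b, hli, ?_, fun x hx => (hb hx).2, fun _ => hdis, fun _ _ => ?_, by omega⟩
      · rintro ⟨x, hx⟩
        refine ⟨hq1.1, hq1.2.le, fun _ => ?_⟩
        by_contra hp
        have h0 : x = 0 := (Submodule.disjoint_def.1 hdis) x (Submodule.subset_span hx)
          (h q hq1.1 hq1.2 hp (hb hx).2)
        exact hli.ne_zero ⟨x, hx⟩ h0
      · rw [hspan, inf_comm, inf_sup_assoc_of_le _ (levels_antitone I (Nat.le_succ q)),
          hC.symm.sup_eq_top, inf_top_eq]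
    · by_cases hqN : q = N
      · obtain ⟨b, hb, hspan, hli⟩ :=
          exists_linearIndependent k (levels I q : Set (σ → MvPolynomial σ k))
        rw [Submodule.span_eq] at hspan
        exact ⟨b, hli, fun _ => ⟨by omega, by omega, by omega⟩, hb, by omega, by omega,
          fun _ => hspan.ge⟩
      · exact ⟨∅, linearIndependent_empty _ _, by simp, by simp, by simp, by omega, by omega⟩
  choose b hli hne hsub hdis hsup htop using key
  have key2 : ∀ i : Σ q, b q, ∃ (E : k[X] ⊗[k] MvPolynomial σ k →ₐ[k[X]] k[X] ⊗[k] MvPolynomial σ k)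
      (η : MvPolynomial σ k → MvPolynomial σ k),
      Lin i.2.1 E ∧ Ob (XI k 1) I (XI k (i.1 + 1)) (Polynomial.X ^ i.1) η E := by
    rintro ⟨q, x, hx⟩
    obtain ⟨E, hE, hE'⟩ := hsub q hx
    obtain ⟨η, hη⟩ := hE'.ob _ (X_pow_mem_XI le_rfl) exists_sub_smul_X_pow_mem
    exact ⟨E, η, hE, hη⟩
  choose E η hlin hob using key2
  have hspan : ∀ q, q ≤ N → 1 ≤ q → levels I q ≤
      Submodule.span k (Set.range fun i : Σ q, b q => i.2.1) := by
    have hb : ∀ q, Submodule.span k (b q) ≤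
        Submodule.span k (Set.range fun i : Σ q, b q => i.2.1) := fun q =>
      Submodule.span_mono fun x hx => ⟨⟨q, x, hx⟩, rfl⟩
    intro q hq
    induction hq using Nat.decreasingInduction with
    | self => exact fun _ => (htop N rfl).trans (hb N)
    | of_succ q hq ih => exact fun h1 => (hsup q h1 hq).trans (sup_le (hb q) (ih (by omega)))
  refine ⟨Σ q, b q, E, fun i => i.1, fun i => i.2.1, η, hlin, hob,
    fun i => (hne i.1 ⟨_, i.2.2⟩).1, fun i => (hne i.1 ⟨_, i.2.2⟩).2.1,
    fun i => (hne i.1 ⟨_, i.2.2⟩).2.2, ?_, ?_⟩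
  · rw [eq_top_iff, ← levels_one I]
    exact hspan 1 hN le_rfl
  · intro q hq t c hc hmem
    classical
    have hsum : ∑ i ∈ t, c i • (i.2.1 : σ → MvPolynomial σ k) =
        ∑ x ∈ t.preimage (Sigma.mk q) (sigma_mk_injective.injOn),
          c ⟨q, x⟩ • (x : σ → MvPolynomial σ k) := by
      rw [Finset.sum_preimage (Sigma.mk q) t _ (fun i => c i • (i.2.1 : σ → MvPolynomial σ k))]
      rintro ⟨q', x⟩ hx hne'
      by_contra h0
      have : c ⟨q', x⟩ ≠ 0 := fun h => h0 (by simp [h])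
      obtain rfl : q' = q := hc _ hx this
      exact hne' ⟨x, rfl⟩
    have h0 : ∑ i ∈ t, c i • (i.2.1 : σ → MvPolynomial σ k) = 0 := by
      refine Submodule.disjoint_def.1 (hdis q hq) _ ?_ hmem
      rw [hsum]
      exact Submodule.sum_mem _ fun x _ => Submodule.smul_mem _ _ (Submodule.subset_span x.2)
    rw [hsum] at h0
    have h1 := linearIndependent_iff'.1 (hli q) _ _ h0
    rintro ⟨q', x⟩ hx
    by_contra hcx
    obtain rfl : q' = q := hc _ hx hcx
    exact hcx (h1 x (by simpa using hx))

end Levels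

section Compare

variable {k : Type*} [Field k] {P : Type*} [CommRing P] [Algebra k P]
variable {A : Type*} [CommRing A] [Algebra k A]

/-- The coefficient of `s` of an element of `I + J` lies in `I`, if `s ∉ J`. -/
lemma mem_of_tmul_mem {J : Ideal A} {I : Ideal P} {s : A} (hs : s ∉ J) {x : P}
    (h : s ⊗ₜ[k] x ∈ baseIdeal k A I ⊔ coeffIdeal k P J) : x ∈ I := by
  obtain ⟨f, hf, hJ⟩ := Submodule.exists_le_ker_of_notMem
    (p := J.restrictScalars k) (v := s) (by simpa using hs)
  let F : A ⊗[k] P →ₗ[k] P := TensorProduct.lift ((LinearMap.lsmul k P).comp f)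
  have hF : ∀ a y, F (a ⊗ₜ y) = f a • y := fun a y => by simp [F]
  have h1 : ∀ y ∈ baseIdeal k A I, F y ∈ I := by
    intro y hy
    have h2 : ∀ z, F (z * y) ∈ I := by
      refine Submodule.span_induction (p := fun y _ => ∀ z, F (z * y) ∈ I) ?_ ?_ ?_ ?_ hy
      · rintro _ ⟨u, hu, rfl⟩ z
        induction z with
        | zero => simp
        | tmul b x =>
          simp only [Algebra.TensorProduct.includeRight_apply,
            Algebra.TensorProduct.tmul_mul_tmul, hF]
          exact Submodule.smul_of_tower_mem I _ (I.mul_mem_left _ hu)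
        | add x y hx hy => rw [add_mul, map_add]; exact add_mem hx hy
      · simp
      · intro x y _ _ hx hy z
        rw [mul_add, map_add]; exact add_mem (hx z) (hy z)
      · intro c x _ hx z
        rw [smul_eq_mul, ← mul_assoc]; exact hx _
    simpa using h2 1
  have h2 : ∀ y ∈ coeffIdeal k P J, F y = 0 := fun y hy =>
    coeffIdeal_induction (p := fun y => F y = 0) (map_zero F)
      (fun x y hx hy => by rw [map_add, hx, hy, add_zero])
      (fun a ha x => by
        have : f a = 0 := hJ ha
        rw [hF, this, zero_smul]) hy
  obtain ⟨y, hy, z, hz, hyz⟩ := Submodule.mem_sup.1 h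
  have h3 : f s • x ∈ I := by
    rw [← hF, ← hyz, map_add, h2 z hz, add_zero]
    exact h1 y hy
  have := Submodule.smul_of_tower_mem I (f s)⁻¹ h3
  rwa [smul_smul, inv_mul_cancel₀ hf, one_smul] at this

lemma errIdeal_le (m : Ideal A) (I : Ideal P) (J : Ideal A) :
    errIdeal k m I J ≤ baseIdeal k A I ⊔ coeffIdeal k P J :=
  sup_le_sup Ideal.mul_le_right le_rfl

lemma Ob.sub_mem_of_congrMod {m J : Ideal A} {I : Ideal P} {s : A} (hs : s ∉ J) {η η' : P → P}
    {g g' : A ⊗[k] P →ₐ[A] A ⊗[k] P} (h : Ob m I J s η g) (h' : Ob m I J s η' g')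
    (hg : CongrMod J g g') {u : P} (hu : u ∈ I) : η u - η' u ∈ I := by
  refine mem_of_tmul_mem hs (k := k) (errIdeal_le m I J ?_)
  convert sub_mem (h' u hu) (h.congr hg.symm u hu) using 1
  rw [TensorProduct.tmul_sub]; ring

lemma exists_sub_smul_mem_of_sup {m J : Ideal A} (hm : ∀ a : A, ∃ c : k, a - algebraMap k A c ∈ m)
    {s : A} (hs : ∀ a ∈ m, a * s ∈ J) : ∀ a ∈ J ⊔ Ideal.span {s}, ∃ c : k, a - c • s ∈ J := by
  intro a ha
  obtain ⟨x, hx, y, hy, rfl⟩ := Submodule.mem_sup.1 ha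
  obtain ⟨b, rfl⟩ := Ideal.mem_span_singleton'.1 hy
  obtain ⟨c, hc⟩ := hm b
  refine ⟨c, ?_⟩
  have : x + b * s - c • s = x + (b - algebraMap k A c) * s := by
    rw [Algebra.smul_def]; ring
  rw [this]
  exact add_mem hx (hs _ hc)

lemma exists_socle {m J n : Ideal A} {r : ℕ} (hr : m ^ r ≤ J) (hJ : ¬ n ≤ J) :
    ∃ s ∈ n, s ∉ J ∧ ∀ a ∈ m, a * s ∈ J := by
  classical
  have hex : ∃ t, m ^ t * n ≤ J := ⟨r, Ideal.mul_le_left.trans hr⟩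
  have h0 : Nat.find hex ≠ 0 := fun h => hJ (by
    have := Nat.find_spec hex
    rwa [h, pow_zero, one_mul] at this)
  obtain ⟨t, ht⟩ := Nat.exists_eq_succ_of_ne_zero h0
  have h1 : ¬ m ^ t * n ≤ J := Nat.find_min hex (by omega)
  obtain ⟨s, hs, hsJ⟩ := Set.not_subset.1 h1
  refine ⟨s, Ideal.mul_le_right hs, hsJ, fun a ha => ?_⟩
  have h2 := Nat.find_spec hex
  rw [ht, pow_succ', mul_assoc] at h2
  exact h2 (Ideal.mul_mem_mul ha hs)

end Compare

section Adapted

variable {k : Type*} [Field k] {σ ι : Type*} {p : ℕ}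
variable {I : Ideal (MvPolynomial σ k)} {N : ℕ}
variable {E : ι → (k[X] ⊗[k] MvPolynomial σ k →ₐ[k[X]] k[X] ⊗[k] MvPolynomial σ k)}
variable {n : ι → ℕ} {v : ι → σ → MvPolynomial σ k} {η : ι → MvPolynomial σ k → MvPolynomial σ k}

lemma IsAdapted.exists_curve [IsAlgClosed k] (h : IsAdapted p I N E n v η) (l : List ι)
    (c : ι → k) {q : ℕ} (hq : 1 ≤ q) (hl : ∀ i ∈ l, c i ≠ 0 → n i ∣ q) :
    ∃ (F : k[X] ⊗[k] MvPolynomial σ k →ₐ[k[X]] k[X] ⊗[k] MvPolynomial σ k) (d : ι → k),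
      Ob (XI k 1) I (XI k (q + 1)) (Polynomial.X ^ q) (l.map fun i => c i • η i).sum F ∧
      Lin (l.map fun i => d i • v i).sum F ∧
      ∀ i, (d i ≠ 0 → n i = q) ∧ (n i = q → d i ^ n i = c i) := by
  classical
  choose κ hκ using fun i => IsAlgClosed.exists_pow_nat_eq (c i) (h.one_le i)
  have hpos : ∀ i, n i ∣ q → 1 ≤ q / n i := fun i hi =>
    (Nat.one_le_div_iff (h.one_le i)).2 (Nat.le_of_dvd hq hi)
  let a : ι → k[X] := fun i => if n i ∣ q then κ i • Polynomial.X ^ (q / n i) else 0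
  have ha : ∀ i, a i ∈ XI k 1 := by
    intro i
    by_cases hi : n i ∣ q
    · simp only [a, if_pos hi]
      exact Submodule.smul_of_tower_mem _ _ (X_pow_mem_XI (hpos i hi))
    · simp only [a, if_neg hi, zero_mem]
  refine ⟨prodSpec E l a, fun i => if n i = q then κ i else 0, ?_, ?_, ?_⟩
  · refine ob_prodSpec (XI_one_mul_X_pow q) (fun i => (h.lin i).unip) l ha fun i hi =>
      ob_spec_smul (h.ob i) (ha i) (XI_one_mul_X_pow q) ?_
    by_cases hd : n i ∣ q
    · simp only [a, if_pos hd]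
      rw [smul_pow, hκ, ← pow_mul, Nat.div_mul_cancel hd, sub_self]
      exact zero_mem _
    · have : c i = 0 := by
        by_contra hc
        exact hd (hl i hi hc)
      simp only [a, if_neg hd, this]
      rw [zero_pow (by have := h.one_le i; omega), zero_smul, sub_zero]
      exact zero_mem _
  · refine lin_prodSpec l fun i => ?_
    beta_reduce
    by_cases hiq : n i = q
    · have : a i = κ i • Polynomial.X := by
        simp only [a, hiq, dvd_refl, if_true, Nat.div_self hq, pow_one]
      rw [if_pos hiq, this]
      exact (h.lin i).spec_smul_X _
    · rw [if_neg hiq, zero_smul]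
      refine Unip.lin_spec_zero (h.lin i).unip ?_
      by_cases hd : n i ∣ q
      · simp only [a, if_pos hd]
        refine Submodule.smul_of_tower_mem _ _ (X_pow_mem_XI ?_)
        obtain ⟨e, he⟩ := hd
        have h1 := h.one_le i
        rw [he, Nat.mul_div_cancel_left _ h1]
        rcases e with _ | _ | e
        · omega
        · omega
        · omega
      · simp only [a, if_neg hd, zero_mem]
  · intro i
    by_cases hiq : n i = q
    · simp only [if_pos hiq]
      exact ⟨fun _ => hiq, fun _ => hκ i⟩
    · simp only [if_neg hiq]
      exact ⟨fun h => absurd rfl h, fun h => absurd h hiq⟩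

lemma IsAdapted.eq_zero_of_sum_mem [IsAlgClosed k] (hp : 1 < p) (h : IsAdapted p I N E n v η)
    {l : List ι} (hl : l.Nodup) {c : ι → k} (hc : ∀ i ∈ l, c i ≠ 0 → n i < N)
    (hI : ∀ u ∈ I, (l.map fun i => c i • η i).sum u ∈ I) : ∀ i ∈ l, c i = 0 := by
  classical
  by_contra! hne
  obtain ⟨j, hj, hcj⟩ := hne
  obtain ⟨i, hi, hmax⟩ := Finset.exists_max_image (l.toFinset.filter fun i => c i ≠ 0) n
    ⟨j, by simp [hj, hcj]⟩
  simp only [Finset.mem_filter, List.mem_toFinset] at hi hmax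
  have hiN := hc i hi.1 hi.2
  obtain ⟨F, d, hF, hFl, hd⟩ := h.exists_curve l c (h.one_le i) fun j hj hcj => by
    obtain ⟨e, he⟩ := h.exists_pow j (hc j hj hcj)
    obtain ⟨f, hf⟩ := h.exists_pow i hiN
    have := hmax j ⟨hj, hcj⟩
    rw [he, hf] at this ⊢
    exact pow_dvd_pow _ ((Nat.pow_le_pow_iff_right hp).1 this)
  have hlev : (l.map fun i => d i • v i).sum ∈ levels I (n i + 1) :=
    ⟨F, hFl, hF.change fun u hu => by
      rw [Pi.zero_apply, TensorProduct.tmul_zero, sub_zero]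
      exact tmul_mem_errIdeal _ (X_pow_mem_XI (h.one_le i)) (hI u hu)⟩
  rw [← List.sum_toFinset _ hl] at hlev
  have h0 := h.indep (n i) hiN l.toFinset d (fun j _ => (hd j).1) hlev i (by simpa using hi.1)
  have h1 := (hd i).2 rfl
  rw [h0, zero_pow (by have := h.one_le i; omega)] at h1
  exact hi.2 h1.symm

variable {A : Type*} [CommRing A] [Algebra k A]

lemma IsAdapted.absorb (h : IsAdapted p I N E n v η) {m J : Ideal A}
    (hm : ∀ a : A, ∃ c : k, a - algebraMap k A c ∈ m) {s : A} (hsm : s ∈ m)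
    (hs : ∀ a ∈ m, a * s ∈ J) {g g' : A ⊗[k] MvPolynomial σ k →ₐ[A] A ⊗[k] MvPolynomial σ k}
    (hg' : Unip m g') {l : List ι} (hl : l.Nodup) {a : ι → A} (ha : ∀ i, a i ∈ m)
    (hal : ∀ i ∉ l, a i = 0) (hg : CongrMod (J ⊔ Ideal.span {s}) g (g' * prodSpec E l a)) :
    ∃ (l' : List ι) (c : ι → k), l'.Nodup ∧ (∀ i ∉ l', a i + c i • s = 0) ∧
      CongrMod J g (g' * prodSpec E l' fun i => a i + c i • s) := by
  classical
  have hw : ∃ w : σ → MvPolynomial σ k, Dif J s w g (g' * prodSpec E l a) := by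
    choose w hw using fun j => exists_tmul_of_mem_coeffIdeal
      (Ideal.mem_sup_right (Ideal.mem_span_singleton_self s))
      (exists_sub_smul_mem_of_sup hm hs) (hg (1 ⊗ₜ MvPolynomial.X j))
    exact ⟨w, hw⟩
  obtain ⟨w, hw⟩ := hw
  obtain ⟨c, hc⟩ := Finsupp.mem_span_range_iff_exists_finsupp.1
    (h.span_eq_top.symm ▸ Submodule.mem_top : w ∈ Submodule.span k (Set.range v))
  let l₁ := (c.support \ l.toFinset).toList
  have hl₁ : ∀ i ∈ l₁, i ∉ l := fun i hi => by
    have : i ∈ c.support \ l.toFinset := by simpa [l₁] using hi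
    simpa using (Finset.mem_sdiff.1 this).2
  have hnd : (l ++ l₁).Nodup := by
    refine List.nodup_append'.2 ⟨hl, Finset.nodup_toList _, fun i hi hi' => hl₁ i hi' hi⟩
  have hsub : ∀ i ∉ l ++ l₁, i ∉ l ∧ c i = 0 := by
    intro i hi
    simp only [List.mem_append, not_or, l₁, Finset.mem_toList, Finset.mem_sdiff,
      Finsupp.mem_support_iff, List.mem_toFinset, not_and, not_not] at hi
    refine ⟨hi.1, ?_⟩
    by_contra h0
    exact hi.1 (hi.2 h0)
  refine ⟨l ++ l₁, c, hnd, fun i hi => ?_, ?_⟩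
  · rw [hal i (hsub i hi).1, (hsub i hi).2, zero_smul, add_zero]
  · have hd := dif_prodSpec hsm hs h.lin (l ++ l₁) ha c
    have hsum : ((l ++ l₁).map fun i => c i • v i).sum = w := by
      rw [← List.sum_toFinset _ hnd, ← hc, Finsupp.sum]
      refine (Finset.sum_subset (fun i hi => ?_) fun i _ hi => ?_).symm
      · by_contra h0
        exact Finsupp.mem_support_iff.1 hi (hsub i (by simpa using h0)).2
      · rw [Finsupp.notMem_support_iff.1 hi, zero_smul]
    rw [hsum, prodSpec_append_of_zero (fun i => (h.lin i).unip) _ _ _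
      fun i hi => hal i (hl₁ i hi)] at hd
    have hd' := Dif.mul hs hg' (unip_prodSpec (fun i => (h.lin i).unip) l ha) (Dif.refl J s g') hd
    rw [zero_add] at hd'
    refine congrMod_of_X fun j => ?_
    convert sub_mem (hw j) (hd' j) using 1
    ring

lemma IsAdapted.compare (h : IsAdapted p I N E n v η) {m J : Ideal A}
    {s : A} (hs : ∀ a ∈ m, a * s ∈ J) (hsJ : s ∉ J)
    {g g' : A ⊗[k] MvPolynomial σ k →ₐ[A] A ⊗[k] MvPolynomial σ k} (hg' : Unip m g')
    {ξ ξ' : MvPolynomial σ k → MvPolynomial σ k} (hξ : Ob m I J s ξ g) (hξ' : Ob m I J s ξ' g')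
    {l : List ι} {a : ι → A} (ha : ∀ i, a i ∈ m) {c : ι → k}
    (hc : ∀ i ∈ l, a i ^ n i - c i • s ∈ J) (hg : CongrMod J g (g' * prodSpec E l a)) :
    ∀ u ∈ I, ξ u - (ξ' u + (l.map fun i => c i • η i).sum u) ∈ I := fun _ hu =>
  hξ.sub_mem_of_congrMod hsJ (Ob.mul hs hg' hξ' (ob_prodSpec hs (fun i => (h.lin i).unip) l ha
    fun i hi => ob_spec_smul (h.ob i) (ha i) hs (hc i hi))) hg hu

/-- An automorphism preserving `I` modulo `J₀` and congruent to another one modulo `n₀` differs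
from it, modulo any intermediate ideal, by a product of members of an adapted family. -/
lemma IsAdapted.exists_factorization [IsAlgClosed k] (hp : 1 < p) (h : IsAdapted p I N E n v η)
    [IsNoetherianRing A] {m n₀ J₀ : Ideal A} (hm : ∀ a : A, ∃ c : k, a - algebraMap k A c ∈ m)
    (hn₀ : n₀ ≤ m) {r : ℕ} (hr : m ^ r ≤ J₀) (hN : ∀ a ∈ n₀, a ^ N ∈ J₀)
    {g g' : A ⊗[k] MvPolynomial σ k →ₐ[A] A ⊗[k] MvPolynomial σ k} (hg' : Unip m g')
    (hgI : Pres m I J₀ g) (hgI' : Pres m I J₀ g') (hgg : CongrMod n₀ g g') {J : Ideal A}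
    (hJ₀ : J₀ ≤ J) (hJ : J ≤ n₀) :
    ∃ (l : List ι) (a : ι → A), l.Nodup ∧ (∀ i, a i ∈ n₀) ∧ (∀ i ∉ l, a i = 0) ∧
      (∀ i, a i ^ n i ∈ J) ∧ CongrMod J g (g' * prodSpec E l a) := by
  classical
  induction J using WellFoundedGT.induction with
  | ind J ih =>
  have hne : ∀ i, n i ≠ 0 := fun i => by have := h.one_le i; omega
  by_cases hJn : n₀ ≤ J
  · refine ⟨[], 0, List.nodup_nil, fun i => zero_mem _, fun _ _ => rfl, fun i => ?_, ?_⟩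
    · rw [Pi.zero_apply, zero_pow (hne i)]
      exact zero_mem _
    · rw [prodSpec_nil, mul_one]
      exact hgg.mono hJn
  obtain ⟨s, hsn, hsJ, hs⟩ := exists_socle (hr.trans hJ₀) hJn
  have hlt : J < J ⊔ Ideal.span {s} :=
    left_lt_sup.2 fun hle => hsJ (hle (Ideal.mem_span_singleton_self s))
  obtain ⟨l, a, hl, ha, hal, hapow, hga⟩ := ih _ hlt (hJ₀.trans hlt.le)
    (sup_le hJ ((Ideal.span_singleton_le_iff_mem _).2 hsn))
  obtain ⟨l', c, hl', hal', hg⟩ := h.absorb hm (hn₀ hsn) hs hg' hl (fun i => hn₀ (ha i)) hal hga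
  have hb : ∀ i, a i + c i • s ∈ n₀ := fun i =>
    add_mem (ha i) (Submodule.smul_of_tower_mem _ _ hsn)
  have hbpow : ∀ i, (a i + c i • s) ^ n i ∈ J ⊔ Ideal.span {s} := by
    intro i
    have h1 : a i + c i • s - a i ∈ J ⊔ Ideal.span {s} := by
      rw [add_sub_cancel_left]
      exact Ideal.mem_sup_right (Submodule.smul_of_tower_mem _ _ (Ideal.mem_span_singleton_self s))
    have h2 := Ideal.mem_of_dvd _ (sub_dvd_pow_sub_pow (a i + c i • s) (a i) (n i)) h1
    simpa using add_mem h2 (hapow i)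
  have hd : ∀ i, ∃ d : k, (a i + c i • s) ^ n i - d • s ∈ J ∧ (d ≠ 0 → n i < N) := by
    intro i
    rcases (h.le i).lt_or_eq with hi | hi
    · obtain ⟨d, hd⟩ := exists_sub_smul_mem_of_sup hm hs _ (hbpow i)
      exact ⟨d, hd, fun _ => hi⟩
    · refine ⟨0, ?_, fun h0 => absurd rfl h0⟩
      rw [zero_smul, sub_zero, hi]
      exact hJ₀ (hN _ (hb i))
  choose d hd hdN using hd
  have hzero : ∀ i ∈ l', d i = 0 := by
    refine h.eq_zero_of_sum_mem hp hl' (fun i _ => hdN i) fun u hu => ?_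
    have := h.compare hs hsJ hg' (Pres.ob_iff_zero.2 (hgI.mono hJ₀))
      (Pres.ob_iff_zero.2 (hgI'.mono hJ₀)) (fun i => hn₀ (hb i)) (fun i _ => hd i) hg u hu
    simpa using this
  refine ⟨l', _, hl', hb, hal', fun i => ?_, hg⟩
  by_cases hi : i ∈ l'
  · simpa [hzero i hi] using hd i
  · rw [hal' i hi, zero_pow (hne i)]
    exact zero_mem _

end Adapted

section Leap

variable {k : Type*} [Field k]

lemma exists_dvd_of_pow_sub_mem {n N t : ℕ} {b : k[X]} {d : k} (hd : d ≠ 0) (hb : b ∈ XI k t)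
    (hbn : b ^ n - d • Polynomial.X ^ N ∈ XI k (N + 1)) : ∃ t', t ≤ t' ∧ N = n * t' := by
  have hX := Polynomial.prime_X (R := k)
  rcases eq_or_ne n 0 with rfl | hn
  · refine ⟨t, le_rfl, ?_⟩
    by_contra hN
    have h1 : (Polynomial.X : k[X]) ∣ b ^ 0 - d • Polynomial.X ^ N :=
      (dvd_pow_self _ (Nat.succ_ne_zero N)).trans (mem_XI.1 hbn)
    have h2 : (Polynomial.X : k[X]) ∣ d • Polynomial.X ^ N := by
      rw [Polynomial.smul_eq_C_mul]
      exact (dvd_pow_self _ (by omega)).mul_left _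
    have := dvd_add h1 h2
    rw [sub_add_cancel, pow_zero] at this
    exact hX.not_isUnit (isUnit_of_dvd_one this)
  obtain ⟨e, he⟩ := mem_XI.1 hbn
  have hu : b ^ n = Polynomial.X ^ N * (Polynomial.C d + Polynomial.X * e) := by
    rw [Polynomial.smul_eq_C_mul] at he
    linear_combination he
  have hXu : ¬ (Polynomial.X : k[X]) ∣ Polynomial.C d + Polynomial.X * e := by
    rw [Polynomial.X_dvd_iff]
    simpa using hd
  have hb0 : b ≠ 0 := by
    rintro rfl
    rw [zero_pow hn, eq_comm, mul_eq_zero] at hu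
    rcases hu with hu | hu
    · exact pow_ne_zero N hX.ne_zero hu
    · exact hXu (hu ▸ dvd_zero _)
  obtain ⟨c, hc, hXc⟩ := (FiniteMultiplicity.of_prime_left hX hb0).exists_eq_pow_mul_and_not_dvd
  set t' := multiplicity (Polynomial.X : k[X]) b
  have hXcn : ¬ (Polynomial.X : k[X]) ∣ c ^ n := fun h => hXc (hX.dvd_of_dvd_pow h)
  have hmul : Polynomial.X ^ (n * t') * c ^ n =
      Polynomial.X ^ N * (Polynomial.C d + Polynomial.X * e) := by
    rw [← hu, hc, mul_pow, ← pow_mul, mul_comm n]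
  refine ⟨t', ?_, le_antisymm ?_ ?_⟩
  · have h1 := mem_XI.1 hb
    rw [hc] at h1
    exact (pow_dvd_pow_iff hX.ne_zero hX.not_isUnit).1 (hX.pow_dvd_of_dvd_mul_right t hXc h1)
  · exact (pow_dvd_pow_iff hX.ne_zero hX.not_isUnit).1
      (hX.pow_dvd_of_dvd_mul_right N hXcn (hmul ▸ dvd_mul_right _ _))
  · exact (pow_dvd_pow_iff hX.ne_zero hX.not_isUnit).1
      (hX.pow_dvd_of_dvd_mul_right (n * t') hXu (hmul ▸ dvd_mul_right _ _))

lemma exists_eq_pow_of_add_pow [Infinite k] (p : ℕ) [Fact p.Prime] [CharP k p] {N : ℕ} (hN : 1 ≤ N)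
    (h : ∀ x : k, (1 + x) ^ N = 1 + x ^ N) : ∃ e, N = p ^ e := by
  induction N using Nat.strong_induction_on with
  | _ N ih =>
  by_cases hp : p ∣ N
  · obtain ⟨M, rfl⟩ := hp
    have hp1 := (Fact.out : p.Prime).one_lt
    have hM : 1 ≤ M := by
      rcases M with _ | M
      · omega
      · omega
    obtain ⟨e, he⟩ := ih M (by nlinarith) hM fun x => by
      refine frobenius_inj k p ?_
      have := h x
      rw [pow_mul', pow_mul'] at this
      rw [frobenius_def, frobenius_def, this, add_pow_char, one_pow]
    exact ⟨e + 1, by rw [he, pow_succ']⟩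
  · rcases hN.eq_or_lt with rfl | hN2
    · exact ⟨0, by simp⟩
    · exfalso
      have hpol : (1 + Polynomial.X) ^ N = (1 + Polynomial.X ^ N : k[X]) :=
        Polynomial.funext fun x => by simpa using h x
      have := congrArg (fun q => (Polynomial.derivative q).eval 0) hpol
      simp only [Polynomial.derivative_pow, Polynomial.derivative_add, Polynomial.derivative_one,
        Polynomial.derivative_X] at this
      have h0 : N - 1 ≠ 0 := by omega
      simp [h0] at this
      exact hp ((CharP.cast_eq_zero_iff k p N).1 this)

lemma list_sum_smul_apply {ι P : Type*} [AddCommGroup P] [Module k P] (l : List ι) (c : ι → k)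
    (η : ι → P → P) (e : k) (u : P) :
    (l.map fun i => (e * c i) • η i).sum u = e • (l.map fun i => c i • η i).sum u := by
  induction l with
  | nil => simp
  | cons i l ih =>
    rw [List.map_cons, List.sum_cons, List.map_cons, List.sum_cons, Pi.add_apply, Pi.add_apply, ih,
      smul_add, Pi.smul_apply, Pi.smul_apply, mul_smul]

variable [IsAlgClosed k] {p : ℕ} [Fact p.Prime] [CharP k p] {σ : Type*}

lemma JumpsAtPow.succ {I : Ideal (MvPolynomial σ k)} {N : ℕ} (h : JumpsAtPow p I N) :
    JumpsAtPow p I (N + 1) := by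
  intro n hn hnN hnp
  rcases (Nat.lt_succ_iff.1 hnN).lt_or_eq with hlt | rfl
  · exact h n hn hlt hnp
  have hp1 := (Fact.out : p.Prime).one_lt
  have hn2 : 2 ≤ n := by
    by_contra hn2
    exact hnp ⟨0, by rw [pow_zero]; omega⟩
  rintro v ⟨E, hEv, hE⟩
  obtain ⟨ι, F, d, w, ξ, had⟩ := h.exists_adapted hn
  have : ∃ x : k, (1 + x) ^ n ≠ 1 + x ^ n := by
    by_contra! hx
    exact hnp (exists_eq_pow_of_add_pow p hn hx)
  obtain ⟨x, hx⟩ := this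
  obtain ⟨η, hη⟩ := hE.ob _ (X_pow_mem_XI le_rfl) exists_sub_smul_X_pow_mem
  have hm : ∀ a : k[X], ∃ c : k, a - algebraMap k k[X] c ∈ XI k 1 := fun a =>
    ⟨a.coeff 0, mem_XI.2 (by
      rw [pow_one, Polynomial.X_dvd_iff, Polynomial.algebraMap_eq]; simp)⟩
  have hcX : ∀ c : k, c • (Polynomial.X : k[X]) ∈ XI k 1 := fun c =>
    Submodule.smul_of_tower_mem _ _ X_mem_XI
  have hpres : ∀ c : k, Pres (XI k 1) I (XI k n) (spec E (c • (Polynomial.X : k[X]))) := fun c =>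
    pres_spec hE (hcX c) (by
      rw [smul_pow]; exact Submodule.smul_of_tower_mem _ _ (X_pow_mem_XI le_rfl))
  have hob : ∀ c : k, Ob (XI k 1) I (XI k (n + 1)) (Polynomial.X ^ n) (c ^ n • η)
      (spec E (c • (Polynomial.X : k[X]))) := fun c =>
    ob_spec_smul hη (hcX c) (XI_one_mul_X_pow n) (by
      rw [smul_pow, sub_self]; exact zero_mem _)
  have hlin' := (hEv.spec_smul_X 1).mul (hEv.spec_smul_X x)
  have hgg : CongrMod (XI k 2) (spec E ((1 + x) • (Polynomial.X : k[X])))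
      (spec E ((1 : k) • (Polynomial.X : k[X])) * spec E (x • (Polynomial.X : k[X]))) := by
    refine congrMod_of_X fun j => ?_
    convert sub_mem (hEv.spec_smul_X (1 + x) j) (hlin' j) using 1
    rw [← add_smul]
    ring
  have hg' := hlin'.unip
  have hpow1 : XI k 1 ^ n ≤ XI k n := by
    rw [XI, XI, Ideal.span_singleton_pow, pow_one]
  obtain ⟨l, a, hl, ha, hal, hapow, hga⟩ := had.exists_factorization (J := XI k n) hp1 hm
    (XI_antitone one_le_two) hpow1
    (fun a ha => mem_XI.2 ((pow_dvd_pow _ (by omega : n ≤ 2 * n)).trans (by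
      rw [pow_mul]; exact pow_dvd_pow_of_dvd (mem_XI.1 ha) n)))
    hg' (hpres _) ((hpres 1).mul (hEv.spec_smul_X 1).unip (hpres x)) hgg le_rfl (XI_antitone hn2)
  have hs2 : (Polynomial.X ^ n : k[X]) ∈ XI k 2 := X_pow_mem_XI hn2
  obtain ⟨l', c, hl', -, hg⟩ := had.absorb hm (X_pow_mem_XI hn) (XI_one_mul_X_pow n) hg' hl
    (fun i => XI_antitone one_le_two (ha i)) hal (hga.mono le_sup_right)
  have hb : ∀ i, a i + c i • Polynomial.X ^ n ∈ XI k 2 := fun i =>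
    add_mem (ha i) (Submodule.smul_of_tower_mem _ _ hs2)
  have hbpow : ∀ i, (a i + c i • Polynomial.X ^ n) ^ d i ∈ XI k n := by
    intro i
    have h1 : a i + c i • Polynomial.X ^ n - a i ∈ XI k n := by
      rw [add_sub_cancel_left]
      exact Submodule.smul_of_tower_mem _ _ (X_pow_mem_XI le_rfl)
    have h2 := Ideal.mem_of_dvd _
      (sub_dvd_pow_sub_pow (a i + c i • Polynomial.X ^ n) (a i) (d i)) h1
    simpa using add_mem h2 (hapow i)
  choose e he using fun i => exists_sub_smul_X_pow_mem _ (hbpow i)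
  have hXn : (Polynomial.X ^ n : k[X]) ∉ XI k (n + 1) := fun hX => by
    have := (pow_dvd_pow_iff Polynomial.X_ne_zero Polynomial.not_isUnit_X).1 (mem_XI.1 hX)
    omega
  have hcmp := had.compare (XI_one_mul_X_pow n) hXn hg' (hob _)
    (Ob.mul (XI_one_mul_X_pow n) (hEv.spec_smul_X 1).unip (hob 1) (hob x))
    (fun i => XI_antitone one_le_two (hb i)) (fun i _ => he i) hg
  have hdvd : ∀ i, e i ≠ 0 → d i ∣ n ∧ d i ≠ n := by
    intro i hi
    obtain ⟨t, ht, hnt⟩ := exists_dvd_of_pow_sub_mem hi (hb i) (he i)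
    refine ⟨⟨t, hnt⟩, fun hdn => ?_⟩
    rw [hdn] at hnt
    nlinarith
  set x₀ := (1 + x) ^ n - (1 + x ^ n) with hx₀
  have hx₀' : x₀ ≠ 0 := sub_ne_zero.2 hx
  obtain ⟨F', μ, hF', hFl, hμ⟩ := had.exists_curve l' (fun i => -x₀⁻¹ * e i) hn
    (fun i _ hi => (hdvd i (right_ne_zero_of_mul hi)).1)
  have hμ0 : ∀ i, μ i = 0 := by
    intro i
    by_contra hne
    have h1 := (hμ i).2 ((hμ i).1 hne)
    have h2 : -x₀⁻¹ * e i ≠ 0 := h1 ▸ pow_ne_zero _ hne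
    exact (hdvd i (right_ne_zero_of_mul h2)).2 ((hμ i).1 hne)
  have hFl' : Lin 0 F' := by
    have : (l'.map fun i => μ i • w i).sum = 0 := by simp [hμ0]
    rwa [this] at hFl
  refine ⟨E * F', by simpa using hEv.mul hFl',
    (Ob.mul (XI_one_mul_X_pow n) hEv.unip hη hF').change fun u hu => ?_⟩
  rw [Pi.zero_apply, TensorProduct.tmul_zero, sub_zero]
  refine tmul_mem_errIdeal _ (X_pow_mem_XI hn) ?_
  have h1 := Submodule.smul_of_tower_mem I x₀⁻¹ (hcmp u hu)
  convert h1 using 1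
  rw [Pi.add_apply, list_sum_smul_apply]
  simp only [Pi.add_apply, Pi.smul_apply, one_pow, one_smul]
  have h2 : η u = x₀⁻¹ • ((1 + x) ^ n • η u - (η u + x ^ n • η u)) := by
    have : (1 + x) ^ n • η u - (η u + x ^ n • η u) = x₀ • η u := by
      rw [hx₀]; module
    rw [this, smul_smul, inv_mul_cancel₀ hx₀', one_smul]
  nth_rewrite 1 [h2]
  module

lemma jumpsAtPow (I : Ideal (MvPolynomial σ k)) (N : ℕ) : JumpsAtPow p I N := by
  induction N with
  | zero => exact fun n _ hn => absurd hn (Nat.not_lt_zero n)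
  | succ N ih => exact ih.succ

/-- The obstruction of an automorphism along `s` is realised by a one-parameter family of level
`p ^ e`, where `p ^ e` is the largest power of `p` for which `s` has a root modulo `J`. -/
lemma exists_curve_of_ob {A : Type*} [CommRing A] [Algebra k A] [IsNoetherianRing A]
    {m J : Ideal A} (hm : ∀ a : A, ∃ c : k, a - algebraMap k A c ∈ m) {r : ℕ} (hr : m ^ r = ⊥)
    {s : A} (hsm : s ∈ m) (hs : ∀ a ∈ m, a * s ∈ J) (hsJ : s ∉ J) (hJ : J ≤ m) {e : ℕ}
    (he : ∀ e', ∀ a ∈ m, a ^ p ^ e' - s ∈ J → e' ≤ e) {I : Ideal (MvPolynomial σ k)}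
    {g : A ⊗[k] MvPolynomial σ k →ₐ[A] A ⊗[k] MvPolynomial σ k} (hg : Unip m g)
    {ξ : MvPolynomial σ k → MvPolynomial σ k} (hξ : Ob m I J s ξ g) :
    ∃ (F : k[X] ⊗[k] MvPolynomial σ k →ₐ[k[X]] k[X] ⊗[k] MvPolynomial σ k)
      (w : MvPolynomial σ k → MvPolynomial σ k), Unip (XI k 1) F ∧
      Ob (XI k 1) I (XI k (p ^ e + 1)) (Polynomial.X ^ p ^ e) w F ∧ ∀ u ∈ I, ξ u - w u ∈ I := by
  have hp1 := (Fact.out : p.Prime).one_lt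
  obtain ⟨ι, E, d, v, η, had⟩ := (jumpsAtPow (p := p) I (r + 1)).exists_adapted (by omega)
  have hsJ₀ : s ∈ J ⊔ Ideal.span {s} :=
    Ideal.mem_sup_right (Ideal.mem_span_singleton_self s)
  have hr' : ∀ a ∈ m, a ^ (r + 1) = 0 := fun a ha => by
    have := Ideal.pow_mem_pow ha r
    rw [hr, Ideal.mem_bot] at this
    rw [pow_succ, this, zero_mul]
  have hJ₀m : J ⊔ Ideal.span {s} ≤ m := sup_le hJ ((Ideal.span_singleton_le_iff_mem _).2 hsm)
  obtain ⟨l, a, hl, ha, hal, hapow, hga⟩ := had.exists_factorization (J₀ := J ⊔ Ideal.span {s})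
    hp1 hm le_rfl (hr ▸ bot_le) (fun a ha => by rw [hr' a ha]; exact zero_mem _)
    (Unip.one m) ((hξ.mono le_sup_left).pres hsJ₀) (Ob.one _ _ _ _) hg le_rfl hJ₀m
  obtain ⟨l', c, hl', -, hg'⟩ := had.absorb hm hsm hs (Unip.one m) hl ha hal hga
  have hb : ∀ i, a i + c i • s ∈ m := fun i =>
    add_mem (ha i) (Submodule.smul_of_tower_mem _ _ hsm)
  have hbpow : ∀ i, (a i + c i • s) ^ d i ∈ J ⊔ Ideal.span {s} := by
    intro i
    have h1 : a i + c i • s - a i ∈ J ⊔ Ideal.span {s} := by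
      rw [add_sub_cancel_left]
      exact Submodule.smul_of_tower_mem _ _ hsJ₀
    have h2 := Ideal.mem_of_dvd _ (sub_dvd_pow_sub_pow (a i + c i • s) (a i) (d i)) h1
    simpa using add_mem h2 (hapow i)
  have hd : ∀ i, ∃ x : k, (a i + c i • s) ^ d i - x • s ∈ J ∧ (x ≠ 0 → d i ∣ p ^ e) := by
    intro i
    rcases (had.le i).lt_or_eq with hi | hi
    · obtain ⟨x, hx⟩ := exists_sub_smul_mem_of_sup hm hs _ (hbpow i)
      refine ⟨x, hx, fun hx0 => ?_⟩
      obtain ⟨e', he'⟩ := had.exists_pow i hi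
      obtain ⟨y, hy⟩ := IsAlgClosed.exists_pow_nat_eq x⁻¹ (had.one_le i)
      rw [he']
      refine pow_dvd_pow _ (he e' (y • (a i + c i • s)) (Submodule.smul_of_tower_mem _ _ (hb i)) ?_)
      have := Submodule.smul_of_tower_mem J x⁻¹ hx
      rwa [smul_sub, smul_smul, inv_mul_cancel₀ hx0, one_smul, ← hy, ← smul_pow, he'] at this
    · refine ⟨0, ?_, fun h0 => absurd rfl h0⟩
      rw [hi, hr' _ (hb i), zero_smul, sub_zero]
      exact zero_mem _
  choose x hx hxd using hd
  have hcmp := had.compare hs hsJ (Unip.one m) hξ (Ob.one _ _ _ _) hb (fun i _ => hx i) hg'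
  obtain ⟨F, μ, hF, hFl, -⟩ := had.exists_curve l' x (Nat.one_le_pow e p (by omega))
    (fun i _ hi => hxd i hi)
  exact ⟨F, _, hFl.unip, hF, fun u hu => by simpa using hcmp u hu⟩

end Leap

section Retraction

variable {k : Type*} [Field k] {P : Type*} [CommRing P] [Algebra k P]
variable {A : Type*} [CommRing A] [Algebra k A]

lemma lTensor_apply_of_mem_baseIdeal {I : Ideal P} {ρ : P →ₗ[k] P} (hρ : ∀ u ∈ I, ρ u = u)
    {y : A ⊗[k] P} (hy : y ∈ baseIdeal k A I) : ρ.lTensor A y = y := by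
  have h : ∀ z, ρ.lTensor A (z * y) = z * y := by
    refine Submodule.span_induction (p := fun y _ => ∀ z, ρ.lTensor A (z * y) = z * y)
      ?_ ?_ ?_ ?_ hy
    · rintro _ ⟨u, hu, rfl⟩ z
      induction z with
      | zero => simp
      | tmul a x => simp [hρ (x * u) (I.mul_mem_left _ hu)]
      | add x y hx hy => rw [add_mul, map_add, hx, hy]
    · simp
    · intro x y _ _ hx hy z
      rw [mul_add, map_add, hx, hy]
    · intro c x _ hx z
      rw [smul_eq_mul, ← mul_assoc, hx]
  simpa using h 1

lemma mem_errIdeal_of_mem_coeffIdeal {m J : Ideal A} {I : Ideal P} (hJ : J ≤ m) {y : A ⊗[k] P}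
    (hy : y ∈ coeffIdeal k P m) (hy' : y ∈ baseIdeal k A I ⊔ coeffIdeal k P J) :
    y ∈ errIdeal k m I J := by
  obtain ⟨i, hi, j, hj, rfl⟩ := Submodule.mem_sup.1 hy'
  obtain ⟨f, hf⟩ := (I.restrictScalars k).subtype.exists_leftInverse_of_injective
    (Submodule.ker_subtype _)
  set ρ : P →ₗ[k] P := (I.restrictScalars k).subtype ∘ₗ f with hρ
  have hρI : ∀ x, ρ x ∈ I := fun x => (f x).2
  have hρu : ∀ u ∈ I, ρ u = u := fun u hu =>
    congrArg Subtype.val (LinearMap.congr_fun hf ⟨u, hu⟩)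
  have hT : ∀ z ∈ coeffIdeal k P m, ρ.lTensor A z ∈ coeffIdeal k P m * baseIdeal k A I := by
    intro z hz
    refine coeffIdeal_induction (p := fun z => ρ.lTensor A z ∈ _) ?_ ?_ ?_ hz
    · rw [map_zero]
      exact zero_mem _
    · intro x y hx hy
      rw [map_add]
      exact add_mem hx hy
    · intro a ha x
      rw [LinearMap.lTensor_tmul]
      exact tmul_mem_mul ha (hρI x)
  refine Submodule.mem_sup.2 ⟨i, ?_, j, hj, rfl⟩
  have h := sub_mem (hT _ hy) (hT _ (coeffIdeal_mono hJ hj))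
  rwa [map_add, add_sub_cancel_right, lTensor_apply_of_mem_baseIdeal hρu hi] at h

end Retraction

section Devissage

/-- Descending induction over the ideals contained in a nilpotent ideal of a noetherian ring. -/
lemma ideal_descent {A : Type*} [CommRing A] [IsNoetherianRing A] {m : Ideal A} {r : ℕ}
    (hr : m ^ r = ⊥) {S : Ideal A → Prop} (h0 : S m)
    (hS : ∀ J s, J ≤ m → s ∈ m → s ∉ J → (∀ a ∈ m, a * s ∈ J) → S (J ⊔ Ideal.span {s}) → S J) :
    S ⊥ := by
  have key : ∀ J : Ideal A, J ≤ m → S J := by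
    intro J
    induction J using WellFoundedGT.induction with
    | _ J ih =>
    intro hJ
    by_cases hmJ : m ≤ J
    · rwa [le_antisymm hJ hmJ]
    · obtain ⟨s, hs, hsJ, has⟩ := exists_socle (hr.trans_le bot_le : m ^ r ≤ J) hmJ
      refine hS J s hJ hs hsJ has (ih _ ?_ (sup_le hJ ((Ideal.span_singleton_le_iff_mem _).2 hs)))
      refine lt_of_le_of_ne le_sup_left fun h => hsJ ?_
      rw [h]
      exact Ideal.mem_sup_right (Ideal.mem_span_singleton_self s)
  exact key ⊥ bot_le

variable {A : Type*} [CommRing A] {B : Type*} [CommRing B] [Algebra A B]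

lemma smul_mem_map {J : Ideal A} {a : A} (ha : a ∈ J) (b : B) :
    a • b ∈ J.map (algebraMap A B) := by
  rw [Algebra.smul_def]
  exact Ideal.mul_mem_right _ _ (Ideal.mem_map_of_mem _ ha)

lemma smul_mem_map_of_mem {m J : Ideal A} {a : A} (ha : ∀ x ∈ m, x * a ∈ J) {b : B}
    (hb : b ∈ m.map (algebraMap A B)) : a • b ∈ J.map (algebraMap A B) := by
  have : m.map (algebraMap A B) ≤
      Submodule.comap (LinearMap.mulLeft B (algebraMap A B a)) (J.map (algebraMap A B)) := by
    refine Ideal.map_le_iff_le_comap.2 fun x hx => ?_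
    have := Ideal.mem_map_of_mem (algebraMap A B) (ha x hx)
    rw [map_mul, mul_comm] at this
    exact this
  rw [Algebra.smul_def]
  exact this hb

lemma mem_map_of_smul_mem [Module.Flat A B] {m J : Ideal A} {s : A}
    (hs : ∀ a, s * a ∈ J → a ∈ m) {b : B} (h : s • b ∈ J.map (algebraMap A B)) :
    b ∈ m.map (algebraMap A B) := by
  obtain ⟨n, c, d, hcd⟩ := Submodule.mem_span_set'.1 h
  choose a ha hab using fun i => (d i).2
  have hrel : ∑ i, (Fin.cons s fun i => - a i : Fin (n + 1) → A) i •
      (Fin.cons b c : Fin (n + 1) → B) i = 0 := by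
    rw [Fin.sum_univ_succ]
    simp only [Fin.cons_zero, Fin.cons_succ, ← hcd, neg_smul, Finset.sum_neg_distrib]
    rw [add_neg_eq_zero]
    refine Finset.sum_congr rfl fun i _ => ?_
    rw [← hab, smul_eq_mul, Algebra.smul_def, mul_comm]
  obtain ⟨κ, z, y, hy, hz⟩ :=
    Module.Flat.isTrivialRelation_of_sum_smul_eq_zero (R := A) (M := B) hrel
  have hb := hy 0
  rw [Fin.cons_zero] at hb
  rw [hb]
  refine Ideal.sum_mem _ fun j _ => smul_mem_map (hs _ ?_) _
  have := hz j
  rw [Fin.sum_univ_succ] at this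
  simp only [Fin.cons_zero, Fin.cons_succ] at this
  rw [eq_neg_of_add_eq_zero_left this]
  exact neg_mem (Ideal.sum_mem _ fun i _ => Ideal.mul_mem_right _ _ (neg_mem (ha i)))

lemma surjective_of_sup_map_eq_top {C : Type*} [CommRing C] [Algebra A C] (Ψ : C →ₐ[A] B)
    {m : Ideal A} {r : ℕ} (hr : m ^ r = ⊥)
    (h : ∀ b, ∃ c, b - Ψ c ∈ m.map (algebraMap A B)) : Function.Surjective Ψ := by
  have key : ∀ i, ∀ b, ∃ c, b - Ψ c ∈ (m ^ i).map (algebraMap A B) := by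
    intro i
    induction i with
    | zero => exact fun b => ⟨0, by simp [Ideal.map_top]⟩
    | succ i ih =>
      have h2 : ∀ y ∈ (m ^ i).map (algebraMap A B), ∃ c, y - Ψ c ∈
          (m ^ (i + 1)).map (algebraMap A B) := by
        intro y hy
        obtain ⟨n, c, d, rfl⟩ := Submodule.mem_span_set'.1 hy
        choose a ha hab using fun i => (d i).2
        choose e he using fun i => h (c i)
        refine ⟨∑ i, a i • e i, ?_⟩
        rw [map_sum, ← Finset.sum_sub_distrib]
        refine Ideal.sum_mem _ fun j _ => ?_
        rw [map_smul, ← hab, smul_eq_mul, mul_comm, ← Algebra.smul_def, ← smul_sub]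
        refine smul_mem_map_of_mem (fun x hx => ?_) (he j)
        rw [pow_succ']
        exact Ideal.mul_mem_mul hx (ha j)
      intro b
      obtain ⟨c, hc⟩ := ih b
      obtain ⟨c', hc'⟩ := h2 _ hc
      exact ⟨c + c', by rwa [map_add, ← sub_sub]⟩
  intro b
  obtain ⟨c, hc⟩ := key r b
  rw [hr, Ideal.map_bot, Ideal.mem_bot, sub_eq_zero] at hc
  exact ⟨c, hc.symm⟩

end Devissage

section Trivialisation

variable {k : Type*} [Field k] {R : Type*} [CommRing R] [Algebra k R]
variable {A : Type*} [CommRing A] [Algebra k A] {ε : A →ₐ[k] k}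
variable {B : Type*} [CommRing B] [Algebra k B] [Algebra A B] [IsScalarTower k A B]

lemma sub_algebraMap_mem {m : Ideal A} (hε : RingHom.ker ε.toRingHom = m) (a : A) :
    a - algebraMap k A (ε a) ∈ m := by
  rw [← hε, RingHom.mem_ker]
  simp

lemma sub_tmul_tensorProj_mem {m : Ideal A} (hε : RingHom.ker ε.toRingHom = m) (y : A ⊗[k] R) :
    y - 1 ⊗ₜ tensorProj k A ε R y ∈ coeffIdeal k R m := by
  induction y with
  | zero => simp
  | tmul a x =>
    have := tmul_mem_coeffIdeal (k := k) (sub_algebraMap_mem hε a) x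
    rw [TensorProduct.sub_tmul, Algebra.algebraMap_eq_smul_one, TensorProduct.smul_tmul] at this
    simpa [tensorProj] using this
  | add x y hx hy =>
    rw [map_add, TensorProduct.tmul_add]
    convert add_mem hx hy using 1
    ring

/-- A section `R → B` of a flat deformation trivialises it. -/
lemma exists_equiv_of_section [IsNoetherianRing A] [Module.Flat A B] {m : Ideal A} {r : ℕ}
    (hr : m ^ r = ⊥) (hε : RingHom.ker ε.toRingHom = m) {π : B →ₐ[k] R}
    (hkerπ : RingHom.ker π.toRingHom = m.map (algebraMap A B)) (t : R →ₐ[k] B)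
    (ht : ∀ x, π (t x) = x) :
    ∃ ψ : B ≃ₐ[A] (A ⊗[k] R), ∀ b : B, tensorProj k A ε R (ψ b) = π b := by
  have hm : ∀ a, a ∉ m → IsUnit a := by
    intro a ha
    have h1 : ε a ≠ 0 := fun h => ha (hε ▸ h)
    have h2 : IsNilpotent (a - algebraMap k A (ε a)) := ⟨r, by
      rw [← Ideal.mem_bot, ← hr]
      exact Ideal.pow_mem_pow (sub_algebraMap_mem hε a) r⟩
    have h3 := h2.isUnit_add_left_of_commute ((IsUnit.mk0 _ h1).map (algebraMap k A))
      (Commute.all _ _)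
    simpa using h3
  set Ψ : A ⊗[k] R →ₐ[A] B :=
    Algebra.TensorProduct.lift (Algebra.ofId A B) t (fun _ _ => Commute.all _ _) with hΨ
  have hΨt : ∀ a x, Ψ (a ⊗ₜ x) = a • t x := fun a x => by
    rw [hΨ, Algebra.TensorProduct.lift_tmul, Algebra.ofId_apply, Algebra.smul_def]
  have hπm : ∀ a ∈ m, π (algebraMap A B a) = 0 := fun a ha => by
    have : algebraMap A B a ∈ RingHom.ker π.toRingHom := hkerπ ▸ Ideal.mem_map_of_mem _ ha
    exact this
  have hπA : ∀ a, π (algebraMap A B a) = algebraMap k R (ε a) := fun a => by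
    have := hπm _ (sub_algebraMap_mem hε a)
    rwa [map_sub, ← IsScalarTower.algebraMap_apply, map_sub, π.commutes, sub_eq_zero] at this
  have hπΨ : ∀ y, π (Ψ y) = tensorProj k A ε R y := by
    intro y
    induction y with
    | zero => simp
    | tmul a x =>
      rw [hΨt, Algebra.smul_def, map_mul, hπA, ht]
      simp [tensorProj, Algebra.smul_def]
    | add x y hx hy => rw [map_add, map_add, map_add, hx, hy]
  have hsurj : Function.Surjective Ψ := surjective_of_sup_map_eq_top Ψ hr fun b =>
    ⟨1 ⊗ₜ π b, by
      rw [← hkerπ, RingHom.mem_ker]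
      simp [hΨt, ht]⟩
  have hinj : ∀ y, Ψ y ∈ (⊥ : Ideal A).map (algebraMap A B) → y ∈ coeffIdeal k R (⊥ : Ideal A) := by
    refine ideal_descent hr (S := fun J => ∀ y, Ψ y ∈ J.map (algebraMap A B) →
      y ∈ coeffIdeal k R J) ?_ ?_
    · intro y hy
      have h1 : π (Ψ y) = 0 := by
        rw [← hkerπ] at hy
        exact hy
      have h2 := sub_tmul_tensorProj_mem hε y
      rwa [← hπΨ, h1, TensorProduct.tmul_zero, sub_zero] at h2
    · intro J s hJ hsm hsJ hs ih y hy
      have h1 := ih y (Ideal.map_mono le_sup_left hy)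
      have hmk : ∀ a : A, ∃ c : k, a - algebraMap k A c ∈ m := fun a =>
        ⟨_, sub_algebraMap_mem hε a⟩
      obtain ⟨w, hw⟩ := exists_tmul_of_mem_coeffIdeal (k := k)
        (Ideal.mem_sup_right (Ideal.mem_span_singleton_self s) : s ∈ J ⊔ Ideal.span {s})
        (exists_sub_smul_mem_of_sup hmk hs) h1
      have h2 : ∀ z ∈ coeffIdeal k R J, Ψ z ∈ J.map (algebraMap A B) := fun z hz => by
        refine coeffIdeal_induction (p := fun z => Ψ z ∈ _) ?_ ?_ ?_ hz
        · rw [map_zero]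
          exact zero_mem _
        · intro x y hx hy
          rw [map_add]
          exact add_mem hx hy
        · intro a ha x
          rw [hΨt]
          exact smul_mem_map ha _
      have h3 := sub_mem hy (h2 _ hw)
      rw [← map_sub, sub_sub_cancel, hΨt] at h3
      have h4 : t w ∈ m.map (algebraMap A B) := by
        refine mem_map_of_smul_mem (fun a ha => ?_) h3
        by_contra ham
        obtain ⟨v, hv⟩ := (hm a ham).exists_right_inv
        refine hsJ ?_
        have := J.mul_mem_right v ha
        rwa [mul_assoc, hv, mul_one] at this
      rw [← hkerπ] at h4
      have h5 : w = 0 := by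
        rw [← ht w]
        exact h4
      rwa [h5, TensorProduct.tmul_zero, sub_zero] at hw
  have hinj' : Function.Injective Ψ := by
    refine (injective_iff_map_eq_zero Ψ).2 fun y hy => ?_
    have := hinj y (by rw [hy]; exact zero_mem _)
    rwa [coeffIdeal, Ideal.map_bot, Ideal.mem_bot] at this
  refine ⟨(AlgEquiv.ofBijective Ψ ⟨hinj', hsurj⟩).symm, fun b => ?_⟩
  rw [← hπΨ]
  exact congrArg π ((AlgEquiv.ofBijective Ψ ⟨hinj', hsurj⟩).apply_symm_apply b)

end Trivialisation

section Arc

variable {k : Type*} [Field k] {P : Type*} [CommRing P] [Algebra k P]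

lemma sum_sub_mem_of_forall {M : Type*} [AddCommGroup M] (K : AddSubgroup M) (t : ℕ → M)
    {q N : ℕ} (hq : q ≠ 0) (hN : q < N) (h : ∀ n, n ≠ 0 → n ≠ q → t n ∈ K) :
    ∑ n ∈ Finset.range N, t n - (t 0 + t q) ∈ K := by
  classical
  have h0 : 0 ∈ Finset.range N := Finset.mem_range.2 (by omega)
  have hq' : q ∈ (Finset.range N).erase 0 := Finset.mem_erase.2 ⟨hq, Finset.mem_range.2 hN⟩
  rw [← Finset.add_sum_erase _ _ h0, ← Finset.add_sum_erase _ _ hq', ← add_assoc,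
    add_sub_cancel_left]
  refine sum_mem fun n hn => h n ?_ ?_
  · exact (Finset.mem_erase.1 (Finset.mem_erase.1 hn).2).1
  · exact (Finset.mem_erase.1 hn).1

/-- A one-parameter family of endomorphisms starting at the identity, which preserves `I` up to
order `q`, and moves `I` by `w` at order `q`. -/
def IsArc (I : Ideal P) (q : ℕ) (w : P → P) (E : P →ₐ[k] P[X]) : Prop :=
  (∀ x, (E x).coeff 0 = x) ∧
    ∀ u ∈ I, (∀ n < q, (E u).coeff n ∈ I) ∧ (E u).coeff q - w u ∈ I

lemma IsArc.congr {I : Ideal P} {q : ℕ} {w w' : P → P} {E : P →ₐ[k] P[X]} (h : IsArc I q w E)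
    (hw : ∀ u ∈ I, w u - w' u ∈ I) : IsArc I q w' E :=
  ⟨h.1, fun u hu => ⟨(h.2 u hu).1, by
    simpa using add_mem (h.2 u hu).2 (hw u hu)⟩⟩

lemma isArc_zero (I : Ideal P) {q : ℕ} (hq : q ≠ 0) :
    IsArc I q 0 (Polynomial.CAlgHom : P →ₐ[k] P[X]) := by
  refine ⟨fun x => by simp, fun u hu => ⟨fun n _ => ?_, ?_⟩⟩
  · rw [Polynomial.CAlgHom_apply, Polynomial.coeff_C]
    split_ifs
    · exact hu
    · exact zero_mem _
  · rw [Polynomial.CAlgHom_apply, Polynomial.coeff_C, if_neg hq]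
    simp

/-- The substitution `X ↦ cX`. -/
noncomputable def scale (k : Type*) [Field k] {P : Type*} [CommRing P] [Algebra k P] (c : P) :
    P[X] →ₐ[k] P[X] :=
  (Polynomial.aeval (Polynomial.C c * Polynomial.X : P[X])).restrictScalars k

lemma scale_coeff (c : P) (f : P[X]) (n : ℕ) : (scale k c f).coeff n = f.coeff n * c ^ n :=
  Polynomial.comp_C_mul_X_coeff

lemma IsArc.scale {I : Ideal P} {q : ℕ} {w : P → P} {E : P →ₐ[k] P[X]} (h : IsArc I q w E)
    (c : P) : IsArc I q (fun u => c ^ q * w u) ((scale k c).comp E) := by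
  refine ⟨fun x => ?_, fun u hu => ⟨fun n hn => ?_, ?_⟩⟩
  · rw [AlgHom.comp_apply, scale_coeff, h.1, pow_zero, mul_one]
  · rw [AlgHom.comp_apply, scale_coeff]
    exact I.mul_mem_right _ ((h.2 u hu).1 n hn)
  · rw [AlgHom.comp_apply, scale_coeff, mul_comm, ← mul_sub]
    exact I.mul_mem_left _ (h.2 u hu).2

lemma coeff_eval₂_X (E : P →ₐ[k] P[X]) (f : P[X]) {n N : ℕ} (hN : f.natDegree < N) :
    (Polynomial.eval₂ (E : P →+* P[X]) Polynomial.X f).coeff n =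
      ∑ i ∈ Finset.range N, if i ≤ n then (E (f.coeff i)).coeff (n - i) else 0 := by
  rw [Polynomial.eval₂_eq_sum_range' _ hN, Polynomial.finsetSum_coeff]
  exact Finset.sum_congr rfl fun i _ => by rw [Polynomial.coeff_mul_X_pow']; rfl

lemma IsArc.add {I : Ideal P} {q : ℕ} (hq : q ≠ 0) {w₁ w₂ : P → P} {E₁ E₂ : P →ₐ[k] P[X]}
    (h₁ : IsArc I q w₁ E₁) (h₂ : IsArc I q w₂ E₂) :
    ∃ E : P →ₐ[k] P[X], IsArc I q (fun u => w₁ u + w₂ u) E := by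
  refine ⟨(Polynomial.eval₂AlgHom E₁ Polynomial.X fun _ => Commute.all _ _).comp E₂,
    fun x => ?_, fun u hu => ⟨fun n hn => ?_, ?_⟩⟩
  · change (Polynomial.eval₂ (E₁ : P →+* P[X]) Polynomial.X (E₂ x)).coeff 0 = x
    rw [coeff_eval₂_X E₁ _ (Nat.lt_succ_self _), Finset.sum_range_succ']
    simp [h₁.1, h₂.1]
  · change (Polynomial.eval₂ (E₁ : P →+* P[X]) Polynomial.X (E₂ u)).coeff n ∈ I
    rw [coeff_eval₂_X E₁ _ (Nat.lt_succ_self _)]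
    refine sum_mem fun i _ => ?_
    split_ifs with hi
    · exact (h₁.2 _ ((h₂.2 u hu).1 i (by omega))).1 _ (by omega)
    · exact zero_mem _
  · change (Polynomial.eval₂ (E₁ : P →+* P[X]) Polynomial.X (E₂ u)).coeff q - _ ∈ I
    have hN : (E₂ u).natDegree < max (E₂ u).natDegree q + 1 := by omega
    rw [coeff_eval₂_X E₁ _ hN]
    have key := sum_sub_mem_of_forall I.toAddSubgroup
      (fun i => if i ≤ q then (E₁ ((E₂ u).coeff i)).coeff (q - i) else 0) hq
      (by omega : q < max (E₂ u).natDegree q + 1) fun i hi0 hiq => by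
        split_ifs with hi
        · exact (h₁.2 _ ((h₂.2 u hu).1 i (by omega))).1 _ (by omega)
        · exact zero_mem _
    simp only [zero_le, if_true, le_refl, Nat.sub_self, Nat.sub_zero, h₁.1, h₂.1] at key
    convert add_mem (show _ ∈ I from key) (add_mem (h₁.2 u hu).2 (h₂.2 u hu).2) using 1
    ring

lemma exists_isArc_sum {I : Ideal P} {q : ℕ} (hq : q ≠ 0) {ι : Type*} (s : Finset ι)
    {c : ι → P} {η : P → P} (h : ∀ i ∈ s, ∃ E : P →ₐ[k] P[X], IsArc I q (fun u => c i * η u) E) :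
    ∃ E : P →ₐ[k] P[X], IsArc I q (fun u => (∑ i ∈ s, c i) * η u) E := by
  classical
  induction s using Finset.induction_on with
  | empty => exact ⟨_, (isArc_zero I hq).congr fun u _ => by simp⟩
  | insert i s hi ih =>
    obtain ⟨E₁, h₁⟩ := h i (Finset.mem_insert_self i s)
    obtain ⟨E₂, h₂⟩ := ih fun j hj => h j (Finset.mem_insert_of_mem hj)
    obtain ⟨E, hE⟩ := h₁.add hq h₂
    exact ⟨E, hE.congr fun u _ => by
      rw [Finset.sum_insert hi, add_mul, sub_self]
      exact zero_mem _⟩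

/-- Families realising multiples of `η` along a partition of unity combine to one realising
`-η`. -/
lemma exists_isArc_neg {p : ℕ} [Fact p.Prime] [CharP P p] {e : ℕ} {I : Ideal P} {ι : Type*}
    [Fintype ι] {f c : ι → P} (hc : ∑ i, c i * f i - 1 ∈ I) {η : P → P}
    (h : ∀ i, ∃ E : P →ₐ[k] P[X], IsArc I (p ^ e) (fun u => f i ^ p ^ e * η u) E) :
    ∃ E : P →ₐ[k] P[X], IsArc I (p ^ e) (fun u => - η u) E := by
  have hq : p ^ e ≠ 0 := pow_ne_zero _ (Fact.out : p.Prime).ne_zero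
  obtain ⟨E, hE⟩ := exists_isArc_sum hq Finset.univ (I := I) (c := fun i => (c i * f i) ^ p ^ e)
    (η := η) fun i _ => by
      obtain ⟨E, hE⟩ := h i
      exact ⟨_, (hE.scale (c i)).congr fun u _ => by
        rw [mul_pow, mul_assoc, sub_self]
        exact zero_mem _⟩
  rw [← sum_pow_char_pow] at hE
  have hneg : (-1 : P) ^ p ^ e = -1 := by
    have := sub_pow_char_pow (p := p) (n := e) (0 : P) 1
    rwa [zero_sub, zero_pow hq, one_pow, zero_sub] at this
  refine ⟨_, (hE.scale (-1)).congr fun u _ => ?_⟩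
  have h1 := Ideal.pow_mem_of_mem I hc (p ^ e) (Nat.pos_of_ne_zero hq)
  rw [sub_pow_char_pow, one_pow] at h1
  rw [hneg]
  convert I.mul_mem_left (- η u) h1 using 1
  ring

/-- An arc realising `-η` corrects a lift which maps `I` to `sη(I)`. -/
lemma IsArc.exists_lift {A : Type*} [CommRing A] {B : Type*} [CommRing B] [Algebra k B]
    [Algebra A B] {m J : Ideal A} {s a : A} (hs : ∀ a ∈ m, a * s ∈ J)
    (ha : a ∈ m) {q : ℕ} (hq : q ≠ 0) (haq : a ^ q - s ∈ J) {I : Ideal P} {τ : P →ₐ[k] B}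
    (hτ : ∀ u ∈ I, τ u ∈ (J ⊔ Ideal.span {s}).map (algebraMap A B)) {η : P → P}
    (hη : ∀ u ∈ I, τ u - s • τ (η u) ∈ J.map (algebraMap A B)) {E : P →ₐ[k] P[X]}
    (hE : IsArc I q (fun u => - η u) E) :
    ∃ τ' : P →ₐ[k] B, (∀ x, τ' x - τ x ∈ m.map (algebraMap A B)) ∧
      ∀ u ∈ I, τ' u ∈ J.map (algebraMap A B) := by
  have hmJ : ∀ b ∈ m, ∀ x ∈ J ⊔ Ideal.span {s}, x * b ∈ J := by
    intro b hb x hx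
    obtain ⟨j, hj, y, hy, rfl⟩ := Submodule.mem_sup.1 hx
    obtain ⟨y, rfl⟩ := Ideal.mem_span_singleton'.1 hy
    rw [add_mul, mul_assoc, mul_comm s]
    exact add_mem (J.mul_mem_right _ hj) (J.mul_mem_left _ (hs b hb))
  have hpow : ∀ n, n ≠ 0 → a ^ n ∈ m := fun n hn => Ideal.pow_mem_of_mem m ha n
    (Nat.pos_of_ne_zero hn)
  have hτm : ∀ n, n ≠ 0 → ∀ u ∈ I, a ^ n • τ u ∈ J.map (algebraMap A B) := fun n hn u hu =>
    smul_mem_map_of_mem (hmJ _ (hpow n hn)) (hτ u hu)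
  have hlt : ∀ n, q < n → a ^ n ∈ J := by
    intro n hn
    have h1 : a ^ n = a ^ (n - q) * (a ^ q - s) + a ^ (n - q) * s := by
      rw [← mul_add, sub_add_cancel, ← pow_add, Nat.sub_add_cancel hn.le]
    rw [h1]
    exact add_mem (J.mul_mem_left _ haq) (hs _ (hpow _ (by omega)))
  have hval : ∀ (f : P[X]) (N : ℕ), f.natDegree < N →
      Polynomial.eval₂ (τ : P →+* B) (algebraMap A B a) f =
        ∑ n ∈ Finset.range N, a ^ n • τ (f.coeff n) := fun f N hN => by
    rw [Polynomial.eval₂_eq_sum_range' _ hN]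
    exact Finset.sum_congr rfl fun n _ => by
      rw [Algebra.smul_def, map_pow, mul_comm]; rfl
  refine ⟨(Polynomial.eval₂AlgHom τ (algebraMap A B a) fun _ => Commute.all _ _).comp E,
    fun x => ?_, fun u hu => ?_⟩
  · change Polynomial.eval₂ (τ : P →+* B) (algebraMap A B a) (E x) - τ x ∈ _
    rw [hval _ _ (Nat.lt_succ_self _), Finset.sum_range_succ', pow_zero, one_smul, hE.1,
      add_sub_cancel_right]
    exact sum_mem fun n _ => smul_mem_map (hpow _ (Nat.succ_ne_zero n)) _
  · change Polynomial.eval₂ (τ : P →+* B) (algebraMap A B a) (E u) ∈ _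
    rw [hval _ (max (E u).natDegree q + 1) (by omega)]
    have key := sum_sub_mem_of_forall (J.map (algebraMap A B)).toAddSubgroup
      (fun n => a ^ n • τ ((E u).coeff n)) hq
      (by omega : q < max (E u).natDegree q + 1) fun n hn0 hnq => by
        rcases lt_or_gt_of_ne hnq with hn | hn
        · exact hτm n hn0 _ ((hE.2 u hu).1 n hn)
        · exact smul_mem_map (hlt n hn) _
    rw [pow_zero, one_smul, hE.1] at key
    have h1 := hτm q hq _ (hE.2 u hu).2
    rw [map_sub, map_neg] at h1
    have h2 := smul_mem_map (B := B) haq (τ (η u))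
    convert sub_mem (add_mem (add_mem (show _ ∈ J.map (algebraMap A B) from key) h1) (hη u hu)) h2
      using 1
    simp only [sub_smul, smul_sub, smul_neg]
    ring

end Arc

section Denominators

variable {k : Type*} [Field k]

lemma exists_pow_mul_eq_zero {R L : Type*} [CommRing R] [IsNoetherianRing R] [CommRing L]
    [Algebra R L] (f : R) [IsLocalization.Away f L] :
    ∃ K : ℕ, ∀ r : R, algebraMap R L r = 0 → f ^ K * r = 0 := by
  obtain ⟨S, hS⟩ := (IsNoetherian.noetherian (RingHom.ker (algebraMap R L)))
  have h : ∀ r : R, ∃ n : ℕ, r ∈ RingHom.ker (algebraMap R L) → f ^ n * r = 0 := by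
    intro r
    by_cases hr : r ∈ RingHom.ker (algebraMap R L)
    · obtain ⟨⟨_, n, rfl⟩, hn⟩ := (IsLocalization.map_eq_zero_iff (Submonoid.powers f) L r).1 hr
      exact ⟨n, fun _ => hn⟩
    · exact ⟨0, fun h => absurd h hr⟩
  choose n hn using h
  refine ⟨∑ r ∈ S, n r, fun r hr => ?_⟩
  have hr' : r ∈ Submodule.span R (S : Set R) := hS ▸ hr
  refine Submodule.span_induction (p := fun r _ => f ^ (∑ r ∈ S, n r) * r = 0) ?_ ?_ ?_ ?_ hr'
  · intro x hx
    have hx' : x ∈ RingHom.ker (algebraMap R L) := hS ▸ Submodule.subset_span hx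
    have hle : n x ≤ ∑ r ∈ S, n r := Finset.single_le_sum (fun _ _ => Nat.zero_le _) hx
    rw [← Nat.sub_add_cancel hle, pow_add, mul_assoc, hn x hx', mul_zero]
  · exact mul_zero _
  · intro x y _ _ hx hy
    rw [mul_add, hx, hy, add_zero]
  · intro a x _ hx
    rw [smul_eq_mul, mul_left_comm, hx, mul_zero]

lemma exists_pow_coeff_integer {R L : Type*} [CommRing R] [CommRing L]
    [Algebra R L] (f : R) [IsLocalization.Away f L] {σ : Type*} [Finite σ] (g : σ → L[X]) :
    ∃ N : ℕ, ∀ j n, ∃ r : R, algebraMap R L r = (g j).coeff n * algebraMap R L f ^ N := by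
  classical
  cases nonempty_fintype σ
  have h : ∀ j, ∃ N : ℕ, ∀ n ∈ (g j).support,
      IsLocalization.IsInteger R (f ^ N • (g j).coeff n) := by
    intro j
    obtain ⟨⟨_, N, rfl⟩, hN⟩ := IsLocalization.exist_integer_multiples (Submonoid.powers f)
      (g j).support (g j).coeff
    exact ⟨N, hN⟩
  choose N hN using h
  refine ⟨∑ j, N j, fun j n => ?_⟩
  by_cases hn : n ∈ (g j).support
  · obtain ⟨r, hr⟩ := hN j n hn
    have hle : N j ≤ ∑ j, N j :=
      Finset.single_le_sum (fun _ _ => Nat.zero_le _) (Finset.mem_univ j)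
    refine ⟨r * f ^ (∑ j, N j - N j), ?_⟩
    rw [map_mul, hr, Algebra.smul_def, map_pow, map_pow, mul_comm (_ ^ _), mul_assoc, ← pow_add,
      Nat.add_sub_cancel' hle]
  · exact ⟨0, by rw [Polynomial.notMem_support_iff.1 hn, map_zero, zero_mul]⟩

/-- A one-parameter family over a principal open set becomes regular after rescaling the
parameter. -/
lemma exists_isArc_of_localization {σ : Type*} [Finite σ] {R : Type*} [CommRing R] [Algebra k R]
    [IsNoetherianRing R] {pr : MvPolynomial σ k →ₐ[k] R} (hpr : Function.Surjective pr)
    (f : MvPolynomial σ k) {L : Type*} [CommRing L] [Algebra k L] [Algebra R L]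
    [IsScalarTower k R L] [IsLocalization.Away (pr f) L] {q : ℕ} (hq : q ≠ 0)
    {η : MvPolynomial σ k → MvPolynomial σ k} {e : MvPolynomial σ k →ₐ[k] L[X]}
    (h0 : ∀ x, (e x).coeff 0 = algebraMap R L (pr x))
    (h1 : ∀ u ∈ RingHom.ker pr, (∀ n < q, (e u).coeff n = 0) ∧
      (e u).coeff q = algebraMap R L (pr (η u))) :
    ∃ (M : ℕ) (E : MvPolynomial σ k →ₐ[k] (MvPolynomial σ k)[X]),
      IsArc (RingHom.ker pr) q (fun u => (f ^ M) ^ q * η u) E := by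
  obtain ⟨N, hN⟩ := exists_pow_coeff_integer (pr f) fun j => e (MvPolynomial.X j)
  set c : L := algebraMap R L (pr f) ^ N with hc
  have hy : ∀ j n, ∃ y : MvPolynomial σ k, (n = 0 → y = MvPolynomial.X j) ∧
      algebraMap R L (pr y) = (e (MvPolynomial.X j)).coeff n * c ^ n := by
    intro j n
    rcases n with _ | n
    · exact ⟨_, fun _ => rfl, by rw [h0, pow_zero, mul_one]⟩
    · obtain ⟨r, hr⟩ := hN j (n + 1)
      obtain ⟨y, rfl⟩ := hpr r
      refine ⟨y * (f ^ N) ^ n, fun h => absurd h (Nat.succ_ne_zero n), ?_⟩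
      rw [map_mul, map_mul, hr, map_pow, map_pow, map_pow, map_pow, mul_assoc, ← hc, pow_succ']
  choose y hy0 hy using hy
  set Y : σ → (MvPolynomial σ k)[X] := fun j =>
    ∑ n ∈ Finset.range ((e (MvPolynomial.X j)).natDegree + 1), Polynomial.monomial n (y j n)
    with hY
  have hYc : ∀ j n, (Y j).coeff n =
      if n < (e (MvPolynomial.X j)).natDegree + 1 then y j n else 0 := fun j n => by
    simp [hY, Polynomial.finsetSum_coeff, Polynomial.coeff_monomial]
  set E₁ : MvPolynomial σ k →ₐ[k] (MvPolynomial σ k)[X] := MvPolynomial.aeval Y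
  have hE0 : ∀ x, (E₁ x).coeff 0 = x := by
    have : ((Polynomial.aeval (0 : MvPolynomial σ k)).restrictScalars k).comp E₁ =
        AlgHom.id k _ := by
      refine MvPolynomial.algHom_ext fun j => ?_
      have := hYc j 0
      rw [if_pos (Nat.succ_pos _), hy0 j 0 rfl] at this
      simpa [E₁, ← Polynomial.coeff_zero_eq_eval_zero] using this
    intro x
    rw [Polynomial.coeff_zero_eq_aeval_zero]
    exact AlgHom.congr_fun this x
  have hmap : ∀ (g : (MvPolynomial σ k)[X]) n,
      (Polynomial.mapAlgHom ((Algebra.algHom k R L).comp pr) g).coeff n =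
        algebraMap R L (pr (g.coeff n)) := fun g n => Polynomial.coeff_map _ _
  have hE : ∀ x n, algebraMap R L (pr ((E₁ x).coeff n)) = (e x).coeff n * c ^ n := by
    have : (Polynomial.mapAlgHom ((Algebra.algHom k R L).comp pr)).comp E₁ =
        (scale k c).comp e := by
      refine MvPolynomial.algHom_ext fun j => Polynomial.ext fun n => ?_
      rw [AlgHom.comp_apply, AlgHom.comp_apply, scale_coeff, MvPolynomial.aeval_X]
      rw [hmap, hYc]
      split_ifs with hn
      · exact hy j n
      · rw [Polynomial.coeff_eq_zero_of_natDegree_lt (by omega), zero_mul, map_zero, map_zero]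
    intro x n
    have h2 := congrArg (fun g => g.coeff n) (AlgHom.congr_fun this x)
    simp only [AlgHom.comp_apply, scale_coeff] at h2
    rw [← h2, hmap]
  obtain ⟨K, hK⟩ := exists_pow_mul_eq_zero (L := L) (pr f)
  have hK' : ∀ n, n ≠ 0 → ∀ x : MvPolynomial σ k, algebraMap R L (pr x) = 0 →
      x * (f ^ K) ^ n ∈ RingHom.ker pr := by
    intro n hn x hx
    obtain ⟨n, rfl⟩ := Nat.exists_eq_succ_of_ne_zero hn
    rw [RingHom.mem_ker, pow_succ', map_mul, map_mul, map_pow, ← mul_assoc, mul_comm (pr x),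
      hK _ hx, zero_mul]
  refine ⟨N + K, (scale k (f ^ K)).comp E₁, fun x => ?_, fun u hu => ⟨fun n hn => ?_, ?_⟩⟩
  · rw [AlgHom.comp_apply, scale_coeff, pow_zero, mul_one, hE0]
  · rw [AlgHom.comp_apply, scale_coeff]
    rcases eq_or_ne n 0 with rfl | hn0
    · rw [pow_zero, mul_one, hE0]
      exact hu
    · exact hK' n hn0 _ (by rw [hE, (h1 u hu).1 n hn, zero_mul])
  · rw [AlgHom.comp_apply, scale_coeff]
    have h3 := hK' q hq ((E₁ u).coeff q - (f ^ N) ^ q * η u) (by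
      rw [map_sub, map_sub, hE, (h1 u hu).2]
      simp only [map_mul, map_pow, hc]
      ring)
    convert h3 using 1
    rw [pow_add]
    ring

end Denominators

section Chart

variable {k : Type*} [Field k]

section Lift

variable {P L : Type*} [CommRing P] [Algebra k P] [CommRing L] [Algebra k L]
variable {A : Type*} [CommRing A] [Algebra k A]

lemma baseMap_mem_coeffIdeal (h : P →ₐ[k] L) {K : Ideal A} {y : A ⊗[k] P}
    (hy : y ∈ coeffIdeal k P K) :
    Algebra.TensorProduct.map (AlgHom.id A A) h y ∈ coeffIdeal k L K :=
  map_mem_coeffIdeal (Algebra.TensorProduct.map (AlgHom.id A A) h).toRingHom (fun a ha => by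
    simpa using tmul_mem_coeffIdeal ha (1 : L)) hy

lemma exists_baseMap_eq {h : P →ₐ[k] L} (hh : Function.Surjective h) {K : Ideal A} {y : A ⊗[k] L}
    (hy : y ∈ coeffIdeal k L K) :
    ∃ z ∈ coeffIdeal k P K, Algebra.TensorProduct.map (AlgHom.id A A) h z = y := by
  refine coeffIdeal_induction (p := fun y => ∃ z ∈ coeffIdeal k P K,
    Algebra.TensorProduct.map (AlgHom.id A A) h z = y) ⟨0, zero_mem _, map_zero _⟩ ?_ ?_ hy
  · rintro _ _ ⟨z, hz, rfl⟩ ⟨z', hz', rfl⟩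
    exact ⟨z + z', add_mem hz hz', map_add _ _ _⟩
  · intro a ha x
    obtain ⟨x, rfl⟩ := hh x
    exact ⟨a ⊗ₜ x, tmul_mem_coeffIdeal ha x, by simp⟩

lemma baseMap_eq_zero_of_mem (h : P →ₐ[k] L) {y : A ⊗[k] P}
    (hy : y ∈ baseIdeal k A (RingHom.ker h)) :
    Algebra.TensorProduct.map (AlgHom.id A A) h y = 0 := by
  have : baseIdeal k A (RingHom.ker h) ≤
      RingHom.ker (Algebra.TensorProduct.map (AlgHom.id A A) h) := by
    refine Ideal.map_le_iff_le_comap.2 fun u hu => ?_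
    have hu' : h u = 0 := hu
    simp [hu']
  exact this hy

lemma mem_of_baseMap_mem {h : P →ₐ[k] L} (hh : Function.Surjective h) {K : Ideal A}
    {y : A ⊗[k] P} (hy : Algebra.TensorProduct.map (AlgHom.id A A) h y ∈ coeffIdeal k L K) :
    y ∈ baseIdeal k A (RingHom.ker h) ⊔ coeffIdeal k P K := by
  obtain ⟨z, hz, hzy⟩ := exists_baseMap_eq hh hy
  refine Submodule.mem_sup.2 ⟨y - z, ?_, z, hz, sub_add_cancel y z⟩
  have h1 : ∀ w : A ⊗[k] P, Algebra.TensorProduct.map (AlgHom.id A A) h w =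
      Algebra.TensorProduct.map (AlgHom.id k A) h w := by
    intro w
    induction w with
    | zero => rw [map_zero, map_zero]
    | tmul a x => simp
    | add x y hx hy => rw [map_add, map_add, hx, hy]
  have h2 : y - z ∈ RingHom.ker (Algebra.TensorProduct.map (AlgHom.id k A) h) := by
    rw [RingHom.mem_ker, ← h1, map_sub, hzy, sub_self]
  rw [Algebra.TensorProduct.lTensor_ker h hh] at h2
  exact h2

lemma baseMap_mem_of_mem_errIdeal (h : P →ₐ[k] L) {m J : Ideal A} {y : A ⊗[k] P}
    (hy : y ∈ errIdeal k m (RingHom.ker h) J) :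
    Algebra.TensorProduct.map (AlgHom.id A A) h y ∈ coeffIdeal k L J := by
  obtain ⟨i, hi, j, hj, rfl⟩ := Submodule.mem_sup.1 hy
  rw [map_add, baseMap_eq_zero_of_mem h (Ideal.mul_le_right hi), zero_add]
  exact baseMap_mem_coeffIdeal h hj

lemma exists_algHom_factor {R C : Type*} [CommRing R] [Algebra k R] [CommRing C] [Algebra k C]
    {pr : P →ₐ[k] R} (hpr : Function.Surjective pr) (h : P →ₐ[k] C)
    (hk : ∀ u ∈ RingHom.ker pr, h u = 0) : ∃ h' : R →ₐ[k] C, ∀ x, h' (pr x) = h x := by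
  refine ⟨(Ideal.Quotient.liftₐ (RingHom.ker pr) h hk).comp
    (Ideal.quotientKerAlgEquivOfSurjective hpr).symm.toAlgHom, fun x => ?_⟩
  have : (Ideal.quotientKerAlgEquivOfSurjective hpr).symm (pr x) =
      Ideal.Quotient.mk (RingHom.ker pr) x := by
    rw [AlgEquiv.symm_apply_eq]
    rfl
  rw [AlgHom.comp_apply]
  exact (congrArg _ this).trans (Ideal.Quotient.lift_mk _ _ _)

/-- The isomorphism `k[X] ⊗ L → L[X]`. -/
noncomputable def toPoly (k : Type*) [Field k] (L : Type*) [CommRing L] [Algebra k L] :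
    k[X] ⊗[k] L →ₐ[k] L[X] :=
  Algebra.TensorProduct.lift (Polynomial.mapAlgHom (Algebra.ofId k L)) Polynomial.CAlgHom
    (fun _ _ => Commute.all _ _)

lemma toPoly_tmul (a : k[X]) (x : L) :
    toPoly k L (a ⊗ₜ x) = a.map (algebraMap k L) * Polynomial.C x := by
  rw [toPoly, Algebra.TensorProduct.lift_tmul]
  rfl

lemma toPoly_X_pow_coeff (n q : ℕ) (x : L) :
    (toPoly k L ((Polynomial.X ^ q : k[X]) ⊗ₜ x)).coeff n = if n = q then x else 0 := by
  rw [toPoly_tmul, Polynomial.map_pow, Polynomial.map_X, Polynomial.coeff_mul_C,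
    Polynomial.coeff_X_pow]
  split_ifs <;> simp

lemma toPoly_coeff_of_mem {n i : ℕ} (hi : i < n) {y : k[X] ⊗[k] L}
    (hy : y ∈ coeffIdeal k L (XI k n)) : (toPoly k L y).coeff i = 0 := by
  refine coeffIdeal_induction (p := fun y => (toPoly k L y).coeff i = 0) (by simp) ?_ ?_ hy
  · intro x y hx hy
    rw [map_add, Polynomial.coeff_add, hx, hy, add_zero]
  · intro a ha x
    obtain ⟨b, rfl⟩ := mem_XI.1 ha
    rw [toPoly_tmul, Polynomial.coeff_mul_C, Polynomial.map_mul, Polynomial.map_pow,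
      Polynomial.map_X, Polynomial.coeff_X_pow_mul', if_neg (by omega), zero_mul]

end Lift

variable {A : Type*} [CommRing A] [Algebra k A]

lemma exists_unip_lift {σ : Type*} {L : Type*} [CommRing L] [Algebra k L] {m : Ideal A}
    {pr : MvPolynomial σ k →ₐ[k] L} (hpr : Function.Surjective pr)
    (γ : MvPolynomial σ k →ₐ[k] A ⊗[k] L) (hγ : ∀ x, γ x - 1 ⊗ₜ pr x ∈ coeffIdeal k L m) :
    ∃ g : A ⊗[k] MvPolynomial σ k →ₐ[A] A ⊗[k] MvPolynomial σ k, Unip m g ∧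
      ∀ x, Algebra.TensorProduct.map (AlgHom.id A A) pr (g (1 ⊗ₜ x)) = γ x := by
  choose z hz hzγ using fun j => exists_baseMap_eq hpr (hγ (MvPolynomial.X j))
  set G : MvPolynomial σ k →ₐ[k] A ⊗[k] MvPolynomial σ k :=
    MvPolynomial.aeval fun j => 1 ⊗ₜ MvPolynomial.X j + z j with hG
  have hGX : ∀ j, G (MvPolynomial.X j) = 1 ⊗ₜ MvPolynomial.X j + z j := fun j => by simp [hG]
  refine ⟨ofHom G, congrMod_of_X fun j => ?_, fun x => ?_⟩
  · rw [ofHom_one_tmul, hGX, AlgHom.one_apply, add_sub_cancel_left]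
    exact hz j
  · rw [ofHom_one_tmul]
    have : ((Algebra.TensorProduct.map (AlgHom.id A A) pr).restrictScalars k).comp G = γ := by
      refine MvPolynomial.algHom_ext fun j => ?_
      rw [AlgHom.comp_apply, hGX, AlgHom.restrictScalars_apply, map_add, hzγ]
      simp
    exact AlgHom.congr_fun this x

end Chart

section LocalChart

variable {k : Type*} [Field k] {A : Type*} [CommRing A] [Algebra k A] {ε : A →ₐ[k] k}

lemma isNilpotent_of_mem_coeffIdeal {P : Type*} [CommRing P] [Algebra k P] {m : Ideal A} {r : ℕ}
    (hr : m ^ r = ⊥) {y : A ⊗[k] P} (hy : y ∈ coeffIdeal k P m) : IsNilpotent y := by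
  refine ⟨r, ?_⟩
  have := Ideal.pow_mem_pow hy r
  rwa [coeffIdeal, ← Ideal.map_pow, hr, Ideal.map_bot, Ideal.mem_bot] at this

lemma algHom_mem_coeffIdeal {L : Type*} [CommRing L] [Algebra k L] {B : Type*} [CommRing B]
    [Algebra A B] (β : B →ₐ[A] A ⊗[k] L) {K : Ideal A} {b : B}
    (hb : b ∈ K.map (algebraMap A B)) : β b ∈ coeffIdeal k L K := by
  have : K.map (algebraMap A B) ≤ (coeffIdeal k L K).comap β := by
    refine Ideal.map_le_iff_le_comap.2 fun a ha => ?_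
    rw [Ideal.mem_comap, Ideal.mem_comap, AlgHom.commutes]
    exact Ideal.mem_map_of_mem _ ha
  exact this hb

/-- A morphism `P → A ⊗ L` extends to the presentation `P[Y] → L` of the localisation `L` of
`R = P / I`, and the extension preserves the new ideal modulo `J`. -/
lemma exists_extension {σ : Type*} {R : Type*} [CommRing R] [Algebra k R]
    {pr : MvPolynomial σ k →ₐ[k] R} (hpr : Function.Surjective pr) (f : MvPolynomial σ k)
    {L : Type*} [CommRing L] [Algebra k L] [Algebra R L] [IsScalarTower k R L]
    [IsLocalization.Away (pr f) L] {m : Ideal A} {r : ℕ} (hr : m ^ r = ⊥)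
    (hε : RingHom.ker ε.toRingHom = m) {J : Ideal A} (θ : MvPolynomial σ k →ₐ[k] A ⊗[k] L)
    (hθ : ∀ x, tensorProj k A ε L (θ x) = algebraMap R L (pr x))
    (hθJ : ∀ u ∈ RingHom.ker pr, θ u ∈ coeffIdeal k L J) :
    ∃ (pr' : MvPolynomial (Option σ) k →ₐ[k] L) (γ : MvPolynomial (Option σ) k →ₐ[k] A ⊗[k] L),
      Function.Surjective pr' ∧ (∀ x, pr' (MvPolynomial.rename some x) = algebraMap R L (pr x)) ∧
      (∀ x, γ (MvPolynomial.rename some x) = θ x) ∧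
      (∀ x, γ x - 1 ⊗ₜ pr' x ∈ coeffIdeal k L m) ∧
      ∀ u ∈ RingHom.ker pr', γ u ∈ coeffIdeal k L J := by
  have hunit : IsUnit (θ f) := by
    have h1 := sub_tmul_tensorProj_mem hε (θ f)
    have h2 : IsUnit ((1 : A) ⊗ₜ[k] tensorProj k A ε L (θ f)) := by
      rw [hθ]
      exact (IsLocalization.Away.algebraMap_isUnit (pr f)).map
        (Algebra.TensorProduct.includeRight : L →ₐ[k] A ⊗[k] L)
    have h3 := (isNilpotent_of_mem_coeffIdeal hr h1).isUnit_add_left_of_commute h2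
      (Commute.all _ _)
    simpa using h3
  obtain ⟨b, hb⟩ := hunit.exists_right_inv
  set c : L := IsLocalization.Away.invSelf (pr f) with hc
  have hcf : algebraMap R L (pr f) * c = 1 := IsLocalization.Away.mul_invSelf (pr f)
  set pr' : MvPolynomial (Option σ) k →ₐ[k] L :=
    MvPolynomial.aeval fun o => o.elim c fun j => algebraMap R L (pr (MvPolynomial.X j)) with hpr'
  set γ : MvPolynomial (Option σ) k →ₐ[k] A ⊗[k] L :=
    MvPolynomial.aeval fun o => o.elim b fun j => θ (MvPolynomial.X j) with hγ
  have hprX : ∀ x, pr' (MvPolynomial.rename some x) = algebraMap R L (pr x) := by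
    have : pr'.comp (MvPolynomial.rename some) = (Algebra.algHom k R L).comp pr :=
      MvPolynomial.algHom_ext fun j => by simp [hpr']; rfl
    exact fun x => AlgHom.congr_fun this x
  have hγX : ∀ x, γ (MvPolynomial.rename some x) = θ x := by
    have : γ.comp (MvPolynomial.rename some) = θ :=
      MvPolynomial.algHom_ext fun j => by simp [hγ]
    exact fun x => AlgHom.congr_fun this x
  have hprn : pr' (MvPolynomial.X none) = c := by simp [hpr']
  have hγn : γ (MvPolynomial.X none) = b := by simp [hγ]
  have hproj : ∀ x, tensorProj k A ε L (γ x) = pr' x := by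
    have : (tensorProj k A ε L).comp γ = pr' := by
      refine MvPolynomial.algHom_ext fun o => ?_
      rcases o with _ | j
      · rw [AlgHom.comp_apply, hprn, hγn]
        have h1 := congrArg (tensorProj k A ε L) hb
        rw [map_mul, hθ, map_one] at h1
        linear_combination c * h1 - tensorProj k A ε L b * hcf
      · have h1 := hprX (MvPolynomial.X j)
        have h2 := hγX (MvPolynomial.X j)
        rw [MvPolynomial.rename_X] at h1 h2
        rw [AlgHom.comp_apply, h1, h2, hθ]
    exact fun x => AlgHom.congr_fun this x
  refine ⟨pr', γ, fun z => ?_, hprX, hγX, fun x => ?_, fun u hu => ?_⟩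
  · obtain ⟨n, a, ha⟩ := IsLocalization.Away.surj (pr f) z
    obtain ⟨a, rfl⟩ := hpr a
    refine ⟨MvPolynomial.rename some a * MvPolynomial.X none ^ n, ?_⟩
    rw [map_mul, map_pow, hprX, hprn, ← ha, mul_assoc, ← mul_pow, hcf, one_pow, mul_one]
  · rw [← hproj]
    exact sub_tmul_tensorProj_mem hε _
  · set mk := Ideal.Quotient.mkₐ k (coeffIdeal k L J) with hmk
    obtain ⟨h', hh'⟩ := exists_algHom_factor hpr (mk.comp θ) fun u hu =>
      Ideal.Quotient.eq_zero_iff_mem.2 (hθJ u hu)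
    have hu' : IsUnit ((h' : R →+* (A ⊗[k] L) ⧸ coeffIdeal k L J) (pr f)) := by
      have := hunit.map mk
      rwa [← AlgHom.comp_apply, ← hh'] at this
    set h'' : L →+* (A ⊗[k] L) ⧸ coeffIdeal k L J := IsLocalization.Away.lift (pr f) hu'
    have hlift : ∀ x, h'' (algebraMap R L (pr x)) = mk (θ x) := fun x =>
      (IsLocalization.Away.lift_eq (pr f) hu' (pr x)).trans (hh' x)
    have hkey : h''.comp (pr' : MvPolynomial (Option σ) k →+* L) =
        (mk : A ⊗[k] L →+* _).comp (γ : MvPolynomial (Option σ) k →+* A ⊗[k] L) := by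
      refine MvPolynomial.ringHom_ext (fun a => ?_) fun o => ?_
      · have h1 := hlift (MvPolynomial.C a)
        have h2 := hprX (MvPolynomial.C a)
        have h3 := hγX (MvPolynomial.C a)
        rw [MvPolynomial.rename_C] at h2 h3
        simp only [RingHom.comp_apply, RingHom.coe_coe]
        rw [h2, h3, h1]
      · rcases o with _ | j
        · simp only [RingHom.comp_apply, RingHom.coe_coe]
          rw [hprn, hγn]
          have h1 := congrArg h'' hcf
          have h2 := congrArg mk hb
          rw [map_mul, map_one, hlift] at h1
          rw [map_mul, map_one] at h2
          linear_combination mk b * h1 - h'' c * h2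
        · have h1 := hprX (MvPolynomial.X j)
          have h2 := hγX (MvPolynomial.X j)
          rw [MvPolynomial.rename_X] at h1 h2
          simp only [RingHom.comp_apply, RingHom.coe_coe]
          rw [h1, h2, hlift]
    have h1 := RingHom.congr_fun hkey u
    simp only [RingHom.comp_apply, RingHom.coe_coe] at h1
    rw [(RingHom.mem_ker.1 hu : pr' u = 0), map_zero] at h1
    exact Ideal.Quotient.eq_zero_iff_mem.1 h1.symm

end LocalChart

section ArcOfChart

variable {k : Type*} [Field k] [IsAlgClosed k] {p : ℕ} [Fact p.Prime] [CharP k p]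
variable {A : Type*} [CommRing A] [Algebra k A] [IsNoetherianRing A] {ε : A →ₐ[k] k}

/-- A lift `P → A ⊗ L` of the presentation of a localisation `L` of `R`, moving the ideal of
relations by `sη`, yields an arc moving it by a multiple of `η`. -/
lemma exists_isArc_of_lift {σ : Type*} [Finite σ] {R : Type*} [CommRing R] [Algebra k R]
    [IsNoetherianRing R] {pr : MvPolynomial σ k →ₐ[k] R} (hpr : Function.Surjective pr)
    (f : MvPolynomial σ k) {L : Type*} [CommRing L] [Algebra k L] [Algebra R L]
    [IsScalarTower k R L] [IsLocalization.Away (pr f) L] {m J : Ideal A} {r : ℕ} (hr : m ^ r = ⊥)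
    (hε : RingHom.ker ε.toRingHom = m) {s : A} (hsm : s ∈ m) (hs : ∀ a ∈ m, a * s ∈ J)
    (hsJ : s ∉ J) (hJ : J ≤ m) {e : ℕ} (he : ∀ e', ∀ a ∈ m, a ^ p ^ e' - s ∈ J → e' ≤ e)
    (θ : MvPolynomial σ k →ₐ[k] A ⊗[k] L)
    (hθ : ∀ x, tensorProj k A ε L (θ x) = algebraMap R L (pr x))
    {η : MvPolynomial σ k → MvPolynomial σ k}
    (hη : ∀ u ∈ RingHom.ker pr, θ u - s • θ (η u) ∈ coeffIdeal k L J) :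
    ∃ (M : ℕ) (E : MvPolynomial σ k →ₐ[k] (MvPolynomial σ k)[X]),
      IsArc (RingHom.ker pr) (p ^ e) (fun u => (f ^ M) ^ p ^ e * η u) E := by
  have hq : p ^ e ≠ 0 := pow_ne_zero _ (Fact.out : p.Prime).ne_zero
  have hm : ∀ a : A, ∃ c : k, a - algebraMap k A c ∈ m := fun a =>
    ⟨ε a, sub_algebraMap_mem hε a⟩
  have hsJ' : s ∈ J ⊔ Ideal.span {s} := Ideal.mem_sup_right (Ideal.mem_span_singleton_self s)
  have hJ' : J ⊔ Ideal.span {s} ≤ m :=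
    sup_le hJ ((Ideal.span_singleton_le_iff_mem m).2 hsm)
  have hθJ : ∀ u ∈ RingHom.ker pr, θ u ∈ coeffIdeal k L (J ⊔ Ideal.span {s}) := fun u hu => by
    have := add_mem (coeffIdeal_mono le_sup_left (hη u hu))
      (smul_mem_coeffIdeal (k := k) hsJ' (θ (η u)))
    rwa [sub_add_cancel] at this
  obtain ⟨pr', γ, hpr', hprX, hγX, hγ, hγJ⟩ := exists_extension hpr f hr hε θ hθ hθJ
  obtain ⟨g, hg, hgγ⟩ := exists_unip_lift hpr' γ hγ
  have hpres : Pres m (RingHom.ker pr') (J ⊔ Ideal.span {s}) g := by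
    intro u hu
    have h1 := mem_errIdeal_of_mem_coeffIdeal hJ' (hg (1 ⊗ₜ u)) (sub_mem
      (mem_of_baseMap_mem hpr' (y := g (1 ⊗ₜ u)) (by rw [hgγ]; exact hγJ u hu))
      (Ideal.mem_sup_left (tmul_mem_baseIdeal (1 : A) hu)))
    rw [TensorProduct.zero_tmul, sub_zero]
    exact h1
  obtain ⟨ξ, hξ⟩ := hpres.ob m hsJ' (exists_sub_smul_mem_of_sup hm hs)
  have hker : ∀ u ∈ RingHom.ker pr, MvPolynomial.rename some u ∈ RingHom.ker pr' := fun u hu => by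
    rw [RingHom.mem_ker, hprX, (RingHom.mem_ker.1 hu : pr u = 0), map_zero]
  have hξη : ∀ u ∈ RingHom.ker pr,
      pr' (ξ (MvPolynomial.rename some u)) = algebraMap R L (pr (η u)) := by
    intro u hu
    have h0 : pr' (MvPolynomial.rename some u) = 0 := hker u hu
    have h1 := baseMap_mem_of_mem_errIdeal pr' (hξ _ (hker u hu))
    simp only [map_sub, hgγ, hγX, Algebra.TensorProduct.map_tmul, h0, TensorProduct.tmul_zero,
      sub_zero, AlgHom.id_apply] at h1
    have h2 : s • (θ (η u) - 1 ⊗ₜ[k] algebraMap R L (pr (η u))) ∈ coeffIdeal k L J := by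
      refine smul_mem_map_of_mem hs ?_
      rw [← hθ]
      exact sub_tmul_tensorProj_mem hε _
    have h3 : s ⊗ₜ[k] (pr' (ξ (MvPolynomial.rename some u)) - algebraMap R L (pr (η u))) ∈
        baseIdeal k A (⊥ : Ideal L) ⊔ coeffIdeal k L J := by
      refine Ideal.mem_sup_right ?_
      convert sub_mem (add_mem (hη u hu) h2) h1 using 1
      rw [smul_sub, TensorProduct.tmul_sub, TensorProduct.smul_tmul', smul_eq_mul, mul_one]
      ring
    exact sub_eq_zero.1 (mem_of_tmul_mem hsJ h3)
  obtain ⟨F, w, hF, hFw, hw⟩ := exists_curve_of_ob (p := p) hm hr hsm hs hsJ hJ he hg hξ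
  set Φ : k[X] ⊗[k] MvPolynomial (Option σ) k →ₐ[k] L[X] := (toPoly k L).comp
    ((Algebra.TensorProduct.map (AlgHom.id k[X] k[X]) pr').restrictScalars k) with hΦ
  have hΦt : ∀ (q : ℕ) x, Φ ((Polynomial.X ^ q : k[X]) ⊗ₜ x) =
      toPoly k L ((Polynomial.X ^ q : k[X]) ⊗ₜ pr' x) := fun q x => by simp [hΦ]
  have hΦmem : ∀ {n i : ℕ}, i < n → ∀ {y}, Algebra.TensorProduct.map (AlgHom.id k[X] k[X]) pr' y ∈
      coeffIdeal k L (XI k n) → (Φ y).coeff i = 0 := fun hi _ hy => toPoly_coeff_of_mem hi hy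
  refine exists_isArc_of_localization hpr f (L := L) hq (e := Φ.comp (((F.restrictScalars k).comp
    Algebra.TensorProduct.includeRight).comp (MvPolynomial.rename some))) (fun x => ?_)
    fun u hu => ?_
  · have h1 := hΦmem zero_lt_one (baseMap_mem_coeffIdeal pr' (hF (1 ⊗ₜ MvPolynomial.rename some x)))
    have h2 := hΦt 0 (MvPolynomial.rename some x)
    rw [AlgHom.one_apply, map_sub, Polynomial.coeff_sub, ← pow_zero Polynomial.X, h2,
      toPoly_X_pow_coeff, if_pos rfl, hprX, pow_zero] at h1
    exact sub_eq_zero.1 h1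
  · have h0 : pr' (MvPolynomial.rename some u) = 0 := hker u hu
    have h1 := baseMap_mem_of_mem_errIdeal pr' (hFw _ (hker u hu))
    have h2 := hΦt 0 (MvPolynomial.rename some u)
    rw [h0, TensorProduct.tmul_zero, map_zero, pow_zero] at h2
    have h3 : ∀ i < p ^ e + 1, (Φ (F (1 ⊗ₜ MvPolynomial.rename some u))).coeff i =
        if i = p ^ e then pr' (w (MvPolynomial.rename some u)) else 0 := fun i hi => by
      have h3 := hΦmem hi h1
      rw [map_sub, map_sub, h2, hΦt, sub_zero, Polynomial.coeff_sub, toPoly_X_pow_coeff] at h3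
      exact sub_eq_zero.1 h3
    refine ⟨fun n hn => (h3 n (by omega)).trans (if_neg hn.ne), ?_⟩
    refine (h3 (p ^ e) (by omega)).trans ?_
    rw [if_pos rfl, ← hξη u hu]
    have h4 : pr' _ = 0 := hw _ (hker u hu)
    rw [map_sub] at h4
    exact (sub_eq_zero.1 h4).symm

end ArcOfChart

section Global

variable {k : Type*} [Field k]

/-- The largest `e` for which `s` is a `p ^ e`-th power of an element of `m` modulo `J`. -/
lemma exists_max_pow {A : Type*} [CommRing A] {p : ℕ} (hp : 1 < p) {m J : Ideal A} {r : ℕ}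
    (hr : m ^ r = ⊥) {s : A} (hsm : s ∈ m) (hsJ : s ∉ J) :
    ∃ e, ∃ a ∈ m, a ^ p ^ e - s ∈ J ∧ ∀ e', ∀ a ∈ m, a ^ p ^ e' - s ∈ J → e' ≤ e := by
  classical
  have hbd : ∀ e', ∀ a ∈ m, a ^ p ^ e' - s ∈ J → e' ≤ r := by
    intro e' a ha h
    by_contra! hlt
    have h1 : a ^ r = 0 := by
      rw [← Ideal.mem_bot, ← hr]
      exact Ideal.pow_mem_pow ha r
    rw [pow_eq_zero_of_le (hlt.le.trans (Nat.lt_pow_self hp).le) h1, zero_sub, neg_mem_iff] at h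
    exact hsJ h
  set Q : ℕ → Prop := fun e => ∃ a ∈ m, a ^ p ^ e - s ∈ J with hQ
  have h0 : Q 0 := ⟨s, hsm, by simp⟩
  obtain ⟨a, ha, haJ⟩ := Nat.findGreatest_spec (P := Q) (Nat.zero_le r) h0
  exact ⟨Nat.findGreatest Q r, a, ha, haJ, fun e' a ha h =>
    Nat.le_findGreatest (hbd e' a ha h) ⟨a, ha, h⟩⟩

/-- Lifts of a presentation modulo `J + (s)` move the relations by `sη` modulo `J`. -/
lemma exists_obstruction {A : Type*} [CommRing A] {B : Type*} [CommRing B] [Algebra A B]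
    {R P F : Type*} [CommRing R] [CommRing P] [FunLike F P B] {π : B →+* R} {m J : Ideal A}
    (hkerπ : RingHom.ker π = m.map (algebraMap A B)) {s : A} (hs : ∀ a ∈ m, a * s ∈ J)
    {τ : F} (hτ : ∀ b, ∃ x, π (τ x) = π b) (I : Ideal P)
    (hI : ∀ u ∈ I, τ u ∈ (J ⊔ Ideal.span {s}).map (algebraMap A B)) :
    ∃ η : P → P, ∀ u ∈ I, τ u - s • τ (η u) ∈ J.map (algebraMap A B) := by
  have : ∀ u, ∃ w, u ∈ I → τ u - s • τ w ∈ J.map (algebraMap A B) := by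
    intro u
    by_cases hu : u ∈ I
    · have h1 := hI u hu
      rw [Ideal.map_sup, Ideal.map_span, Set.image_singleton] at h1
      obtain ⟨y, hy, z, hz, hyz⟩ := Submodule.mem_sup.1 h1
      obtain ⟨b, rfl⟩ := Ideal.mem_span_singleton'.1 hz
      obtain ⟨x, hx⟩ := hτ b
      refine ⟨x, fun _ => ?_⟩
      have h2 : b - τ x ∈ m.map (algebraMap A B) := by
        rw [← hkerπ, RingHom.mem_ker, map_sub, hx, sub_self]
      convert add_mem hy (smul_mem_map_of_mem hs h2) using 1
      rw [← hyz, smul_sub, Algebra.smul_def s b]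
      ring
    · exact ⟨0, fun h => absurd h hu⟩
  choose η hη using this
  exact ⟨η, fun u hu => hη u hu⟩

variable {A : Type*} [CommRing A] [Algebra k A] {ε : A →ₐ[k] k}
variable {B : Type*} [CommRing B] [Algebra k B] [Algebra A B] [IsScalarTower k A B]

/-- A locally trivial deformation of an affine scheme has a section. -/
lemma exists_section [IsAlgClosed k] {p : ℕ} [Fact p.Prime] [CharP k p] {R : Type*} [CommRing R]
    [Algebra k R] [Algebra.FiniteType k R] [IsNoetherianRing A] {m : Ideal A} {r : ℕ}
    (hr : m ^ r = ⊥) (hε : RingHom.ker ε.toRingHom = m) {π : B →ₐ[k] R}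
    (hπ : Function.Surjective π) (hkerπ : RingHom.ker π.toRingHom = m.map (algebraMap A B))
    {ι : Type*} [Finite ι] (f : ι → R) (hf : Ideal.span (Set.range f) = ⊤)
    (β : ∀ i, B →ₐ[A] A ⊗[k] Localization.Away (f i))
    (hβ : ∀ i b, tensorProj k A ε _ (β i b) = algebraMap R (Localization.Away (f i)) (π b)) :
    ∃ t : R →ₐ[k] B, ∀ x, π (t x) = x := by
  cases nonempty_fintype ι
  have : IsNoetherianRing R := Algebra.FiniteType.isNoetherianRing k R
  obtain ⟨n, pr, hpr⟩ := Algebra.FiniteType.iff_quotient_mvPolynomial''.1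
    (inferInstance : Algebra.FiniteType k R)
  choose fl hfl using fun i => hpr (f i)
  have hker : ∀ b, b ∈ m.map (algebraMap A B) ↔ π b = 0 := fun b => by
    rw [← hkerπ]; exact RingHom.mem_ker
  have key : ∃ τ : MvPolynomial (Fin n) k →ₐ[k] B, (∀ x, π (τ x) = pr x) ∧
      ∀ u ∈ RingHom.ker pr, τ u ∈ (⊥ : Ideal A).map (algebraMap A B) := by
    refine ideal_descent (S := fun J => ∃ τ : MvPolynomial (Fin n) k →ₐ[k] B,
      (∀ x, π (τ x) = pr x) ∧ ∀ u ∈ RingHom.ker pr, τ u ∈ J.map (algebraMap A B)) hr ?_ ?_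
    · choose b hb using fun j => hπ (pr (MvPolynomial.X j))
      have h1 : π.comp (MvPolynomial.aeval b) = pr :=
        MvPolynomial.algHom_ext fun j => by simp [hb]
      have h2 := fun x => AlgHom.congr_fun h1 x
      exact ⟨MvPolynomial.aeval b, h2, fun u hu => (hker _).2 ((h2 u).trans hu)⟩
    · rintro J s hJ hsm hsJ hs ⟨τ, hτ, hτJ⟩
      obtain ⟨e, a, ha, haJ, he⟩ := exists_max_pow (Fact.out : p.Prime).one_lt hr hsm hsJ
      have hq : p ^ e ≠ 0 := pow_ne_zero _ (Fact.out : p.Prime).ne_zero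
      obtain ⟨η, hη⟩ := exists_obstruction (π := π.toRingHom) hkerπ hs (τ := τ) (fun b => by
        obtain ⟨x, hx⟩ := hpr (π b)
        exact ⟨x, (hτ x).trans hx⟩) (RingHom.ker pr) hτJ
      have hloc : ∀ i, ∃ (M : ℕ) (E : MvPolynomial (Fin n) k →ₐ[k] (MvPolynomial (Fin n) k)[X]),
          IsArc (RingHom.ker pr) (p ^ e) (fun u => (fl i ^ M) ^ p ^ e * η u) E := by
        intro i
        have : IsLocalization.Away (pr (fl i)) (Localization.Away (f i)) := by
          rw [hfl]; infer_instance
        refine exists_isArc_of_lift hpr (fl i) hr hε hsm hs hsJ hJ he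
          (((β i).restrictScalars k).comp τ) (fun x => ?_) fun u hu => ?_
        · rw [← hτ]
          exact hβ i (τ x)
        · have := algHom_mem_coeffIdeal (β i) (hη u hu)
          rwa [map_sub, map_smul] at this
      choose M hM using hloc
      obtain ⟨c, hc⟩ : ∃ c : ι → MvPolynomial (Fin n) k,
          ∑ i, c i * fl i ^ (∑ j, M j) - 1 ∈ RingHom.ker pr := by
        have h1 := Ideal.span_pow_eq_top _ hf (∑ j, M j)
        rw [← Set.range_comp, Ideal.eq_top_iff_one, Ideal.mem_span_range_iff_exists_fun] at h1
        obtain ⟨c, hc⟩ := h1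
        choose cl hcl using fun i => hpr (c i)
        refine ⟨cl, ?_⟩
        rw [RingHom.mem_ker, map_sub, map_sum, map_one, ← hc, sub_eq_zero]
        exact Finset.sum_congr rfl fun i _ => by rw [map_mul, map_pow, hcl, hfl]; rfl
      obtain ⟨E, hE⟩ := exists_isArc_neg (p := p) hc (η := η) fun i => by
        obtain ⟨E, hE⟩ := hM i
        refine ⟨_, (hE.scale (fl i ^ (∑ j, M j - M i))).congr fun u _ => ?_⟩
        rw [← mul_assoc, ← mul_pow, ← pow_add,
          Nat.sub_add_cancel (Finset.single_le_sum (fun _ _ => Nat.zero_le _) (Finset.mem_univ i)),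
          sub_self]
        exact zero_mem _
      obtain ⟨τ', h1, h2⟩ := hE.exists_lift hs ha hq haJ hτJ hη
      refine ⟨τ', fun x => ?_, h2⟩
      have h3 := (hker _).1 (h1 x)
      rwa [map_sub, hτ, sub_eq_zero] at h3
  obtain ⟨τ, hτ, hτ0⟩ := key
  obtain ⟨t, ht⟩ := exists_algHom_factor hpr τ fun u hu => by
    simpa using hτ0 u hu
  refine ⟨t, fun x => ?_⟩
  obtain ⟨x, rfl⟩ := hpr x
  rw [ht, hτ]

end Global

end AffineDeformation

/-- Every locally trivial deformation of an affine algebraic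
`k`-scheme over an artinian local `k`-algebra `A` with residue field `k` is
trivial.  Concretely: let `R` be a finite type `k`-algebra, `B` a flat `A`-algebra
with a surjection `π : B → R` with kernel `m_A·B` (so `B ⊗_A k ≅ R`).  If there
are `f₁, …, f_r ∈ R` generating the unit ideal, lifts `g_i ∈ B` of `f_i`, and
`A`-algebra isomorphisms `φ_i : B[1/g_i] ≅ A ⊗_k R[1/f_i]` compatible with the
projections onto `R[1/f_i]`, then there is an `A`-algebra isomorphism
`ψ : B ≅ A ⊗_k R` compatible with the projections onto `R`. -/
theorem locally_trivial_affine_deformation_is_trivial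
    (k : Type*) [Field k] [IsAlgClosed k] (p : ℕ) [Fact p.Prime] [CharP k p]
    (R : Type*) [CommRing R] [Algebra k R] [Algebra.FiniteType k R]
    (A : Type*) [CommRing A] [Algebra k A] [IsArtinianRing A] [IsLocalRing A]
    (ε : A →ₐ[k] k) (hε : RingHom.ker ε.toRingHom = IsLocalRing.maximalIdeal A)
    (B : Type*) [CommRing B] [Algebra k B] [Algebra A B] [IsScalarTower k A B]
    [Module.Flat A B]
    (π : B →ₐ[k] R) (hπ : Function.Surjective π)
    (hkerπ : RingHom.ker π.toRingHom =
      (IsLocalRing.maximalIdeal A).map (algebraMap A B))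
    (r : ℕ) (f : Fin r → R) (g : Fin r → B)
    (hunit : Ideal.span (Set.range f) = ⊤)
    (hg : ∀ i, π (g i) = f i)
    (φ : ∀ i, Localization.Away (g i) ≃+* (A ⊗[k] Localization.Away (f i)))
    (hφA : ∀ i (a : A),
      φ i (algebraMap B (Localization.Away (g i)) (algebraMap A B a)) =
        algebraMap A (A ⊗[k] Localization.Away (f i)) a)
    -- `φ i` is compatible with the natural projections of both sides onto
    -- `R[1/f_i]` (the projection `B[1/g_i] → R[1/f_i]` being the unique ring
    -- homomorphism extending `π`, this is expressed on the image of `B`)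
    (hφcompat : ∀ i (b : B),
      tensorProj k A ε (Localization.Away (f i))
          (φ i (algebraMap B (Localization.Away (g i)) b)) =
        algebraMap R (Localization.Away (f i)) (π b)) :
    ∃ ψ : B ≃ₐ[A] (A ⊗[k] R), ∀ b : B, tensorProj k A ε R (ψ b) = π b := by
  have hnil : IsNilpotent (IsLocalRing.maximalIdeal A) := by
    rw [← IsLocalRing.jacobson_eq_maximalIdeal ⊥ bot_ne_top]
    exact IsArtinianRing.isNilpotent_jacobson_bot
  obtain ⟨N, hN⟩ := hnil
  let β : ∀ i, B →ₐ[A] A ⊗[k] Localization.Away (f i) := fun i =>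
    { (φ i).toRingHom.comp (algebraMap B (Localization.Away (g i))) with commutes' := hφA i }
  obtain ⟨t, ht⟩ := AffineDeformation.exists_section (p := p) hN hε hπ hkerπ f hunit β hφcompat
  exact AffineDeformation.exists_equiv_of_section hN hε hkerπ t ht
end
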